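/- Let K be a combinatorial d-manifold with boundary such that the boundary ∂K is an induced subcomplex of K, and let L be the simplicial complement of ∂K in K. Then the geometric carrier |K| collapses (as a polyhedron) to |L|. -/

import Mathlib

/- Formalization of definitions from:
   B. Bagchi, B. Datta, "Combinatorial triangulations of homology spheres". -/

open Finset

noncomputable section

attribute [local instance] Classical.propDecidable

namespace HomologySpheres

variable {V : Type*} [DecidableEq V] {W : Type*} [DecidableEq W]

/-- The vertex set of a finite family of finite sets. -/
def verts (K : Finset (Finset V)) : Finset V := K.sup id

/-- An (abstract, finite) simplicial complex: a nonempty collection of nonempty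
finite sets closed under taking nonempty subsets. -/
def IsComplex (K : Finset (Finset V)) : Prop :=
  K.Nonempty ∧ ∅ ∉ K ∧ ∀ s ∈ K, ∀ t : Finset V, t ⊆ s → t.Nonempty → t ∈ K

/-- The facets (maximal faces) of `K`. -/
def facets (K : Finset (Finset V)) : Finset (Finset V) :=
  K.filter fun s => ∀ t ∈ K, s ⊆ t → t = s

/-- `K` is pure of dimension `d`: every maximal face has `d + 1` vertices. -/
def IsPure (d : ℕ) (K : Finset (Finset V)) : Prop :=
  ∀ s ∈ facets K, s.card = d + 1

/-- The link of a face `σ` in `K`. -/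
def link (K : Finset (Finset V)) (σ : Finset V) : Finset (Finset V) :=
  K.filter fun τ => Disjoint τ σ ∧ τ ∪ σ ∈ K

/-- `L` is an induced (full) subcomplex of `K`. -/
def IsInduced (K L : Finset (Finset V)) : Prop :=
  L ⊆ K ∧ ∀ s ∈ K, s ⊆ verts L → s ∈ L

/-- The simplicial complement `C(L, K)`: the induced subcomplex of `K` on
`V(K) \ V(L)`. -/
def simpComplement (L K : Finset (Finset V)) : Finset (Finset V) :=
  K.filter fun s => s ⊆ verts K \ verts L

/-- The simplicial neighbourhood `N(L, K)`: the subcomplex of `K` whose maximal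
faces are the maximal faces of `K` meeting `V(L)`. -/
def simpNbhd (L K : Finset (Finset V)) : Finset (Finset V) :=
  K.filter fun s => ∃ t ∈ facets K, s ⊆ t ∧ (t ∩ verts L).Nonempty

/-- `fvec K i` is the number of `i`-dimensional faces of `K`. -/
def fvec (K : Finset (Finset V)) (i : ℕ) : ℕ :=
  (K.filter fun s => s.card = i + 1).card

/-- The number of facets of cardinality `d + 1` containing a given `(d-1)`-face
(the degree of the face in a (weak) pseudomanifold of dimension `d`). -/
def degOf (K : Finset (Finset V)) (d : ℕ) (s : Finset V) : ℕ :=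
  (K.filter fun t => s ⊆ t ∧ t.card = d + 1).card

/-- Simplicial isomorphism (via a vertex bijection carrying faces to faces). -/
def Iso (K : Finset (Finset V)) (L : Finset (Finset W)) : Prop :=
  ∃ f : V → W, Set.InjOn f ↑(verts K) ∧ L = K.image (Finset.image f)

/-- The join of two simplicial complexes (on disjoint vertex sets). -/
def sjoin (K L : Finset (Finset V)) : Finset (Finset V) :=
  K ∪ L ∪ (K ×ˢ L).image fun p => p.1 ∪ p.2

/-- The standard ball on vertex set `A`: all nonempty subsets of `A`. -/
def stdBall (A : Finset V) : Finset (Finset V) := A.powerset.erase ∅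

/-- The standard sphere on vertex set `A`: all nonempty proper subsets of `A`. -/
def stdSphere (A : Finset V) : Finset (Finset V) := (A.powerset.erase ∅).erase A

/-- `τ` is a free face of `K`, with `σ` the unique face properly containing it. -/
def IsFreeFace (K : Finset (Finset V)) (τ σ : Finset V) : Prop :=
  τ ∈ K ∧ σ ∈ K ∧ τ ⊂ σ ∧ ∀ ρ ∈ K, τ ⊂ ρ → ρ = σ

/-- An elementary collapse removes a free face together with the unique face
properly containing it. -/
def ElemCollapse (K K' : Finset (Finset V)) : Prop :=
  ∃ τ σ : Finset V, IsFreeFace K τ σ ∧ K' = (K.erase τ).erase σ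

/-- `K` collapses to `L` by a sequence of elementary collapses. -/
def CollapsesTo (K L : Finset (Finset V)) : Prop :=
  Relation.ReflTransGen ElemCollapse K L

/-- `K` is collapsible: it collapses to a single vertex. -/
def Collapsible (K : Finset (Finset V)) : Prop :=
  ∃ v : V, CollapsesTo K {{v}}

/-! ### Simplicial homology with `ℤ/2` coefficients (augmented chain complex).
A chain of level `n` is a `ZMod 2`-valued function supported on the faces of
cardinality `n` (the empty set, of cardinality `0`, serves as the `(-1)`-simplex
of the augmented complex).  Reduced homology in dimension `q` lives at level
`q + 1`. -/

/-- `c` is a chain of level `n` of `K` (over `ℤ/2`). -/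
def z2chainOK (K : Finset (Finset V)) (n : ℕ) (c : Finset V → ZMod 2) : Prop :=
  ∀ s : Finset V, c s ≠ 0 → s.card = n ∧ (s ∈ K ∨ s = ∅)

/-- The mod-2 boundary operator. -/
def z2bdry (K : Finset (Finset V)) (c : Finset V → ZMod 2) : Finset V → ZMod 2 :=
  fun t => ∑ v ∈ verts K \ t, c (insert v t)

/-- `K` is `ℤ/2`-acyclic: all reduced homology with `ℤ/2` coefficients vanishes,
i.e. in the augmented mod-2 chain complex every cycle is a boundary. -/
def Z2Acyclic (K : Finset (Finset V)) : Prop :=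
  ∀ (n : ℕ) (c : Finset V → ZMod 2), z2chainOK K n c → z2bdry K c = 0 →
    ∃ c', z2chainOK K (n + 1) c' ∧ z2bdry K c' = c

/-- `K` has the reduced `ℤ/2`-homology of the `d`-sphere: reduced homology
vanishes in all dimensions except `d` (level `d + 1`), where it is `ℤ/2`
(there is a cycle `z` which is not a boundary, and modulo boundaries every
cycle is `0` or `z`). -/
def Z2HomologySphere (d : ℕ) (K : Finset (Finset V)) : Prop :=
  (∀ (n : ℕ) (c : Finset V → ZMod 2), n ≠ d + 1 → z2chainOK K n c →
    z2bdry K c = 0 → ∃ c', z2chainOK K (n + 1) c' ∧ z2bdry K c' = c) ∧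
  (∃ z : Finset V → ZMod 2, z2chainOK K (d + 1) z ∧ z2bdry K z = 0 ∧
    (∀ c', z2chainOK K (d + 2) c' → z2bdry K c' ≠ z) ∧
    (∀ z', z2chainOK K (d + 1) z' → z2bdry K z' = 0 →
      (∃ c', z2chainOK K (d + 2) c' ∧ z2bdry K c' = z') ∨
      (∃ c', z2chainOK K (d + 2) c' ∧ z2bdry K c' = z + z')))

/-! ### Integral simplicial homology via ordered chains (Munkres §13: ordered
simplicial homology, allowing repeated vertices, agrees with simplicial
homology). An ordered `m`-tuple chain corresponds to dimension `m - 1`; the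
unique `0`-tuple is the `(-1)`-simplex of the augmented complex. -/

/-- `c` is an ordered chain of `K` over `ℤ`: supported on tuples whose image is
a face (the empty tuple being allowed in level `0`). -/
def zchainOK (K : Finset (Finset V)) {m : ℕ} (c : (Fin m → V) → ℤ) : Prop :=
  ∀ x : Fin m → V, c x ≠ 0 → (Finset.univ.image x ∈ K ∨ m = 0)

/-- The integral boundary operator on ordered chains. -/
def zbdry (K : Finset (Finset V)) {m : ℕ} (c : (Fin (m + 1) → V) → ℤ) :
    (Fin m → V) → ℤ :=
  fun y => ∑ i : Fin (m + 1), (-1 : ℤ) ^ (i : ℕ) * ∑ v ∈ verts K, c (i.insertNth v y)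

/-- `K` has the reduced integral homology of the `d`-sphere: reduced homology
vanishes in all dimensions except `d`, where it is infinite cyclic (there is a
cycle `z` such that every cycle is, modulo boundaries, a unique multiple of `z`). -/
def ZHomologySphere (d : ℕ) (K : Finset (Finset V)) : Prop :=
  (∀ c : (Fin 0 → V) → ℤ, ∃ c' : (Fin 1 → V) → ℤ, zchainOK K c' ∧ zbdry K c' = c) ∧
  (∀ (m : ℕ) (c : (Fin (m + 1) → V) → ℤ), m ≠ d → zchainOK K c → zbdry K c = 0 →
    ∃ c' : (Fin (m + 2) → V) → ℤ, zchainOK K c' ∧ zbdry K c' = c) ∧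
  (∃ z : (Fin (d + 1) → V) → ℤ, zchainOK K z ∧ zbdry K z = 0 ∧
    ∀ z' : (Fin (d + 1) → V) → ℤ, zchainOK K z' → zbdry K z' = 0 →
      ∃! k : ℤ, ∃ c'' : (Fin (d + 2) → V) → ℤ,
        zchainOK K c'' ∧ zbdry K c'' = z' - k • z)

/-- A weak pseudomanifold of dimension `d`: pure, and every `(d-1)`-face is in
exactly two facets. -/
def IsWeakPseudomanifold (d : ℕ) (K : Finset (Finset V)) : Prop :=
  IsComplex K ∧ IsPure d K ∧ ∀ s ∈ K, s.card = d → degOf K d s = 2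

/-- Adjacency of facets along a common `(d-1)`-face. -/
def FacetAdj (d : ℕ) (K : Finset (Finset V)) (s t : Finset V) : Prop :=
  s ∈ K ∧ t ∈ K ∧ s.card = d + 1 ∧ t.card = d + 1 ∧ (s ∩ t).card = d

/-- A pseudomanifold: a weak pseudomanifold in which any two facets are joined
by a chain of facets, consecutive ones sharing a `(d-1)`-face. -/
def IsPseudomanifold (d : ℕ) (K : Finset (Finset V)) : Prop :=
  IsWeakPseudomanifold d K ∧ ∀ s ∈ K, ∀ t ∈ K, s.card = d + 1 → t.card = d + 1 →
    Relation.ReflTransGen (FacetAdj d K) s t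

/-- A weak pseudomanifold with boundary. -/
def IsWeakPseudomanifoldWithBdry (d : ℕ) (K : Finset (Finset V)) : Prop :=
  IsComplex K ∧ IsPure d K ∧
  (∀ s ∈ K, s.card = d → degOf K d s = 1 ∨ degOf K d s = 2) ∧
  (∃ s ∈ K, s.card = d ∧ degOf K d s = 1)

/-- The boundary complex: all faces of degree-one `(d-1)`-faces. -/
def bdryComplex (d : ℕ) (K : Finset (Finset V)) : Finset (Finset V) :=
  K.filter fun t => ∃ s ∈ K, t ⊆ s ∧ s.card = d ∧ degOf K d s = 1

/-- `K` is connected (any two vertices joined by a path of edges). -/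
def SConnected (K : Finset (Finset V)) : Prop :=
  ∀ u ∈ verts K, ∀ v ∈ verts K,
    Relation.ReflTransGen (fun a b : V => ({a, b} : Finset V) ∈ K) u v

/-! ### Geometric realizations, subdivisions and combinatorial equivalence. -/

/-- A geometric simplicial complex in `ℝ^ℕ`: finitely many geometric simplices
(affinely independent vertex sets), closed under faces, any two of which meet
in a common face. -/
structure GComplex where
  faces : Finset (Finset (ℕ → ℝ))
  nonempty : faces.Nonempty
  empty_not_mem : ∅ ∉ faces
  down_closed : ∀ s ∈ faces, ∀ t : Finset (ℕ → ℝ), t ⊆ s → t.Nonempty → t ∈ faces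
  indep : ∀ s ∈ faces,
    AffineIndependent ℝ (fun x : {y : ℕ → ℝ // y ∈ s} => (x : ℕ → ℝ))
  glue : ∀ s ∈ faces, ∀ t ∈ faces,
    convexHull ℝ (s : Set (ℕ → ℝ)) ∩ convexHull ℝ (t : Set (ℕ → ℝ)) =
      convexHull ℝ ((s ∩ t : Finset (ℕ → ℝ)) : Set (ℕ → ℝ))

/-- The geometric carrier (underlying polyhedron) of a geometric complex. -/
def GComplex.carrier (G : GComplex) : Set (ℕ → ℝ) :=
  ⋃ s ∈ G.faces, convexHull ℝ (s : Set (ℕ → ℝ))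

/-- `G` realizes the abstract complex `K` via the vertex map `f`. -/
def RealizesMap (G : GComplex) (K : Finset (Finset V)) (f : V → ℕ → ℝ) : Prop :=
  Set.InjOn f ↑(verts K) ∧ G.faces = K.image (Finset.image f)

/-- `G` is a geometric realization of the abstract complex `K`. -/
def Realizes (G : GComplex) (K : Finset (Finset V)) : Prop :=
  ∃ f : V → ℕ → ℝ, RealizesMap G K f

/-- `G'` is a subdivision of `G`: same carrier, and every simplex of `G'` is
contained in a simplex of `G`. -/
def Subdivides (G' G : GComplex) : Prop :=
  G'.carrier = G.carrier ∧
  ∀ s ∈ G'.faces, ∃ t ∈ G.faces,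
    convexHull ℝ (s : Set (ℕ → ℝ)) ⊆ convexHull ℝ (t : Set (ℕ → ℝ))

/-- Combinatorial equivalence: `K` and `L` admit isomorphic subdivisions. -/
def CombEquiv (K : Finset (Finset V)) (L : Finset (Finset W)) : Prop :=
  ∃ G1 G1' G2 G2' : GComplex, Realizes G1 K ∧ Realizes G2 L ∧
    Subdivides G1' G1 ∧ Subdivides G2' G2 ∧ Iso G1'.faces G2'.faces

/-- A combinatorial `d`-ball: combinatorially equivalent to the standard ball. -/
def IsCombBall (d : ℕ) (K : Finset (Finset V)) : Prop :=
  ∃ A : Finset ℕ, A.card = d + 1 ∧ CombEquiv K (stdBall A)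

/-- A combinatorial `d`-sphere: combinatorially equivalent to the standard sphere. -/
def IsCombSphere (d : ℕ) (K : Finset (Finset V)) : Prop :=
  ∃ A : Finset ℕ, A.card = d + 2 ∧ CombEquiv K (stdSphere A)

/-- A combinatorial `d`-manifold: every vertex link is a combinatorial
`(d-1)`-sphere. -/
def IsCombManifold (d : ℕ) (K : Finset (Finset V)) : Prop :=
  IsComplex K ∧ ∀ v ∈ verts K, IsCombSphere (d - 1) (link K {v})

/-- A combinatorial `d`-manifold with boundary. -/
def IsCombManifoldWithBdry (d : ℕ) (K : Finset (Finset V)) : Prop :=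
  IsComplex K ∧
  (∀ v ∈ verts K, IsCombSphere (d - 1) (link K {v}) ∨
    IsCombBall (d - 1) (link K {v})) ∧
  (∃ v ∈ verts K, IsCombBall (d - 1) (link K {v}))

/-- A pl `k`-ball: a polyhedron carried by some geometric complex whose face
structure is a combinatorial `k`-ball. -/
def IsPLBall (k : ℕ) (P : Set (ℕ → ℝ)) : Prop :=
  ∃ G : GComplex, G.carrier = P ∧ IsCombBall k G.faces

/-- Elementary polyhedral collapse: `P = P' ∪ B` with `B` a pl `k`-ball and
`P' ∩ B` a pl `(k-1)`-ball. -/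
def PolyElemCollapse (P P' : Set (ℕ → ℝ)) : Prop :=
  ∃ k : ℕ, 1 ≤ k ∧ ∃ B : Set (ℕ → ℝ),
    IsPLBall k B ∧ P = P' ∪ B ∧ IsPLBall (k - 1) (P' ∩ B)

/-- Polyhedral collapse. -/
def PolyCollapsesTo (P Q : Set (ℕ → ℝ)) : Prop :=
  Relation.ReflTransGen PolyElemCollapse P Q

/-- Carrier of a subcomplex under a vertex realization map `f`. -/
def subCarrier (f : V → ℕ → ℝ) (L : Finset (Finset V)) : Set (ℕ → ℝ) :=
  ⋃ s ∈ L, convexHull ℝ ((s.image f : Finset (ℕ → ℝ)) : Set (ℕ → ℝ))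

/-! ### Bistellar moves. -/

/-- The core `β = {x ∈ A : A \ {x} ∈ X}` of a `(d+2)`-set `A`. -/
def bcore (X : Finset (Finset V)) (A : Finset V) : Finset V :=
  A.filter fun x => A.erase x ∈ X

/-- `κ_A` is a bistellar `i`-move on the `d`-dimensional complex `X`:
`A` has `d + 2` elements and contains at least one and at most `d + 1` facets
of `X`; with `β` the core of `A` and `α = A \ β` an `i`-face of `X`, one has
`β ∉ X`, and either `α` is a facet of `X` or `Lk_X(α)` has vertex set `β`. -/
def BistellarIMove (d i : ℕ) (X : Finset (Finset V)) (A : Finset V) : Prop :=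
  A.card = d + 2 ∧
  0 < ((facets X).filter fun σ => σ ⊆ A).card ∧
  ((facets X).filter fun σ => σ ⊆ A).card ≤ d + 1 ∧
  bcore X A ∉ X ∧
  A \ bcore X A ∈ X ∧ (A \ bcore X A).card = i + 1 ∧
  (A \ bcore X A ∈ facets X ∨ verts (link X (A \ bcore X A)) = bcore X A)

/-! ### The explicit small complexes of the paper. -/

/-- The complex generated by a list of facets: all nonempty subsets thereof. -/
def genBy (F : Finset (Finset ℕ)) : Finset (Finset ℕ) :=
  F.sup fun s => s.powerset.erase ∅

/-- The standard 2-sphere `S²₄`. -/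
def S24 : Finset (Finset ℕ) := stdSphere {1, 2, 3, 4}

/-- The join `S¹₃ * S⁰₂`. -/
def S13S02 : Finset (Finset ℕ) := sjoin (stdSphere {1, 2, 3}) (stdSphere {4, 5})

/-- The octahedron `S⁰₂ * S⁰₂ * S⁰₂`. -/
def Octa : Finset (Finset ℕ) :=
  sjoin (stdSphere {1, 2}) (sjoin (stdSphere {3, 4}) (stdSphere {5, 6}))

/-- The 6-vertex real projective plane `ℝP²₆`. -/
def RP26 : Finset (Finset ℕ) :=
  genBy {{1, 2, 3}, {1, 2, 4}, {1, 3, 5}, {1, 4, 6}, {1, 5, 6},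
         {2, 3, 6}, {2, 4, 5}, {2, 5, 6}, {3, 4, 5}, {3, 4, 6}}

/-- `Σ₁`: the 6-vertex 2-sphere with a vertex of degree 3 and one of degree 5. -/
def Sigma1 : Finset (Finset ℕ) :=
  genBy {{1, 2, 5}, {1, 2, 6}, {1, 5, 6}, {2, 3, 5},
         {2, 3, 6}, {3, 4, 5}, {3, 4, 6}, {4, 5, 6}}

/-- The double pyramid `S¹₅ * S⁰₂`. -/
def S15S02 : Finset (Finset ℕ) :=
  sjoin (genBy {{1, 2}, {2, 3}, {3, 4}, {4, 5}, {1, 5}}) (stdSphere {6, 7})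

/-- `Σ₂` (7-vertex 2-sphere with 10 triangles). -/
def Sigma2 : Finset (Finset ℕ) :=
  genBy {{1, 2, 6}, {1, 2, 7}, {1, 6, 7}, {2, 3, 6}, {2, 3, 7},
         {3, 4, 6}, {3, 4, 7}, {4, 5, 6}, {4, 5, 7}, {5, 6, 7}}

/-- `Σ₃` (7-vertex 2-sphere with 10 triangles). -/
def Sigma3 : Finset (Finset ℕ) :=
  genBy {{1, 2, 6}, {1, 2, 7}, {1, 6, 7}, {2, 3, 4}, {2, 3, 7},
         {2, 4, 6}, {3, 4, 7}, {4, 5, 6}, {4, 5, 7}, {5, 6, 7}}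

/-- `Σ₄` (7-vertex 2-sphere with 10 triangles). -/
def Sigma4 : Finset (Finset ℕ) :=
  genBy {{1, 2, 4}, {1, 2, 7}, {1, 4, 5}, {1, 5, 6}, {1, 6, 7},
         {2, 3, 4}, {2, 3, 7}, {3, 4, 7}, {4, 5, 7}, {5, 6, 7}}

/-- `Σ₅` (7-vertex 2-sphere with 10 triangles). -/
def Sigma5 : Finset (Finset ℕ) :=
  genBy {{1, 2, 3}, {1, 2, 6}, {1, 3, 5}, {1, 5, 6}, {2, 3, 4},
         {2, 4, 6}, {3, 4, 5}, {4, 5, 7}, {4, 6, 7}, {5, 6, 7}}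

/-- `Υ₁ = S²₄ ∪ S²₄`: two tetrahedral spheres sharing exactly one vertex. -/
def Upsilon1 : Finset (Finset ℕ) :=
  stdSphere {1, 2, 3, 7} ∪ stdSphere {4, 5, 6, 7}

/-- `Υ₂ = S²₄ ∪ (S⁰₂ * S¹₃)`: a tetrahedral sphere and a join, where the two
common vertices span an edge of the `S²₄`. -/
def Upsilon2 : Finset (Finset ℕ) :=
  stdSphere {4, 5, 6, 7} ∪ sjoin (stdSphere {6, 7}) (stdSphere {1, 2, 3})

/-- The complex `R` obtained from `ℝP²₆` by the generalized bistellar 1-move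
`κ_A`, `A = {1, 2, 5, 6}` (all such choices of `A` yield isomorphic complexes). -/
def Rcomplex : Finset (Finset ℕ) :=
  genBy {{1, 2, 3}, {1, 2, 4}, {1, 2, 5}, {1, 2, 6}, {1, 3, 5},
         {1, 4, 6}, {2, 3, 6}, {2, 4, 5}, {3, 4, 5}, {3, 4, 6}}



/-! ### Weights, realizations -/

/-- Total weight. -/
def tot {V : Type*} : (V →₀ ℝ) →ₗ[ℝ] ℝ := Finsupp.linearCombination ℝ (fun _ => (1 : ℝ))

/-- Evaluation of weights. -/
abbrev lam {V E : Type*} [AddCommGroup E] [Module ℝ E] (f : V → E) : (V →₀ ℝ) →ₗ[ℝ] E :=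
  Finsupp.linearCombination ℝ f

/-- Closed simplex of weights. -/
def Sx {V : Type*} (s : Finset V) : Set (V →₀ ℝ) :=
  {w | (∀ v, 0 ≤ w v) ∧ w.support ⊆ s ∧ tot w = 1}

/-- Weights with support in `K`. -/
def Wt {V : Type*} (K : Set (Finset V)) : Set (V →₀ ℝ) :=
  {w | (∀ v, 0 ≤ w v) ∧ w.support ∈ K ∧ tot w = 1}

/-- Set-level complexes. -/
def Cpx {V : Type*} (K : Set (Finset V)) : Prop :=
  ∅ ∉ K ∧ ∀ s ∈ K, ∀ t ⊆ s, t.Nonempty → t ∈ K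

/-- Geometric realization. -/
def GR {V E : Type*} [AddCommGroup E] [Module ℝ E] (f : V → E) (K : Set (Finset V)) : Prop :=
  Set.InjOn (lam f) (Wt K)

/-- Carrier. -/
def car {V E : Type*} [AddCommGroup E] [Module ℝ E] (f : V → E) (K : Set (Finset V)) : Set E :=
  lam f '' Wt K

section basics
variable {X E F : Type*} [AddCommGroup E] [Module ℝ E] [AddCommGroup F] [Module ℝ F]

@[simp] lemma tot_single (v : X) (a : ℝ) : tot (Finsupp.single v a) = a := by
  simp [tot]

lemma tot_eq_sum (w : X →₀ ℝ) (s : Finset X) (h : w.support ⊆ s) : tot w = ∑ v ∈ s, w v := by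
  rw [tot, Finsupp.linearCombination_apply, Finsupp.sum_of_support_subset _ h _ (by simp)]
  simp

lemma lam_eq_sum (f : X → E) (w : X →₀ ℝ) (s : Finset X) (h : w.support ⊆ s) :
    lam f w = ∑ v ∈ s, w v • f v := by
  rw [lam, Finsupp.linearCombination_apply, Finsupp.sum_of_support_subset _ h _ (by simp)]

lemma lam_comp (f : X → E) (g : E →ₗ[ℝ] F) (w : X →₀ ℝ) :
    lam (fun v => g (f v)) w = g (lam f w) := by
  simp [lam, Finsupp.linearCombination_apply, Finsupp.sum, map_sum]

lemma lam_prod (f : X → E) (g : X → F) (w : X →₀ ℝ) :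
    lam (fun v => (f v, g v)) w = (lam f w, lam g w) := by
  refine Prod.ext ?_ ?_
  · exact (lam_comp (fun v => (f v, g v)) (LinearMap.fst ℝ E F) w).symm
  · exact (lam_comp (fun v => (f v, g v)) (LinearMap.snd ℝ E F) w).symm

lemma lam_sub_const (f : X → E) (o : E) (w : X →₀ ℝ) :
    lam (fun v => f v - o) w = lam f w - tot w • o := by
  simp only [lam, tot, Finsupp.linearCombination_apply, Finsupp.sum, smul_sub,
    Finset.sum_sub_distrib, Finset.sum_smul, smul_eq_mul, mul_one]

lemma Sx_convex (s : Finset X) : Convex ℝ (Sx s) := by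
  intro w hw u hu a b ha hb hab
  refine ⟨fun v => ?_, ?_, ?_⟩
  · have := hw.1 v; have := hu.1 v
    simp only [Finsupp.add_apply, Finsupp.smul_apply, smul_eq_mul]; positivity
  · refine Finsupp.support_add.trans (Finset.union_subset ?_ ?_)
    · exact Finsupp.support_smul.trans hw.2.1
    · exact Finsupp.support_smul.trans hu.2.1
  · simp [hw.2.2, hu.2.2, hab]

lemma single_mem_Sx {s : Finset X} {v : X} (h : v ∈ s) : Finsupp.single v (1 : ℝ) ∈ Sx s := by
  refine ⟨fun u => ?_, ?_, by simp⟩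
  · by_cases h : v = u <;> simp [Finsupp.single_apply, h]
  · exact Finsupp.support_single_subset.trans (by simpa using h)

lemma lam_Sx (f : X → E) (s : Finset X) : lam f '' Sx s = convexHull ℝ (f '' (s : Set X)) := by
  apply Set.Subset.antisymm
  · rintro _ ⟨w, hw, rfl⟩
    rw [lam_eq_sum f w s hw.2.1]
    refine (convex_convexHull ℝ _).sum_mem (fun v _ => hw.1 v) ?_ ?_
    · rw [← tot_eq_sum w s hw.2.1, hw.2.2]
    · intro v hv
      exact subset_convexHull ℝ _ ⟨v, hv, rfl⟩
  · refine convexHull_min ?_ ((Sx_convex s).linear_image (lam f))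
    rintro _ ⟨v, hv, rfl⟩
    exact ⟨_, single_mem_Sx hv, by simp⟩

lemma Wt_Sx {K : Set (Finset X)} {w : X →₀ ℝ} (hw : w ∈ Wt K) : w ∈ Sx w.support :=
  ⟨hw.1, subset_rfl, hw.2.2⟩

lemma support_nonempty {w : X →₀ ℝ} (h : tot w = 1) : w.support.Nonempty := by
  rw [Finsupp.support_nonempty_iff]
  rintro rfl
  simp at h

lemma Sx_Wt {K : Set (Finset X)} (hK : Cpx K) {s : Finset X} (hs : s ∈ K) : Sx s ⊆ Wt K :=
  fun w hw => ⟨hw.1, hK.2 s hs _ hw.2.1 (support_nonempty hw.2.2), hw.2.2⟩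

lemma Sx_mono {s t : Finset X} (h : s ⊆ t) : Sx s ⊆ Sx t :=
  fun _ hw => ⟨hw.1, hw.2.1.trans h, hw.2.2⟩

lemma Wt_mono {K L : Set (Finset X)} (h : K ⊆ L) : Wt K ⊆ Wt L :=
  fun _ hw => ⟨hw.1, h hw.2.1, hw.2.2⟩

lemma GR.mono {f : X → E} {K L : Set (Finset X)} (hf : GR f L) (h : K ⊆ L) : GR f K :=
  Set.InjOn.mono (Wt_mono h) hf

lemma car_eq {f : X → E} {K : Set (Finset X)} (hK : Cpx K) :
    car f K = ⋃ s ∈ K, convexHull ℝ (f '' (s : Set X)) := by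
  ext x
  simp only [Set.mem_iUnion]
  constructor
  · rintro ⟨w, hw, rfl⟩
    refine ⟨w.support, hw.2.1, ?_⟩
    rw [← lam_Sx]
    exact ⟨w, Wt_Sx hw, rfl⟩
  · rintro ⟨s, hs, hx⟩
    rw [← lam_Sx] at hx
    obtain ⟨w, hw, rfl⟩ := hx
    exact ⟨w, Sx_Wt hK hs hw, rfl⟩

lemma conv_subset_car {f : X → E} {K : Set (Finset X)} (hK : Cpx K) {s : Finset X} (hs : s ∈ K) :
    convexHull ℝ (f '' (s : Set X)) ⊆ car f K := by
  rw [← lam_Sx]; exact Set.image_mono (Sx_Wt hK hs)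

lemma car_inter {f : X → E} {M K L : Set (Finset X)} (hf : GR f M) (hK : K ⊆ M) (hL : L ⊆ M) :
    car f K ∩ car f L = car f (K ∩ L) := by
  rw [car, car, ← hf.image_inter (Wt_mono hK) (Wt_mono hL), car]
  congr 1
  ext w
  constructor
  · rintro ⟨h, h'⟩
    exact ⟨h.1, ⟨h.2.1, h'.2.1⟩, h.2.2⟩
  · rintro h
    exact ⟨⟨h.1, h.2.1.1, h.2.2⟩, ⟨h.1, h.2.1.2, h.2.2⟩⟩

lemma car_union {f : X → E} {K L : Set (Finset X)} :
    car f (K ∪ L) = car f K ∪ car f L := by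
  rw [car, car, car, ← Set.image_union]
  congr 1
  ext w
  constructor
  · rintro ⟨h, h1 | h1, h2⟩
    · exact Or.inl ⟨h, h1, h2⟩
    · exact Or.inr ⟨h, h1, h2⟩
  · rintro (⟨h, h1, h2⟩ | ⟨h, h1, h2⟩)
    · exact ⟨h, Or.inl h1, h2⟩
    · exact ⟨h, Or.inr h1, h2⟩

/-- Uniform weights. -/
def unif (s : Finset X) : X →₀ ℝ := ∑ v ∈ s, Finsupp.single v ((s.card : ℝ)⁻¹)

lemma unif_apply (s : Finset X) (v : X) : unif s v = if v ∈ s then (s.card : ℝ)⁻¹ else 0 := by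
  simp only [unif, Finsupp.finset_sum_apply, Finsupp.single_apply]
  simp

lemma unif_pos {s : Finset X} {v : X} (h : v ∈ s) : 0 < unif s v := by
  rw [unif_apply, if_pos h]
  have : 0 < s.card := Finset.card_pos.2 ⟨v, h⟩
  positivity

lemma unif_support (s : Finset X) : (unif s).support = s := by
  ext v
  rw [Finsupp.mem_support_iff]
  constructor
  · intro h; by_contra hv; apply h; rw [unif_apply, if_neg hv]
  · intro h; exact (unif_pos h).ne'

lemma unif_nonneg (s : Finset X) (v : X) : 0 ≤ unif s v := by
  rw [unif_apply]; split_ifs <;> positivity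

lemma unif_tot {s : Finset X} (h : s.Nonempty) : tot (unif s) = 1 := by
  rw [unif, map_sum]
  simp only [tot_single, Finset.sum_const, nsmul_eq_mul]
  have : (s.card : ℝ) ≠ 0 := by exact_mod_cast (Finset.card_pos.2 h).ne'
  field_simp

lemma unif_mem_Sx {s : Finset X} (h : s.Nonempty) : unif s ∈ Sx s :=
  ⟨unif_nonneg s, (unif_support s).subset, unif_tot h⟩

lemma unif_mem_Wt {K : Set (Finset X)} (hK : Cpx K) {s : Finset X} (h : s ∈ K) : unif s ∈ Wt K := by
  refine Sx_Wt hK h (unif_mem_Sx ?_)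
  rw [Finset.nonempty_iff_ne_empty]; rintro rfl; exact hK.1 h

/-- small perturbation of the uniform weight -/
lemma unif_perturb {s : Finset X} (h : s.Nonempty) (d : X →₀ ℝ) (hd : d.support ⊆ s) :
    ∃ ε > (0 : ℝ), ∀ v, 0 ≤ (unif s + ε • d) v := by
  have hc : (0 : ℝ) < s.card := by exact_mod_cast Finset.card_pos.2 h
  set M : ℝ := ∑ v ∈ s, |d v| with hM
  have hM0 : 0 ≤ M := Finset.sum_nonneg fun _ _ => abs_nonneg _
  refine ⟨(s.card * (M + 1))⁻¹, by positivity, fun v => ?_⟩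
  by_cases hv : v ∈ s
  · simp only [Finsupp.add_apply, Finsupp.smul_apply, smul_eq_mul, unif_apply, if_pos hv]
    have h1 : |d v| ≤ M := Finset.single_le_sum (f := fun v => |d v|) (fun _ _ => abs_nonneg _) hv
    have h2 : -(M + 1) ≤ d v := by have := neg_abs_le (d v); linarith
    have : (s.card : ℝ)⁻¹ = (s.card * (M + 1))⁻¹ * (M + 1) := by field_simp
    rw [this, ← mul_add]
    apply mul_nonneg <;> [positivity; linarith]
  · have : d v = 0 := by
      by_contra h'; exact hv (hd (Finsupp.mem_support_iff.2 h'))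
    simp [this, unif_nonneg]

/-- Injectivity on a closed simplex kills dependencies. -/
lemma dep_zero {f : X → E} {s : Finset X} (hs : s.Nonempty) (hf : Set.InjOn (lam f) (Sx s))
    (d : X →₀ ℝ) (hd : d.support ⊆ s) (h0 : tot d = 0) (h1 : lam f d = 0) : d = 0 := by
  obtain ⟨ε, he, h⟩ := unif_perturb hs d hd
  have hm : unif s + ε • d ∈ Sx s := by
    refine ⟨h, ?_, by simp [h0, unif_tot hs]⟩
    refine Finsupp.support_add.trans (Finset.union_subset (unif_support s).subset ?_)
    exact Finsupp.support_smul.trans hd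
  have := hf hm (unif_mem_Sx hs) (by simp [h1])
  have h2 : ε • d = 0 := by simpa using this
  exact (smul_eq_zero.1 h2).resolve_left he.ne'

end basics

/-! ### The core flag decomposition -/

/-- A conical region with a labelling into cells. -/
structure Fan {V ι : Type*} [AddCommGroup V] [Module ℝ V] (C : Set V) (c : V → Finset ι) :
    Prop where
  zero : (0 : V) ∉ C
  sub : ∀ x ∈ C, ∀ q ∈ C, c x = c q →
    ∃ t > (0 : ℝ), x = t • q ∨ (x - t • q ∈ C ∧ c (x - t • q) ⊂ c x)
  add : ∀ y ∈ C, ∀ q ∈ C, c y ⊂ c q → ∀ a > (0 : ℝ), y + a • q ∈ C ∧ c (y + a • q) = c q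
  smul : ∀ q ∈ C, ∀ a > (0 : ℝ), a • q ∈ C ∧ c (a • q) = c q

/-- Nonempty chains in a set of finsets. -/
def Ch {ι : Type*} (Q : Set (Finset ι)) : Set (Finset (Finset ι)) :=
  {s | s.Nonempty ∧ (∀ a ∈ s, a ∈ Q) ∧ ∀ a ∈ s, ∀ b ∈ s, a ⊆ b ∨ b ⊆ a}

lemma Ch_cpx {ι : Type*} (Q : Set (Finset ι)) : Cpx (Ch Q) := by
  refine ⟨fun h => by simpa using h.1, fun s hs t ht hn => ⟨hn, fun a ha => hs.2.1 a (ht ha), ?_⟩⟩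
  exact fun a ha b hb => hs.2.2 a (ht ha) b (ht hb)

/-- A maximum of a chain. -/
lemma chain_max {ι : Type*} {s : Finset (Finset ι)} (hn : s.Nonempty)
    (hc : ∀ a ∈ s, ∀ b ∈ s, a ⊆ b ∨ b ⊆ a) : ∃ m ∈ s, ∀ a ∈ s, a ⊆ m := by
  obtain ⟨m, hm, h⟩ := s.exists_max_image Finset.card hn
  refine ⟨m, hm, fun a ha => ?_⟩
  rcases hc a ha m hm with h1 | h1
  · exact h1
  · exact (Finset.eq_of_subset_of_card_le h1 (h a ha)).symm.subset

section core
variable {V ι : Type*} [AddCommGroup V] [Module ℝ V] {C : Set V} {c : V → Finset ι}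

/-- Positive weights supported on chains of cells. -/
def Cw (Q : Set (Finset ι)) : Set (Finset ι →₀ ℝ) := {w | (∀ k, 0 ≤ w k) ∧ w.support ∈ Ch Q}

lemma Cw_split {Q : Set (Finset ι)} {w : Finset ι →₀ ℝ} (hw : w ∈ Cw Q) {m : Finset ι}
    (hm : m ∈ w.support) (hmax : ∀ a ∈ w.support, a ⊆ m) :
    w = w.erase m + Finsupp.single m (w m) ∧ 0 < w m ∧ m ∈ Q ∧
    (w.erase m = 0 ∨ (w.erase m ∈ Cw Q ∧ ∀ a ∈ (w.erase m).support, a ⊂ m)) := by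
  refine ⟨(Finsupp.erase_add_single m w).symm, ?_, hw.2.2.1 m hm, ?_⟩
  · exact lt_of_le_of_ne (hw.1 m) (Ne.symm (Finsupp.mem_support_iff.1 hm))
  · by_cases h : w.erase m = 0
    · exact Or.inl h
    · refine Or.inr ⟨⟨fun k => ?_, ?_⟩, fun a ha => ?_⟩
      · by_cases hk : k = m
        · simp [hk]
        · simp [Finsupp.erase_ne hk, hw.1 k]
      · refine (Ch_cpx Q).2 _ hw.2 _ ?_ (Finsupp.support_nonempty_iff.2 h)
        rw [Finsupp.support_erase]; exact Finset.erase_subset _ _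
      · rw [Finsupp.support_erase, Finset.mem_erase] at ha
        exact Finset.ssubset_iff_subset_ne.2 ⟨hmax a ha.2, ha.1⟩

variable {p : Finset ι → V}

lemma core_maps (hF : Fan C c) (hp : ∀ x ∈ C, p (c x) ∈ C ∧ c (p (c x)) = c x) :
    ∀ w ∈ Cw (c '' C), lam p w ∈ C ∧ c (lam p w) ∈ w.support ∧ ∀ a ∈ w.support, a ⊆ c (lam p w) := by
  suffices H : ∀ n, ∀ w ∈ Cw (c '' C), w.support.card = n → lam p w ∈ C ∧ c (lam p w) ∈ w.support ∧
      ∀ a ∈ w.support, a ⊆ c (lam p w) from fun w hw => H _ w hw rfl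
  intro n
  induction n using Nat.strong_induction_on with
  | _ n ih =>
    intro w hw hn
    obtain ⟨m, hm, hmax⟩ := chain_max hw.2.1 hw.2.2.2
    obtain ⟨h1, h2, ⟨x, hx, rfl⟩, h4⟩ := Cw_split hw hm hmax
    have hpm := hp x hx
    have key : lam p w ∈ C ∧ c (lam p w) = c x := by
      rcases h4 with h4 | ⟨h4, h5⟩
      · rw [h4, zero_add] at h1
        rw [h1, lam, Finsupp.linearCombination_single]
        have := hF.smul _ hpm.1 _ h2
        exact ⟨this.1, this.2.trans hpm.2⟩
      · have hlt : (w.erase (c x)).support.card < n := by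
          rw [← hn, Finsupp.support_erase]; exact Finset.card_erase_lt_of_mem hm
        obtain ⟨i1, i2, i3⟩ := ih _ hlt _ h4 rfl
        have := hF.add _ i1 _ hpm.1 (by rw [hpm.2]; exact h5 _ i2) _ h2
        rw [h1, map_add, lam, Finsupp.linearCombination_single]
        exact ⟨this.1, this.2.trans hpm.2⟩
    refine ⟨key.1, by rw [key.2]; exact hm, by rw [key.2]; exact hmax⟩

lemma core_inj (hF : Fan C c) (hp : ∀ x ∈ C, p (c x) ∈ C ∧ c (p (c x)) = c x) :
    Set.InjOn (lam p) (Cw (c '' C)) := by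
  suffices H : ∀ n, ∀ w ∈ Cw (c '' C), ∀ u ∈ Cw (c '' C), w.support.card = n →
      lam p w = lam p u → w = u from fun w hw u hu h => H _ w hw u hu rfl h
  -- splitting at the top label
  have split : ∀ w ∈ Cw (c '' C), ∃ a > (0 : ℝ), ∃ r : Finset ι →₀ ℝ, w = r + Finsupp.single (c (lam p w)) a ∧
      r.support.card < w.support.card ∧
      (r = 0 ∨ (r ∈ Cw (c '' C) ∧ c (lam p r) ⊂ c (lam p w))) := by
    intro w hw
    obtain ⟨h1, h2, h3⟩ := core_maps hF hp w hw
    obtain ⟨i1, i2, i3, i4⟩ := Cw_split hw h2 h3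
    refine ⟨_, i2, _, i1, ?_, ?_⟩
    · rw [Finsupp.support_erase]; exact Finset.card_erase_lt_of_mem h2
    · rcases i4 with i4 | ⟨i4, i5⟩
      · exact Or.inl i4
      · exact Or.inr ⟨i4, i5 _ (core_maps hF hp _ i4).2.1⟩
  -- comparison of the coefficients of the top label
  have cmp : ∀ q ∈ C, ∀ a b : ℝ, ∀ r s : Finset ι →₀ ℝ,
      (r = 0 ∨ (r ∈ Cw (c '' C) ∧ c (lam p r) ⊂ c q)) →
      (s = 0 ∨ (s ∈ Cw (c '' C) ∧ c (lam p s) ⊂ c q)) →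
      lam p r + a • q = lam p s + b • q → ¬ a < b := by
    intro q hq a b r s hr hs h hab
    have h' : lam p r = lam p s + (b - a) • q := by
      rw [sub_smul]; rw [← sub_eq_zero] at h ⊢; rw [← h]; abel
    have h2 : lam p s + (b - a) • q ∈ C ∧ c (lam p s + (b - a) • q) = c q := by
      rcases hs with rfl | ⟨hs, hs'⟩
      · simpa using hF.smul q hq (b - a) (by linarith)
      · exact hF.add _ (core_maps hF hp _ hs).1 q hq hs' _ (by linarith)
    rw [← h'] at h2
    rcases hr with rfl | ⟨hr, hr'⟩
    · exact hF.zero (by simpa using h2.1)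
    · rw [h2.2] at hr'; exact hr'.2 subset_rfl
  intro n
  induction n using Nat.strong_induction_on with
  | _ n ih =>
    intro w hw u hu hn h
    obtain ⟨a, ha, r, hr, hcard, hr'⟩ := split w hw
    obtain ⟨b, hb, s, hs, -, hs'⟩ := split u hu
    have hx := (core_maps hF hp w hw).1
    obtain ⟨q1, q2⟩ := hp _ hx
    rw [← h] at hs hs'
    have e : lam p r + a • p (c (lam p w)) = lam p s + b • p (c (lam p w)) := by
      have e1 : lam p w = lam p r + a • p (c (lam p w)) := by
        conv_lhs => rw [hr]
        simp [lam]
      have e2 : lam p u = lam p s + b • p (c (lam p w)) := by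
        conv_lhs => rw [hs]
        simp [lam]
      rw [← e1, ← e2, h]
    rw [← q2] at hr' hs'
    have hab : a = b := le_antisymm (not_lt.1 (cmp _ q1 b a s r hs' hr' e.symm))
      (not_lt.1 (cmp _ q1 a b r s hr' hs' e))
    subst hab
    have e' : lam p r = lam p s := by simpa using e
    have : r = s := by
      rcases hr' with rfl | ⟨hr1, hr2⟩
      · rcases hs' with rfl | ⟨hs1, hs2⟩
        · rfl
        · exfalso; apply hF.zero
          have := (core_maps hF hp _ hs1).1
          rw [← e'] at this; simpa using this
      · rcases hs' with rfl | ⟨hs1, hs2⟩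
        · exfalso; apply hF.zero
          have := (core_maps hF hp _ hr1).1
          rw [e'] at this; simpa using this
        · exact ih _ (hn ▸ hcard) r hr1 s hs1 rfl e'
    rw [hr, hs, this]

lemma core_surj (hF : Fan C c) (hp : ∀ x ∈ C, p (c x) ∈ C ∧ c (p (c x)) = c x) :
    ∀ x ∈ C, ∃ w ∈ Cw (c '' C), lam p w = x := by
  suffices H : ∀ n, ∀ x ∈ C, (c x).card = n → ∃ w ∈ Cw (c '' C), lam p w = x from
    fun x hx => H _ x hx rfl
  intro n
  induction n using Nat.strong_induction_on with
  | _ n ih =>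
    intro x hx hn
    obtain ⟨q1, q2⟩ := hp x hx
    obtain ⟨t, ht, h⟩ := hF.sub x hx _ q1 q2.symm
    rcases h with h | ⟨h1, h2⟩
    · refine ⟨Finsupp.single (c x) t, ⟨fun k => ?_, ?_⟩, by simp [lam, ← h]⟩
      · rw [Finsupp.single_apply]; split_ifs <;> linarith
      · rw [Finsupp.support_single_ne_zero _ ht.ne']
        refine ⟨by simp, ?_, ?_⟩
        · simp only [Finset.mem_singleton]; rintro _ rfl; exact ⟨x, hx, rfl⟩
        · simp only [Finset.mem_singleton]; rintro _ rfl _ rfl; simp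
    · obtain ⟨w, hw, hwx⟩ := ih _ (hn ▸ Finset.card_lt_card h2) _ h1 rfl
      have hm := core_maps hF hp w hw
      rw [hwx] at hm
      have hlt : ∀ a ∈ w.support, a ⊂ c x := fun a ha => (hm.2.2 a ha).trans_ssubset h2
      have hsup : (w + Finsupp.single (c x) t).support ⊆ insert (c x) w.support := by
        refine Finsupp.support_add.trans (Finset.union_subset (Finset.subset_insert _ _) ?_)
        exact Finsupp.support_single_subset.trans (by simp)
      refine ⟨w + Finsupp.single (c x) t, ⟨fun k => ?_, ?_, fun a ha => ?_, fun a ha b hb => ?_⟩, ?_⟩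
      · have := hw.1 k
        have : 0 ≤ Finsupp.single (c x) t k := by
          rw [Finsupp.single_apply]; split_ifs <;> linarith
        simp only [Finsupp.add_apply]; linarith
      · refine ⟨c x, ?_⟩
        rw [Finsupp.mem_support_iff]
        have := hw.1 (c x)
        simp only [Finsupp.add_apply, Finsupp.single_eq_same]
        linarith
      · rcases Finset.mem_insert.1 (hsup ha) with rfl | h
        · exact ⟨x, hx, rfl⟩
        · exact hw.2.2.1 a h
      · rcases Finset.mem_insert.1 (hsup ha) with rfl | h <;>
        rcases Finset.mem_insert.1 (hsup hb) with rfl | h'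
        · simp
        · exact Or.inr (hlt _ h').1
        · exact Or.inl (hlt _ h).1
        · exact hw.2.2.2 _ h _ h'
      · rw [map_add, hwx]; simp [lam]

end core

/-- A fan cut out by finitely many linear functionals. -/
lemma fan_of_fun {V ι : Type*} [AddCommGroup V] [Module ℝ V] {C : Set V} {c : V → Finset ι}
    (W : Submodule ℝ V) (h : ι → V →ₗ[ℝ] ℝ) (hCW : ∀ x ∈ C, x ∈ W)
    (h0 : (0 : V) ∉ C)
    (hc : ∀ x ∈ C, ∀ i, i ∈ c x ↔ 0 < h i x)
    (hZ : ∀ i, (∀ x ∈ C, 0 ≤ h i x) ∨ ∃ j, h j = - h i)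
    (hR : ∀ x ∈ C, ∀ y ∈ W, y ≠ 0 →
      (∀ i, (0 < h i y → 0 < h i x) ∧ (h i y < 0 → h i x < 0)) → y ∈ C)
    (hJ : ∀ y ∈ W, (∀ i, h i y = 0) → y = 0) : Fan C c := by
  have neg : ∀ x ∈ C, ∀ i, h i x < 0 → ∃ j, h j = - h i ∧ j ∈ c x := by
    intro x hx i hi
    rcases hZ i with h1 | ⟨j, hj⟩
    · exact absurd (h1 x hx) (not_le.2 hi)
    · exact ⟨j, hj, (hc x hx j).2 (by rw [hj]; simpa using hi)⟩
  have ne : ∀ x ∈ C, (c x).Nonempty := by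
    intro x hx
    by_contra hn
    rw [Finset.not_nonempty_iff_eq_empty] at hn
    apply h0
    rw [← hJ x (hCW x hx) ?_]
    · exact hx
    · intro i
      rcases lt_trichotomy (h i x) 0 with h1 | h1 | h1
      · obtain ⟨j, _, hj⟩ := neg x hx i h1
        rw [hn] at hj; simp at hj
      · exact h1
      · have := (hc x hx i).2 h1
        rw [hn] at this; simp at this
  -- monotone sign pattern
  have mono : ∀ y ∈ C, ∀ q ∈ C, c y ⊆ c q → ∀ i, (0 < h i y → 0 < h i q) ∧ (h i y < 0 → h i q < 0) := by
    intro y hy q hq hs i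
    refine ⟨fun h1 => (hc q hq i).1 (hs ((hc y hy i).2 h1)), fun h1 => ?_⟩
    obtain ⟨j, hj, hjc⟩ := neg y hy i h1
    have := (hc q hq j).1 (hs hjc)
    rw [hj] at this; simpa using this
  refine ⟨h0, ?_, ?_, ?_⟩
  · intro x hx q hq hxq
    obtain ⟨i0, hi0, hmin⟩ := (c x).exists_min_image (fun i => h i x / h i q) (ne x hx)
    have hp : ∀ i ∈ c x, 0 < h i x ∧ 0 < h i q := fun i hi =>
      ⟨(hc x hx i).1 hi, (hc q hq i).1 (hxq ▸ hi)⟩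
    refine ⟨h i0 x / h i0 q, div_pos (hp i0 hi0).1 (hp i0 hi0).2, ?_⟩
    set t := h i0 x / h i0 q with ht
    by_cases hz : x - t • q = 0
    · left; exact sub_eq_zero.1 hz
    right
    have hle : ∀ i ∈ c x, t * h i q ≤ h i x := fun i hi => by
      have := hmin i hi
      exact (le_div_iff₀ (hp i hi).2).1 this
    have hev : ∀ i, h i (x - t • q) = h i x - t * h i q := fun i => by simp
    have sg : ∀ i, (0 < h i (x - t • q) → 0 < h i x) ∧ (h i (x - t • q) < 0 → h i x < 0) := by
      intro i
      rw [hev]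
      have m1 := mono x hx q hq hxq.subset i
      have m2 := mono q hq x hx hxq.symm.subset i
      rcases lt_trichotomy (h i x) 0 with h1 | h1 | h1
      · obtain ⟨j, hj, hjc⟩ := neg x hx i h1
        have := hle j hjc
        rw [hj] at this
        simp at this
        exact ⟨fun h2 => by linarith, fun _ => h1⟩
      · have : h i q = 0 := by
          rcases lt_trichotomy (h i q) 0 with h2 | h2 | h2
          · have := m2.2 h2; linarith
          · exact h2
          · have := m2.1 h2; linarith
        rw [this, h1]; simp
      · have := hle i ((hc x hx i).2 h1)
        exact ⟨fun _ => h1, fun h2 => by linarith⟩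
    have hyC : x - t • q ∈ C :=
      hR x hx _ (W.sub_mem (hCW x hx) (W.smul_mem _ (hCW q hq))) hz sg
    refine ⟨hyC, ?_⟩
    rw [Finset.ssubset_iff_subset_ne]
    refine ⟨fun i hi => (hc x hx i).2 ((sg i).1 ((hc _ hyC i).1 hi)), fun he => ?_⟩
    have h1 := (hc _ hyC i0).1 (he ▸ hi0)
    rw [hev, ht, div_mul_cancel₀ _ (hp i0 hi0).2.ne'] at h1
    simp at h1
  · intro y hy q hq hyq a ha
    have m := mono y hy q hq hyq.subset
    have hev : ∀ i, h i (y + a • q) = h i y + a * h i q := fun i => by simp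
    have sg : ∀ i, (0 < h i (y + a • q) ↔ 0 < h i q) ∧ (h i (y + a • q) < 0 ↔ h i q < 0) := by
      intro i
      rw [hev]
      rcases lt_trichotomy (h i q) 0 with h1 | h1 | h1
      · have h2 : h i y ≤ 0 := by by_contra h3; have := (m i).1 (not_le.1 h3); linarith
        have h3 : a * h i q < 0 := mul_neg_of_pos_of_neg ha h1
        constructor <;> constructor <;> intro <;> linarith
      · have h2 : h i y = 0 := by
          rcases lt_trichotomy (h i y) 0 with h2 | h2 | h2
          · have := (m i).2 h2; linarith
          · exact h2
          · have := (m i).1 h2; linarith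
        rw [h1, h2]; simp
      · have h2 : 0 ≤ h i y := by by_contra h3; have := (m i).2 (not_le.1 h3); linarith
        have h3 : 0 < a * h i q := mul_pos ha h1
        constructor <;> constructor <;> intro <;> linarith
    have hz : y + a • q ≠ 0 := by
      intro hz
      obtain ⟨i, hi⟩ := ne q hq
      have := (sg i).1.2 ((hc q hq i).1 hi)
      rw [hz] at this; simp at this
    have hyC : y + a • q ∈ C := hR q hq _ (W.add_mem (hCW y hy) (W.smul_mem _ (hCW q hq))) hz
      fun i => ⟨(sg i).1.1, (sg i).2.1⟩
    refine ⟨hyC, ?_⟩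
    ext i
    rw [hc _ hyC, hc q hq, (sg i).1]
  · intro q hq a ha
    have hev : ∀ i, h i (a • q) = a * h i q := fun i => by simp
    have hz : a • q ≠ 0 := by
      intro hz
      rcases smul_eq_zero.1 hz with h1 | h1
      · exact ha.ne' h1
      · exact h0 (h1 ▸ hq)
    have hyC : a • q ∈ C := hR q hq _ (W.smul_mem _ (hCW q hq)) hz fun i => by
      rw [hev]
      exact ⟨fun h1 => pos_of_mul_pos_right h1 ha.le, fun h1 => by nlinarith⟩
    refine ⟨hyC, ?_⟩
    ext i
    rw [hc _ hyC, hc q hq, hev, mul_pos_iff_of_pos_left ha]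

/-- The orthant fan over a complex. -/
lemma fan_orthant {X : Type*} {K : Set (Finset X)} (hK : Cpx K) :
    Fan {w : X →₀ ℝ | (∀ v, 0 ≤ w v) ∧ w.support ∈ K} (fun w => w.support) := by
  refine fan_of_fun ⊤ (fun v => Finsupp.lapply v) (by simp) ?_ ?_ ?_ ?_ ?_
  · rintro ⟨_, h⟩
    simp at h
    exact hK.1 h
  · intro x hx i
    simp only [Finsupp.mem_support_iff, Finsupp.lapply_apply]
    exact ⟨fun h => lt_of_le_of_ne (hx.1 i) (Ne.symm h), fun h => h.ne'⟩
  · intro i; left; intro x hx; exact hx.1 i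
  · intro x hx y _ hy h
    simp only [Finsupp.lapply_apply] at h
    have h2 : ∀ v, 0 ≤ y v := by
      intro v; by_contra h3; have := (h v).2 (not_le.1 h3); have := hx.1 v; linarith
    refine ⟨h2, hK.2 _ hx.2 _ ?_ (Finsupp.support_nonempty_iff.2 hy)⟩
    intro v hv
    have := (h v).1 (lt_of_le_of_ne (h2 v) (Ne.symm (Finsupp.mem_support_iff.1 hv)))
    exact Finsupp.mem_support_iff.2 this.ne'
  · intro y _ h
    ext v; exact h v

section bary
variable {X E : Type*} [AddCommGroup E] [Module ℝ E]

/-- barycentre map -/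
def bary (f : X → E) (s : Finset X) : E := lam f (unif s)

lemma lam_bary (f : X → E) (w : Finset X →₀ ℝ) : lam (bary f) w = lam f (lam unif w) :=
  lam_comp unif (lam f) w

lemma orth_image {K : Set (Finset X)} (hK : Cpx K) :
    (fun w : X →₀ ℝ => w.support) '' {w : X →₀ ℝ | (∀ v, 0 ≤ w v) ∧ w.support ∈ K} = K := by
  ext s; constructor
  · rintro ⟨w, hw, rfl⟩; exact hw.2
  · intro hs
    exact ⟨unif s, ⟨unif_nonneg s, by rwa [unif_support]⟩, unif_support s⟩

lemma orth_hp {K : Set (Finset X)} : ∀ x ∈ {w : X →₀ ℝ | (∀ v, 0 ≤ w v) ∧ w.support ∈ K},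
    unif x.support ∈ {w : X →₀ ℝ | (∀ v, 0 ≤ w v) ∧ w.support ∈ K} ∧
      (unif x.support).support = x.support := fun x hx =>
  ⟨⟨unif_nonneg _, by rw [unif_support]; exact hx.2⟩, unif_support _⟩

lemma tot_lam_unif {K : Set (Finset X)} (hK : Cpx K) {w : Finset X →₀ ℝ}
    (hw : ∀ s ∈ w.support, s ∈ K) : tot (lam unif w) = tot w := by
  rw [← lam_comp, lam_eq_sum _ w _ subset_rfl, tot_eq_sum w _ subset_rfl]
  refine Finset.sum_congr rfl fun s hs => ?_
  rw [unif_tot, smul_eq_mul, mul_one]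
  rw [Finset.nonempty_iff_ne_empty]; rintro rfl; exact hK.1 (hw _ hs)

lemma bary_maps {K : Set (Finset X)} (hK : Cpx K) {w : Finset X →₀ ℝ} (hw : w ∈ Wt (Ch K)) :
    lam unif w ∈ Wt K ∧ (lam unif w).support ∈ w.support := by
  have := core_maps (fan_orthant hK) orth_hp w ⟨hw.1, by rw [orth_image hK]; exact hw.2.1⟩
  refine ⟨⟨this.1.1, this.1.2, ?_⟩, this.2.1⟩
  rw [tot_lam_unif hK hw.2.1.2.1, hw.2.2]

lemma bary_inj {K : Set (Finset X)} (hK : Cpx K) : Set.InjOn (lam unif) (Wt (Ch K)) := by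
  intro w hw u hu h
  refine core_inj (fan_orthant hK) orth_hp ⟨hw.1, ?_⟩ ⟨hu.1, ?_⟩ h
  · rw [orth_image hK]; exact hw.2.1
  · rw [orth_image hK]; exact hu.2.1

lemma bary_surj {K : Set (Finset X)} (hK : Cpx K) {x : X →₀ ℝ} (hx : x ∈ Wt K) :
    ∃ w ∈ Wt (Ch K), lam unif w = x := by
  obtain ⟨w, hw, h⟩ := core_surj (fan_orthant hK) orth_hp x ⟨hx.1, hx.2.1⟩
  have hw2 : w.support ∈ Ch K := by have := hw.2; rwa [orth_image hK] at this
  refine ⟨w, ⟨hw.1, hw2, ?_⟩, h⟩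
  rw [← tot_lam_unif hK hw2.2.1, h, hx.2.2]

lemma GR_bary {f : X → E} {K : Set (Finset X)} (hK : Cpx K) (hf : GR f K) : GR (bary f) (Ch K) := by
  intro w hw u hu h
  rw [lam_bary, lam_bary] at h
  exact bary_inj hK hw hu (hf (bary_maps hK hw).1 (bary_maps hK hu).1 h)

lemma car_bary {f : X → E} {K : Set (Finset X)} (hK : Cpx K) : car (bary f) (Ch K) = car f K := by
  ext x; constructor
  · rintro ⟨w, hw, rfl⟩
    exact ⟨_, (bary_maps hK hw).1, (lam_bary f w).symm⟩
  · rintro ⟨x, hx, rfl⟩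
    obtain ⟨w, hw, h⟩ := bary_surj hK hx
    exact ⟨w, hw, by rw [lam_bary, h]⟩

end bary

/-- Pointed simplicial cone (without the apex). -/
def pc {V : Type*} [AddCommGroup V] [Module ℝ V] (s : Finset V) : Set V :=
  {x | x ≠ 0 ∧ ∃ w : V →₀ ℝ, (∀ v, 0 ≤ w v) ∧ w.support ⊆ s ∧ lam (fun v => v) w = x}

lemma cone_fun {V : Type*} [AddCommGroup V] [Module ℝ V] (U s : Finset V) (hsU : s ⊆ U)
    (hs : LinearIndepOn ℝ id (s : Set V)) :
    ∃ H : Finset (V →ₗ[ℝ] ℝ), (∀ h ∈ H, -h ∈ H) ∧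
      (∀ y ∈ Submodule.span ℝ (U : Set V), (∀ h ∈ H, h y = 0) → y = 0) ∧
      ∀ x ∈ pc s, ∀ y ∈ Submodule.span ℝ (U : Set V), y ≠ 0 → (∀ h ∈ H, 0 < h y → 0 < h x) →
        y ∈ pc s := by
  set b := Module.Basis.extend hs with hb
  set I := U.biUnion fun u => (b.repr u).support with hI
  have hW : ∀ y ∈ Submodule.span ℝ (U : Set V), (b.repr y).support ⊆ I := by
    intro y hy
    induction hy using Submodule.span_induction with
    | mem u hu => exact Finset.subset_biUnion_of_mem (fun u => (b.repr u).support) hu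
    | zero => simp
    | add x y _ _ hx hy =>
      rw [map_add]; exact Finsupp.support_add.trans (Finset.union_subset hx hy)
    | smul a x _ hx => rw [map_smul]; exact Finsupp.support_smul.trans hx
  refine ⟨I.image (fun i => b.coord i) ∪ I.image (fun i => - b.coord i), ?_, ?_, ?_⟩
  · intro h hh
    rw [Finset.mem_union, Finset.mem_image, Finset.mem_image] at hh ⊢
    rcases hh with ⟨i, hi, rfl⟩ | ⟨i, hi, rfl⟩
    · exact Or.inr ⟨i, hi, rfl⟩
    · exact Or.inl ⟨i, hi, by simp⟩
  · intro y hy h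
    apply b.repr.injective
    rw [map_zero]
    ext i
    by_cases hi : i ∈ I
    · exact h (b.coord i) (Finset.mem_union_left _ (Finset.mem_image_of_mem _ hi))
    · exact Finsupp.notMem_support_iff.1 fun h' => hi (hW y hy h')
  · rintro x ⟨hx0, w, hw0, hws, rfl⟩ y hy hy0 h
    have hcoord : ∀ v ∈ s, ∀ i, b.coord i v = if (i : V) = v then 1 else 0 := by
      intro v hv i
      have hv' : v ∈ hs.extend (Set.subset_univ _) := hs.subset_extend _ hv
      have : v = b ⟨v, hv'⟩ := by rw [hb, Module.Basis.extend_apply_self]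
      conv_lhs => rw [this]
      rw [Module.Basis.coord_apply, Module.Basis.repr_self, Finsupp.single_apply]
      congr 1
      rw [eq_iff_iff, Subtype.ext_iff, eq_comm]
    have hcx : ∀ i, b.coord i (lam (fun v => v) w) = ∑ v ∈ s, w v * b.coord i v := by
      intro i; rw [lam_eq_sum _ w s hws, map_sum]; simp
    have hx1 : ∀ i, 0 ≤ b.coord i (lam (fun v => v) w) := by
      intro i; rw [hcx]
      refine Finset.sum_nonneg fun v hv => mul_nonneg (hw0 v) ?_
      rw [hcoord v hv]; split_ifs <;> norm_num
    have hx2 : ∀ i, 0 < b.coord i (lam (fun v => v) w) → (i : V) ∈ s := by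
      intro i hi
      by_contra hn
      rw [hcx, Finset.sum_eq_zero] at hi
      · exact lt_irrefl _ hi
      · intro v hv
        rw [hcoord v hv, if_neg, mul_zero]
        rintro rfl; exact hn hv
    have hy1 : ∀ i, 0 ≤ b.repr y i := by
      intro i
      by_contra hn
      have hi : i ∈ I := hW y hy (Finsupp.mem_support_iff.2 (not_le.1 hn).ne)
      have := h (- b.coord i) (Finset.mem_union_right _ (Finset.mem_image_of_mem _ hi))
        (by simpa using not_le.1 hn)
      have h2 := hx1 i
      rw [LinearMap.neg_apply] at this
      linarith
    have hy2 : ∀ i ∈ (b.repr y).support, (i : V) ∈ s := by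
      intro i hi
      refine hx2 i (h _ (Finset.mem_union_left _ (Finset.mem_image_of_mem _ (hW y hy hi))) ?_)
      exact lt_of_le_of_ne (hy1 i) (Ne.symm (Finsupp.mem_support_iff.1 hi))
    refine ⟨hy0, (b.repr y).mapDomain Subtype.val, fun v => ?_, ?_, ?_⟩
    · by_cases hv : v ∈ Set.range (Subtype.val : hs.extend (Set.subset_univ _) → V)
      · obtain ⟨i, rfl⟩ := hv
        rw [Finsupp.mapDomain_apply Subtype.val_injective]; exact hy1 i
      · rw [Finsupp.mapDomain_notin_range _ _ hv]
    · refine Finsupp.mapDomain_support.trans ?_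
      intro v hv
      obtain ⟨i, hi, rfl⟩ := Finset.mem_image.1 hv
      exact hy2 i hi
    · rw [Finsupp.linearCombination_mapDomain]
      have := b.linearCombination_repr y
      convert this using 2
      ext i
      rw [hb]
      simp [Module.Basis.extend_apply_self]

lemma fan_cones {V : Type*} [AddCommGroup V] [Module ℝ V] (F : Finset (Finset V))
    (hF : ∀ s ∈ F, LinearIndepOn ℝ id (s : Set V)) :
    ∃ H : Finset (V →ₗ[ℝ] ℝ), ∃ c : V → Finset H, Fan (⋃ s ∈ F, pc s) c ∧
      ∀ s ∈ F, ∀ x ∈ pc s, ∀ y ∈ ⋃ s ∈ F, pc s, c y ⊆ c x → y ∈ pc s := by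
  set U : Finset V := F.biUnion id with hU
  have hsU : ∀ s ∈ F, s ⊆ U := fun s hs => Finset.subset_biUnion_of_mem id hs
  choose! Hs h1 h2 h3 using fun s (hs : s ∈ F) => cone_fun U s (hsU s hs) (hF s hs)
  set H := F.biUnion Hs with hH
  set C := ⋃ s ∈ F, pc s with hC
  set c : V → Finset H := fun x => Finset.univ.filter fun i => 0 < i.1 x with hc
  have hmem : ∀ x (i : H), i ∈ c x ↔ 0 < i.1 x := by intro x i; simp [hc]
  have hCW : ∀ x ∈ C, x ∈ Submodule.span ℝ (U : Set V) := by
    intro x hx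
    simp only [hC, Set.mem_iUnion] at hx
    obtain ⟨s, hs, hx0, w, hw0, hws, rfl⟩ := hx
    rw [lam_eq_sum _ w s hws]
    exact Submodule.sum_mem _ fun v hv => Submodule.smul_mem _ _ (Submodule.subset_span (hsU s hs hv))
  refine ⟨H, c, fan_of_fun (Submodule.span ℝ (U : Set V)) (fun i => i.1) hCW ?_ (fun x _ i => hmem x i) ?_ ?_ ?_, ?_⟩
  · simp only [hC, Set.mem_iUnion]
    rintro ⟨s, hs, h, _⟩
    exact h rfl
  · rintro ⟨i, hi⟩
    right
    obtain ⟨s, hs, his⟩ := Finset.mem_biUnion.1 hi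
    exact ⟨⟨-i, Finset.mem_biUnion.2 ⟨s, hs, h1 s hs i his⟩⟩, rfl⟩
  · intro x hx y hy hy0 h
    simp only [hC, Set.mem_iUnion] at hx ⊢
    obtain ⟨s, hs, hx⟩ := hx
    exact ⟨s, hs, h3 s hs x hx y hy hy0 fun i hi =>
      (h ⟨i, Finset.mem_biUnion.2 ⟨s, hs, hi⟩⟩).1⟩
  · intro y hy h
    by_cases hn : F.Nonempty
    · obtain ⟨s, hs⟩ := hn
      exact h2 s hs y hy fun i hi => h ⟨i, Finset.mem_biUnion.2 ⟨s, hs, hi⟩⟩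
    · rw [Finset.not_nonempty_iff_eq_empty] at hn
      simpa [hU, hn] using hy
  · intro s hs x hx y hy hyx
    have hy0 : y ≠ 0 := by
      simp only [hC, Set.mem_iUnion] at hy
      obtain ⟨_, _, h, _⟩ := hy
      exact h
    refine h3 s hs x hx y (hCW y hy) hy0 fun i hi hp => ?_
    have := hyx ((hmem y ⟨i, Finset.mem_biUnion.2 ⟨s, hs, hi⟩⟩).2 hp)
    exact (hmem x _).1 this

section sect
variable {V : Type*} [AddCommGroup V] [Module ℝ V]

lemma mem_conv_iff {s : Finset V} {x : V} :
    x ∈ convexHull ℝ (s : Set V) ↔ ∃ w ∈ Sx s, lam (fun v => v) w = x := by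
  have := lam_Sx (fun v : V => v) s
  simp only [Set.image_id'] at this
  rw [← this]; rfl

lemma li_weights {s : Finset V} (hs : LinearIndepOn ℝ id (s : Set V)) {w : V →₀ ℝ}
    (hw : w.support ⊆ s) (h : lam (fun v => v) w = 0) : w = 0 := by
  rw [lam_eq_sum _ w s hw] at h
  rw [linearIndepOn_finset_iff] at hs
  ext v
  by_cases hv : v ∈ s
  · exact hs (fun v => w v) h v hv
  · exact Finsupp.notMem_support_iff.1 fun h => hv (hw h)

lemma conv_pc {s : Finset V} (hs : LinearIndepOn ℝ id (s : Set V)) {x : V}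
    (hx : x ∈ convexHull ℝ (s : Set V)) : x ∈ pc s := by
  obtain ⟨w, hw, rfl⟩ := mem_conv_iff.1 hx
  refine ⟨fun h => ?_, w, hw.1, hw.2.1, rfl⟩
  have := li_weights hs hw.2.1 h
  have h2 := hw.2.2
  rw [this] at h2; simp at h2

lemma pc_conv {s : Finset V} {x : V} (hx : x ∈ pc s) : ∃ a > (0 : ℝ), a • x ∈ convexHull ℝ (s : Set V) := by
  obtain ⟨h0, w, hw0, hws, rfl⟩ := hx
  have ht : 0 < tot w := by
    rw [tot_eq_sum w _ subset_rfl]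
    refine Finset.sum_pos (fun v hv => lt_of_le_of_ne (hw0 v) (Ne.symm (Finsupp.mem_support_iff.1 hv))) ?_
    rw [Finsupp.support_nonempty_iff]; rintro rfl; simp at h0
  refine ⟨(tot w)⁻¹, inv_pos.2 ht, mem_conv_iff.2 ⟨(tot w)⁻¹ • w, ⟨fun v => ?_, ?_, ?_⟩, by simp⟩⟩
  · have := hw0 v; simp only [Finsupp.smul_apply, smul_eq_mul]; positivity
  · exact Finsupp.support_smul.trans hws
  · rw [map_smul, smul_eq_mul, inv_mul_cancel₀ ht.ne']

lemma pc_smul {s : Finset V} {x : V} (hx : x ∈ pc s) {a : ℝ} (ha : 0 < a) : a • x ∈ pc s := by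
  obtain ⟨h0, w, hw0, hws, rfl⟩ := hx
  refine ⟨smul_ne_zero ha.ne' h0, a • w, fun v => ?_, Finsupp.support_smul.trans hws, by simp⟩
  have := hw0 v; simp only [Finsupp.smul_apply, smul_eq_mul]; positivity

lemma section_tri {ι : Type*} {F FX : Finset (Finset V)} (hF : ∀ s ∈ F, LinearIndepOn ℝ id (s : Set V))
    {c : V → Finset ι} (hfan : Fan (⋃ s ∈ F, pc s) c)
    (hext : ∀ s ∈ F, ∀ x ∈ pc s, ∀ y ∈ ⋃ s ∈ F, pc s, c y ⊆ c x → y ∈ pc s)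
    (hFX : FX ⊆ F) {X : Set V} (hX : X = ⋃ s ∈ FX, convexHull ℝ (s : Set V))
    (hray : ∀ x ∈ X, ∀ a > (0 : ℝ), a • x ∈ X → a = 1)
    (hcov : ∀ y ∈ ⋃ s ∈ F, pc s, ∃ a > (0 : ℝ), a • y ∈ X) :
    ∃ p : Finset ι → V, GR p (Ch (c '' ⋃ s ∈ F, pc s)) ∧ car p (Ch (c '' ⋃ s ∈ F, pc s)) = X ∧
      ∀ s ∈ FX, ∀ w ∈ Wt (Ch (c '' ⋃ s ∈ F, pc s)), lam p w ∈ convexHull ℝ (s : Set V) →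
        ∀ a ∈ w.support, p a ∈ convexHull ℝ (s : Set V) := by
  set C := ⋃ s ∈ F, pc s with hC
  have hmemX : ∀ {x}, x ∈ X ↔ ∃ s ∈ FX, x ∈ convexHull ℝ (s : Set V) := by
    intro x; rw [hX]; simp
  have hmemC : ∀ {x}, x ∈ C ↔ ∃ s ∈ F, x ∈ pc s := by
    intro x; rw [hC]; simp
  have hXC : ∀ x ∈ X, x ∈ C := by
    intro x hx
    obtain ⟨s, hs, hx⟩ := hmemX.1 hx
    exact hmemC.2 ⟨s, hFX hs, conv_pc (hF s (hFX hs)) hx⟩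
  have hconv : ∀ s ∈ FX, ∀ x ∈ pc s, x ∈ X → x ∈ convexHull ℝ (s : Set V) := by
    intro s hs x hx hxX
    obtain ⟨a, ha, h⟩ := pc_conv hx
    have := hray x hxX a ha (hmemX.2 ⟨s, hs, h⟩)
    rwa [this, one_smul] at h
  have hlab : ∀ k : Finset ι, ∃ z : V, (∃ x ∈ C, c x = k) → z ∈ X ∧ c z = k := by
    intro k
    by_cases h : ∃ x ∈ C, c x = k
    · obtain ⟨x, hx, hk⟩ := h
      obtain ⟨a, ha, h⟩ := hcov x hx
      exact ⟨a • x, fun _ => ⟨h, by rw [(hfan.smul x hx a ha).2, hk]⟩⟩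
    · exact ⟨0, fun h' => absurd h' h⟩
  choose p hp using hlab
  have hp' : ∀ x ∈ C, p (c x) ∈ C ∧ c (p (c x)) = c x := fun x hx =>
    ⟨hXC _ (hp (c x) ⟨x, hx, rfl⟩).1, (hp (c x) ⟨x, hx, rfl⟩).2⟩
  have hWC : ∀ w ∈ Wt (Ch (c '' C)), w ∈ Cw (c '' C) := fun w hw => ⟨hw.1, hw.2.1⟩
  have key : ∀ s ∈ FX, ∀ w ∈ Wt (Ch (c '' C)), lam p w ∈ pc s →
      ∀ a ∈ w.support, p a ∈ convexHull ℝ (s : Set V) := by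
    intro s hs w hw hy a ha
    obtain ⟨h1, h2, h3⟩ := core_maps hfan hp' w (hWC w hw)
    obtain ⟨hpX, hpa⟩ := hp a (hw.2.1.2.1 a ha)
    refine hconv s hs _ (hext s (hFX hs) _ hy _ (hXC _ hpX) ?_) hpX
    rw [hpa]; exact h3 a ha
  refine ⟨p, ?_, ?_, ?_⟩
  · intro w hw u hu h
    exact core_inj hfan hp' (hWC w hw) (hWC u hu) h
  · ext x; constructor
    · rintro ⟨w, hw, rfl⟩
      obtain ⟨h1, h2, h3⟩ := core_maps hfan hp' w (hWC w hw)
      obtain ⟨b, hb, hbX⟩ := hcov _ h1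
      obtain ⟨s, hs, hbs⟩ := hmemX.1 hbX
      have hy : lam p w ∈ pc s := by
        have := pc_smul (conv_pc (hF s (hFX hs)) hbs) (inv_pos.2 hb)
        rwa [smul_smul, inv_mul_cancel₀ hb.ne', one_smul] at this
      refine hmemX.2 ⟨s, hs, ?_⟩
      rw [lam_eq_sum p w _ subset_rfl]
      refine (convex_convexHull ℝ _).sum_mem (fun v _ => hw.1 v) ?_ (key s hs w hw hy)
      rw [← tot_eq_sum w _ subset_rfl]; exact hw.2.2
    · intro hx
      obtain ⟨w, hw, h⟩ := core_surj hfan hp' x (hXC x hx)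
      have ht : 0 < tot w := by
        rw [tot_eq_sum w _ subset_rfl]
        exact Finset.sum_pos (fun v hv => lt_of_le_of_ne (hw.1 v) (Ne.symm (Finsupp.mem_support_iff.1 hv))) hw.2.1
      have hw' : (tot w)⁻¹ • w ∈ Wt (Ch (c '' C)) := by
        refine ⟨fun v => ?_, ?_, ?_⟩
        · have := hw.1 v; simp only [Finsupp.smul_apply, smul_eq_mul]; positivity
        · rw [Finsupp.support_smul_eq (inv_pos.2 ht).ne']; exact hw.2
        · rw [map_smul, smul_eq_mul, inv_mul_cancel₀ ht.ne']
      have hx' : (tot w)⁻¹ • x ∈ X := by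
        obtain ⟨h1, h2, h3⟩ := core_maps hfan hp' _ (hWC _ hw')
        obtain ⟨b, hb, hbX⟩ := hcov _ h1
        obtain ⟨s, hs, hbs⟩ := hmemX.1 hbX
        have hy : lam p ((tot w)⁻¹ • w) ∈ pc s := by
          have := pc_smul (conv_pc (hF s (hFX hs)) hbs) (inv_pos.2 hb)
          rwa [smul_smul, inv_mul_cancel₀ hb.ne', one_smul] at this
        refine hmemX.2 ⟨s, hs, ?_⟩
        have hk := key s hs _ hw' hy
        rw [← h, ← map_smul]
        rw [lam_eq_sum p _ _ subset_rfl]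
        refine (convex_convexHull ℝ _).sum_mem (fun v _ => hw'.1 v) ?_ hk
        rw [← tot_eq_sum _ _ subset_rfl]; exact hw'.2.2
      have := hray x hx _ (inv_pos.2 ht) hx'
      refine ⟨w, ⟨hw.1, hw.2, ?_⟩, h⟩
      rwa [inv_eq_one] at this
  · intro s hs w hw hy
    exact key s hs w hw (conv_pc (hF s (hFX hs)) hy)

end sect

/-- Polyhedra: finite unions of polytopes. -/
def Poly {E : Type*} [AddCommGroup E] [Module ℝ E] (P : Set E) : Prop :=
  ∃ S : Finset (Finset E), P = ⋃ s ∈ S, convexHull ℝ (s : Set E)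

section poly
variable {E : Type*} [AddCommGroup E] [Module ℝ E]

lemma poly_simp {P : Set E} (h : Poly P) : ∃ S : Finset (Finset E),
    P = ⋃ s ∈ S, convexHull ℝ (s : Set E) ∧ ∀ s ∈ S, s.Nonempty ∧
      ∀ d : E →₀ ℝ, d.support ⊆ s → tot d = 0 → lam (fun v => v) d = 0 → d = 0 := by
  obtain ⟨S, rfl⟩ := h
  refine ⟨S.biUnion fun s => s.powerset.filter fun t => t.Nonempty ∧
    AffineIndependent ℝ ((↑) : t → E), ?_, ?_⟩
  · ext x
    simp only [Set.mem_iUnion, Finset.mem_biUnion, Finset.mem_filter, Finset.mem_powerset]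
    constructor
    · rintro ⟨s, hs, hx⟩
      rw [convexHull_eq_union] at hx
      simp only [Set.mem_iUnion] at hx
      obtain ⟨t, hts, hai, hx⟩ := hx
      refine ⟨t, ⟨s, hs, by exact_mod_cast hts, ?_, hai⟩, hx⟩
      rw [Finset.nonempty_iff_ne_empty]; rintro rfl; simp at hx
    · rintro ⟨t, ⟨s, hs, hts, _, _⟩, hx⟩
      exact ⟨s, hs, convexHull_mono (by exact_mod_cast hts) hx⟩
  · intro s hs
    simp only [Finset.mem_biUnion, Finset.mem_filter, Finset.mem_powerset] at hs
    obtain ⟨_, _, _, hn, hai⟩ := hs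
    refine ⟨hn, fun d hd h0 h1 => ?_⟩
    rw [affineIndependent_iff] at hai
    have := hai Finset.univ (fun v => d v) ?_ ?_
    · ext v
      by_cases hv : v ∈ s
      · exact this ⟨v, hv⟩ (Finset.mem_univ _)
      · exact Finsupp.notMem_support_iff.1 fun h => hv (hd h)
    · rw [← h0, tot_eq_sum d s hd, ← Finset.sum_coe_sort s]
    · rw [← h1, lam_eq_sum _ d s hd, ← Finset.sum_coe_sort s]

lemma li_of {s : Finset E} (h : ∀ d : E →₀ ℝ, d.support ⊆ s → lam (fun v => v) d = 0 → d = 0) :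
    LinearIndepOn ℝ id (s : Set E) := by
  rw [linearIndepOn_finset_iff]
  intro g hg v hv
  have := h (∑ v ∈ s, Finsupp.single v (g v)) ?_ ?_
  · have h2 := DFunLike.congr_fun this v
    simpa [Finsupp.finsetSum_apply, Finsupp.single_apply, hv] using h2
  · refine Finsupp.support_finsetSum.trans ?_
    intro u hu
    obtain ⟨v, hv, h⟩ := Finset.mem_biUnion.1 hu
    have := Finsupp.support_single_subset h
    simp at this; rwa [this]
  · rw [map_sum]; simpa using hg

/-- simplices of a ray-unique set are linearly independent -/
lemma li_of_ray {s : Finset E} (hn : s.Nonempty)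
    (h : ∀ d : E →₀ ℝ, d.support ⊆ s → tot d = 0 → lam (fun v => v) d = 0 → d = 0)
    (hray : ∀ x ∈ convexHull ℝ (s : Set E), ∀ a > (0 : ℝ), a • x ∈ convexHull ℝ (s : Set E) → a = 1) :
    LinearIndepOn ℝ id (s : Set E) := by
  refine li_of fun d hd h1 => h d hd ?_ h1
  by_contra ht
  -- may assume the total is positive
  obtain ⟨d', hd', h1', ht'⟩ : ∃ d' : E →₀ ℝ, d'.support ⊆ s ∧ lam (fun v => v) d' = 0 ∧ 0 < tot d' := by
    rcases lt_or_gt_of_ne ht with h2 | h2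
    · exact ⟨-d, by rwa [Finsupp.support_neg], by rw [map_neg, h1, neg_zero], by rw [map_neg]; linarith⟩
    · exact ⟨d, hd, h1, h2⟩
  obtain ⟨ε, he, hp⟩ := unif_perturb hn d' hd'
  have hT : 0 < 1 + ε * tot d' := by positivity
  have hx : lam (fun v => v) (unif s) ∈ convexHull ℝ (s : Set E) :=
    mem_conv_iff.2 ⟨_, unif_mem_Sx hn, rfl⟩
  have := hray _ hx (1 + ε * tot d')⁻¹ (inv_pos.2 hT) ?_
  · rw [inv_eq_one] at this
    have : ε * tot d' = 0 := by linarith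
    exact (mul_pos he ht').ne' this
  · refine mem_conv_iff.2 ⟨(1 + ε * tot d')⁻¹ • (unif s + ε • d'), ⟨fun v => ?_, ?_, ?_⟩, ?_⟩
    · rw [Finsupp.smul_apply, smul_eq_mul]; exact mul_nonneg (inv_pos.2 hT).le (hp v)
    · refine Finsupp.support_smul.trans (Finsupp.support_add.trans (Finset.union_subset ?_ ?_))
      · exact (unif_support s).subset
      · exact Finsupp.support_smul.trans hd'
    · rw [map_smul, map_add, map_smul, unif_tot hn, smul_eq_mul, smul_eq_mul, inv_mul_cancel₀ hT.ne']
    · rw [map_smul, map_add, map_smul, h1', smul_zero, add_zero]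

/-- Simultaneous triangulation. -/
theorem tri.{u} {E : Type u} [AddCommGroup E] [Module ℝ E] (PP : Set (Set E)) (hfin : PP.Finite) (hP : ∀ P ∈ PP, Poly P) :
    ∃ (κ : Type u) (K : Set (Finset κ)) (f : κ → E), K.Finite ∧ Cpx K ∧ GR f K ∧ car f K = ⋃₀ PP ∧
      ∀ P ∈ PP, ∀ w ∈ Wt K, lam f w ∈ P → convexHull ℝ (f '' (w.support : Set κ)) ⊆ P := by
  choose! S hS hS2 using fun P hp => poly_simp (hP P hp)
  set lift : Finset E → Finset (E × ℝ) := fun s => s ×ˢ {1} with hlift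
  have hlc : ∀ s : Finset E, convexHull ℝ (lift s : Set (E × ℝ)) = convexHull ℝ (s : Set E) ×ˢ {1} := by
    intro s
    rw [hlift, Finset.coe_product, convexHull_prod]
    simp
  set F : Finset (Finset (E × ℝ)) := hfin.toFinset.biUnion fun P => (S P).image lift with hFd
  have hFm : ∀ {s'}, s' ∈ F ↔ ∃ P ∈ PP, ∃ s ∈ S P, lift s = s' := by
    intro s'; simp [hFd]
  set X : Set (E × ℝ) := (⋃₀ PP) ×ˢ {1} with hX
  have hXF : X = ⋃ s ∈ F, convexHull ℝ (s : Set (E × ℝ)) := by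
    ext ⟨x, t⟩
    simp only [hX, Set.mem_prod, Set.mem_sUnion, Set.mem_singleton_iff, Set.mem_iUnion]
    constructor
    · rintro ⟨⟨P, hPP, hx⟩, rfl⟩
      rw [hS P hPP] at hx
      simp only [Set.mem_iUnion] at hx
      obtain ⟨s, hs, hx⟩ := hx
      refine ⟨lift s, hFm.2 ⟨P, hPP, s, hs, rfl⟩, ?_⟩
      rw [hlc]; exact ⟨hx, rfl⟩
    · rintro ⟨s', hs', hx⟩
      obtain ⟨P, hPP, s, hs, rfl⟩ := hFm.1 hs'
      rw [hlc] at hx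
      refine ⟨⟨P, hPP, ?_⟩, hx.2⟩
      rw [hS P hPP]
      exact Set.mem_biUnion hs hx.1
  have hray : ∀ x ∈ X, ∀ a > (0 : ℝ), a • x ∈ X → a = 1 := by
    rintro ⟨x, t⟩ ⟨_, ht⟩ a ha ⟨_, h⟩
    simp only [Set.mem_singleton_iff] at ht
    subst ht
    simpa using h
  have hLI : ∀ s ∈ F, LinearIndepOn ℝ id (s : Set (E × ℝ)) := by
    intro s' hs'
    obtain ⟨P, hPP, s, hs, rfl⟩ := hFm.1 hs'
    refine li_of fun d hd h => ?_
    have h1 : (lam (fun v : E × ℝ => v) d) = (lam Prod.fst d, lam Prod.snd d) :=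
      lam_prod Prod.fst Prod.snd d
    rw [h1, Prod.mk_eq_zero] at h
    have hone : ∀ v ∈ d.support, v.2 = 1 := fun v hv => by
      have := Finset.mem_product.1 (hd hv); simpa using this.2
    have h2 : tot d = 0 := by
      rw [← h.2, tot_eq_sum d _ subset_rfl, lam_eq_sum _ d _ subset_rfl]
      exact Finset.sum_congr rfl fun v hv => by rw [hone v hv]; simp
    have hmd : d.mapDomain Prod.fst = 0 := by
      refine (hS2 P hPP s hs).2 _ ?_ ?_ ?_
      · refine Finsupp.mapDomain_support.trans fun v hv => ?_
        obtain ⟨u, hu, rfl⟩ := Finset.mem_image.1 hv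
        exact (Finset.mem_product.1 (hd hu)).1
      · rw [tot, Finsupp.linearCombination_mapDomain]; exact h2
      · rw [lam, Finsupp.linearCombination_mapDomain]; exact h.1
    have hd1 : d = (d.mapDomain Prod.fst).mapDomain (fun x => (x, (1 : ℝ))) := by
      rw [← Finsupp.mapDomain_comp]
      conv_lhs => rw [← Finsupp.mapDomain_id (v := d)]
      refine Finsupp.mapDomain_congr fun v hv => ?_
      exact Prod.ext rfl (hone v hv)
    rw [hd1, hmd, Finsupp.mapDomain_zero]
  obtain ⟨H, c, hfan, hext⟩ := fan_cones F hLI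
  obtain ⟨p, hGR, hcar, hp⟩ := section_tri hLI hfan hext subset_rfl hXF hray (by
    intro y hy
    simp only [Set.mem_iUnion] at hy
    obtain ⟨s, hs, hy⟩ := hy
    obtain ⟨a, ha, h⟩ := pc_conv hy
    exact ⟨a, ha, by rw [hXF]; exact Set.mem_biUnion hs h⟩)
  have hfst : ∀ w, lam (fun k => (p k).1) w = (lam p w).1 := fun w =>
    lam_comp p (LinearMap.fst ℝ E ℝ) w
  refine ⟨Finset H, Ch (c '' ⋃ s ∈ F, pc s), fun k => (p k).1, Set.toFinite _, Ch_cpx _, ?_, ?_, ?_⟩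
  · intro w hw u hu h
    refine hGR hw hu ?_
    rw [hfst, hfst] at h
    have h1 : lam p w ∈ X := hcar ▸ ⟨w, hw, rfl⟩
    have h2 : lam p u ∈ X := hcar ▸ ⟨u, hu, rfl⟩
    refine Prod.ext h ?_
    rw [h1.2, h2.2]
  · ext x; constructor
    · rintro ⟨w, hw, rfl⟩
      have h1 : lam p w ∈ X := hcar ▸ ⟨w, hw, rfl⟩
      rw [hfst]; exact h1.1
    · intro hx
      have : (x, (1 : ℝ)) ∈ X := ⟨hx, rfl⟩
      rw [← hcar] at this
      obtain ⟨w, hw, h⟩ := this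
      exact ⟨w, hw, by rw [hfst, h]⟩
  · intro P hPP w hw hx
    have h1 : lam p w ∈ X := hcar ▸ ⟨w, hw, rfl⟩
    rw [hS P hPP] at hx
    simp only [Set.mem_iUnion] at hx
    obtain ⟨s, hs, hx⟩ := hx
    rw [hfst] at hx
    have h2 := hp (lift s) (hFm.2 ⟨P, hPP, s, hs, rfl⟩) w hw (by rw [hlc]; exact ⟨hx, h1.2⟩)
    refine (convexHull_min ?_ (convex_convexHull ℝ (s : Set E))).trans ?_
    · rintro _ ⟨k, hk, rfl⟩
      have := h2 k hk
      rw [hlc] at this; exact this.1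
    · rw [hS P hPP]
      exact Set.subset_biUnion_of_mem (u := fun s : Finset E => convexHull ℝ (s : Set E)) hs

end poly

section polyops
variable {E F G : Type*} [AddCommGroup E] [Module ℝ E] [AddCommGroup F] [Module ℝ F]
  [AddCommGroup G] [Module ℝ G]

lemma Poly.conv {s : Set E} (hs : s.Finite) : Poly (convexHull ℝ s) :=
  ⟨{hs.toFinset}, by simp⟩

lemma Poly.empty : Poly (∅ : Set E) := ⟨∅, by simp⟩

lemma Poly.biUnion {ι : Type*} {I : Set ι} (hI : I.Finite) {P : ι → Set E} (h : ∀ i ∈ I, Poly (P i)) :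
    Poly (⋃ i ∈ I, P i) := by
  choose! S hS using h
  refine ⟨hI.toFinset.biUnion S, ?_⟩
  ext x
  simp only [Set.mem_iUnion, Finset.mem_biUnion, Set.Finite.mem_toFinset]
  constructor
  · rintro ⟨i, hi, hx⟩
    rw [hS i hi] at hx
    simp only [Set.mem_iUnion] at hx
    obtain ⟨s, hs, hx⟩ := hx
    exact ⟨s, ⟨i, hi, hs⟩, hx⟩
  · rintro ⟨s, ⟨i, hi, hs⟩, hx⟩
    refine ⟨i, hi, ?_⟩
    rw [hS i hi]
    exact Set.mem_biUnion hs hx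

lemma Poly.union {P Q : Set E} (hP : Poly P) (hQ : Poly Q) : Poly (P ∪ Q) := by
  have := Poly.biUnion (I := (Set.univ : Set Bool)) Set.finite_univ (P := fun b => if b then P else Q)
    (by rintro (_ | _) _ <;> simpa)
  convert this using 1
  ext x; simp [or_comm]

lemma Poly.car {X : Type*} {f : X → E} {K : Set (Finset X)} (hf : K.Finite) (hK : Cpx K) : Poly (car f K) := by
  rw [car_eq hK]
  exact Poly.biUnion hf fun s _ => Poly.conv (s.finite_toSet.image f)

lemma Poly.inter {P Q : Set E} (hP : Poly P) (hQ : Poly Q) : Poly (P ∩ Q) := by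
  obtain ⟨κ, K, f, hfin, hK, hf, hcar, h⟩ := tri {P, Q} (by simp) (by
    rintro R (rfl | rfl) <;> assumption)
  have : P ∩ Q = ⋃ s ∈ {s ∈ K | convexHull ℝ (f '' (s : Set κ)) ⊆ P ∩ Q}, convexHull ℝ (f '' (s : Set κ)) := by
    apply Set.Subset.antisymm
    · rintro x ⟨hxP, hxQ⟩
      have hx : x ∈ HomologySpheres.car f K := by rw [hcar]; exact ⟨P, by simp, hxP⟩
      obtain ⟨w, hw, rfl⟩ := hx
      refine Set.mem_biUnion (x := w.support) ⟨hw.2.1, Set.subset_inter (h P (by simp) w hw hxP) (h Q (by simp) w hw hxQ)⟩ ?_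
      rw [← lam_Sx]; exact ⟨w, Wt_Sx hw, rfl⟩
    · intro x hx
      simp only [Set.mem_iUnion] at hx
      obtain ⟨s, hs, hx⟩ := hx
      exact hs.2 hx
  rw [this]
  exact Poly.biUnion (hfin.subset fun s hs => hs.1) fun s _ => Poly.conv (s.finite_toSet.image f)

lemma Poly.prod {P : Set E} {Q : Set F} (hP : Poly P) (hQ : Poly Q) : Poly (P ×ˢ Q) := by
  obtain ⟨S, rfl⟩ := hP
  obtain ⟨T, rfl⟩ := hQ
  have : (⋃ s ∈ S, convexHull ℝ (s : Set E)) ×ˢ (⋃ t ∈ T, convexHull ℝ (t : Set F)) =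
      ⋃ s ∈ (S : Set (Finset E)), ⋃ t ∈ (T : Set (Finset F)), convexHull ℝ ((s : Set E) ×ˢ (t : Set F)) := by
    ext ⟨x, y⟩
    simp only [convexHull_prod, Set.mem_prod, Set.mem_iUnion, Finset.mem_coe, exists_prop]
    constructor
    · rintro ⟨⟨s, hs, hx⟩, ⟨t, ht, hy⟩⟩; exact ⟨s, hs, t, ht, hx, hy⟩
    · rintro ⟨s, hs, t, ht, hx, hy⟩; exact ⟨⟨s, hs, hx⟩, ⟨t, ht, hy⟩⟩
  rw [this]
  exact Poly.biUnion S.finite_toSet fun s _ => Poly.biUnion T.finite_toSet fun t _ =>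
    Poly.conv (s.finite_toSet.prod t.finite_toSet)

lemma Poly.image {P : Set E} (hP : Poly P) (φ : E →ᵃ[ℝ] F) : Poly (φ '' P) := by
  obtain ⟨S, rfl⟩ := hP
  rw [Set.image_iUnion₂]
  have : (⋃ s, ⋃ (_ : s ∈ S), φ '' (convexHull ℝ (s : Set E))) =
      ⋃ s ∈ (S : Set (Finset E)), convexHull ℝ (φ '' (s : Set E)) := by
    simp only [AffineMap.image_convexHull, Finset.mem_coe]
  rw [this]
  exact Poly.biUnion S.finite_toSet fun s _ => Poly.conv (s.finite_toSet.image φ)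

/-- PL homeomorphism given by a polyhedral graph. -/
def PLH (X : Set E) (Y : Set F) : Prop :=
  ∃ Γ : Set (E × F), Poly Γ ∧ (∀ p ∈ Γ, ∀ q ∈ Γ, p.1 = q.1 → p = q) ∧
    (∀ p ∈ Γ, ∀ q ∈ Γ, p.2 = q.2 → p = q) ∧ Prod.fst '' Γ = X ∧ Prod.snd '' Γ = Y

lemma PLH.symm {X : Set E} {Y : Set F} (h : PLH X Y) : PLH Y X := by
  obtain ⟨Γ, h1, h2, h3, rfl, rfl⟩ := h
  refine ⟨Prod.swap '' Γ, ?_, ?_, ?_, ?_, ?_⟩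
  · have := h1.image (LinearMap.prod (LinearMap.snd ℝ E F) (LinearMap.fst ℝ E F)).toAffineMap
    exact this
  · rintro _ ⟨p, hp, rfl⟩ _ ⟨q, hq, rfl⟩ h; rw [h3 p hp q hq h]
  · rintro _ ⟨p, hp, rfl⟩ _ ⟨q, hq, rfl⟩ h; rw [h2 p hp q hq h]
  · rw [← Set.image_comp]; rfl
  · rw [← Set.image_comp]; rfl

lemma PLH.poly_left {X : Set E} {Y : Set F} (h : PLH X Y) : Poly X := by
  obtain ⟨Γ, h1, h2, h3, rfl, rfl⟩ := h
  exact h1.image (LinearMap.fst ℝ E F).toAffineMap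

lemma PLH.poly_right {X : Set E} {Y : Set F} (h : PLH X Y) : Poly Y := h.symm.poly_left

lemma PLH.trans {X : Set E} {Y : Set F} {Z : Set G} (h : PLH X Y) (h' : PLH Y Z) : PLH X Z := by
  have hX := h.poly_left
  have hY := h.poly_right
  have hZ := h'.poly_right
  obtain ⟨Γ, h1, h2, h3, rfl, rfl⟩ := h
  obtain ⟨Δ, k1, k2, k3, k4, rfl⟩ := h'
  set δ : E × F × G →ₗ[ℝ] (E × F) × (F × G) :=
    LinearMap.prod (LinearMap.prod (LinearMap.fst ℝ E (F × G)) (LinearMap.fst ℝ F G ∘ₗ LinearMap.snd ℝ E (F × G)))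
      (LinearMap.snd ℝ E (F × G)) with hδ
  set π : (E × F) × (F × G) →ₗ[ℝ] E × G :=
    LinearMap.prod (LinearMap.fst ℝ E F ∘ₗ LinearMap.fst ℝ (E × F) (F × G))
      (LinearMap.snd ℝ F G ∘ₗ LinearMap.snd ℝ (E × F) (F × G)) with hπ
  have hmem : ∀ x z, (x, z) ∈ π '' ((Γ ×ˢ Δ) ∩ δ '' ((Prod.fst '' Γ) ×ˢ (Prod.snd '' Γ) ×ˢ (Prod.snd '' Δ))) ↔
      ∃ y, (x, y) ∈ Γ ∧ (y, z) ∈ Δ := by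
    intro x z
    constructor
    · rintro ⟨_, ⟨⟨hp, hq⟩, ⟨⟨x', y, z'⟩, _, rfl⟩⟩, he⟩
      obtain ⟨rfl, rfl⟩ := Prod.mk.inj he
      exact ⟨y, hp, hq⟩
    · rintro ⟨y, hp, hq⟩
      refine ⟨((x, y), (y, z)), ⟨⟨hp, hq⟩, ⟨(x, y, z), ⟨⟨_, hp, rfl⟩, ⟨_, hp, rfl⟩, ⟨_, hq, rfl⟩⟩, rfl⟩⟩, rfl⟩
  refine ⟨π '' ((Γ ×ˢ Δ) ∩ δ '' ((Prod.fst '' Γ) ×ˢ (Prod.snd '' Γ) ×ˢ (Prod.snd '' Δ))), ?_, ?_, ?_, ?_, ?_⟩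
  · exact ((h1.prod k1).inter ((hX.prod (hY.prod hZ)).image δ.toAffineMap)).image π.toAffineMap
  · rintro ⟨x, z⟩ hp ⟨x', z'⟩ hq hxx
    obtain ⟨y, a1, a2⟩ := (hmem _ _).1 hp
    obtain ⟨y', b1, b2⟩ := (hmem _ _).1 hq
    simp only at hxx; subst hxx
    have := h2 _ a1 _ b1 rfl
    simp only [Prod.mk.injEq, true_and] at this; subst this
    have := k2 _ a2 _ b2 rfl
    simp only [Prod.mk.injEq, true_and] at this; rw [this]
  · rintro ⟨x, z⟩ hp ⟨x', z'⟩ hq hxx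
    obtain ⟨y, a1, a2⟩ := (hmem _ _).1 hp
    obtain ⟨y', b1, b2⟩ := (hmem _ _).1 hq
    simp only at hxx; subst hxx
    have := k3 _ a2 _ b2 rfl
    simp only [Prod.mk.injEq, and_true] at this; subst this
    have := h3 _ a1 _ b1 rfl
    simp only [Prod.mk.injEq, and_true] at this; rw [this]
  · ext x; constructor
    · rintro ⟨⟨x, z⟩, hp, rfl⟩
      obtain ⟨y, a1, a2⟩ := (hmem _ _).1 hp
      exact ⟨_, a1, rfl⟩
    · rintro ⟨⟨x, y⟩, hp, rfl⟩
      have : y ∈ Prod.fst '' Δ := by rw [k4]; exact ⟨_, hp, rfl⟩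
      obtain ⟨⟨y, z⟩, hq, rfl⟩ := this
      exact ⟨(x, z), (hmem _ _).2 ⟨y, hp, hq⟩, rfl⟩
  · ext z; constructor
    · rintro ⟨⟨x, z⟩, hp, rfl⟩
      obtain ⟨y, a1, a2⟩ := (hmem _ _).1 hp
      exact ⟨_, a2, rfl⟩
    · rintro ⟨⟨y, z⟩, hq, rfl⟩
      have : y ∈ Prod.snd '' Γ := by rw [← k4]; exact ⟨_, hq, rfl⟩
      obtain ⟨⟨x, y⟩, hp, rfl⟩ := this
      exact ⟨(x, z), (hmem _ _).2 ⟨y, hp, hq⟩, rfl⟩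

lemma PLH.simp {X : Type*} {f : X → E} {g : X → F} {K : Set (Finset X)} (hfin : K.Finite) (hK : Cpx K)
    (hf : GR f K) (hg : GR g K) : PLH (HomologySpheres.car f K) (HomologySpheres.car g K) := by
  refine ⟨HomologySpheres.car (fun v => (f v, g v)) K, Poly.car hfin hK, ?_, ?_, ?_, ?_⟩
  · rintro _ ⟨w, hw, rfl⟩ _ ⟨u, hu, rfl⟩ h
    rw [lam_prod, lam_prod] at h
    rw [hf hw hu h]
  · rintro _ ⟨w, hw, rfl⟩ _ ⟨u, hu, rfl⟩ h
    rw [lam_prod, lam_prod] at h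
    rw [hg hw hu h]
  · rw [HomologySpheres.car, ← Set.image_comp]
    exact Set.image_congr fun w _ => by simp [lam_prod]
  · rw [HomologySpheres.car, ← Set.image_comp]
    exact Set.image_congr fun w _ => by simp [lam_prod]

lemma PLH.affine {X : Set E} (hX : Poly X) (φ : E →ᵃ[ℝ] F) (hφ : Set.InjOn φ X) : PLH X (φ '' X) := by
  refine ⟨(AffineMap.prod (AffineMap.id ℝ E) φ) '' X, hX.image _, ?_, ?_, ?_, ?_⟩
  · rintro _ ⟨x, hx, rfl⟩ _ ⟨y, hy, rfl⟩ h
    simp at h; rw [h]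
  · rintro _ ⟨x, hx, rfl⟩ _ ⟨y, hy, rfl⟩ h
    simp at h; rw [hφ hx hy h]
  · rw [← Set.image_comp]
    exact Set.image_id X
  · rw [← Set.image_comp]
    rfl

lemma PLH.refl {X : Set E} (hX : Poly X) : PLH X X := by
  have := PLH.affine hX (AffineMap.id ℝ E) (fun x _ y _ h => h)
  simpa using this

/-- Radial projection from the origin. -/
lemma PLH.radial {X Y : Set E} (hX : Poly X) (hY : Poly Y)
    (rX : ∀ x ∈ X, ∀ a > (0 : ℝ), a • x ∈ X → a = 1) (rY : ∀ x ∈ Y, ∀ a > (0 : ℝ), a • x ∈ Y → a = 1)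
    (hXY : ∀ x ∈ X, ∃ a > (0 : ℝ), a • x ∈ Y) (hYX : ∀ y ∈ Y, ∃ a > (0 : ℝ), a • y ∈ X) : PLH X Y := by
  obtain ⟨S, hS, hS2⟩ := poly_simp hX
  obtain ⟨T, hT, hT2⟩ := poly_simp hY
  have sX : ∀ s ∈ S, convexHull ℝ (s : Set E) ⊆ X := fun s hs => by
    rw [hS]; exact Set.subset_biUnion_of_mem (u := fun s : Finset E => convexHull ℝ (s : Set E)) hs
  have sY : ∀ s ∈ T, convexHull ℝ (s : Set E) ⊆ Y := fun s hs => by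
    rw [hT]; exact Set.subset_biUnion_of_mem (u := fun s : Finset E => convexHull ℝ (s : Set E)) hs
  have hLI : ∀ s ∈ S ∪ T, LinearIndepOn ℝ id (s : Set E) := by
    intro s hs
    rcases Finset.mem_union.1 hs with hs | hs
    · exact li_of_ray (hS2 s hs).1 (hS2 s hs).2 fun x hx a ha h => rX x (sX s hs hx) a ha (sX s hs h)
    · exact li_of_ray (hT2 s hs).1 (hT2 s hs).2 fun x hx a ha h => rY x (sY s hs hx) a ha (sY s hs h)
  obtain ⟨H, c, hfan, hext⟩ := fan_cones (S ∪ T) hLI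
  have cov : ∀ y ∈ ⋃ s ∈ S ∪ T, pc s, (∃ a > (0 : ℝ), a • y ∈ X) ∧ ∃ a > (0 : ℝ), a • y ∈ Y := by
    intro y hy
    simp only [Set.mem_iUnion] at hy
    obtain ⟨s, hs, hy⟩ := hy
    obtain ⟨a, ha, h⟩ := pc_conv hy
    rcases Finset.mem_union.1 hs with hs | hs
    · refine ⟨⟨a, ha, sX s hs h⟩, ?_⟩
      obtain ⟨b, hb, h'⟩ := hXY _ (sX s hs h)
      exact ⟨b * a, mul_pos hb ha, by rwa [mul_smul]⟩
    · refine ⟨?_, ⟨a, ha, sY s hs h⟩⟩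
      obtain ⟨b, hb, h'⟩ := hYX _ (sY s hs h)
      exact ⟨b * a, mul_pos hb ha, by rwa [mul_smul]⟩
  obtain ⟨p, hp1, hp2, _⟩ := section_tri hLI hfan hext Finset.subset_union_left hS rX fun y hy => (cov y hy).1
  obtain ⟨q, hq1, hq2, _⟩ := section_tri hLI hfan hext Finset.subset_union_right hT rY fun y hy => (cov y hy).2
  have := PLH.simp (Set.toFinite _) (Ch_cpx _) hp1 hq1
  rwa [hp2, hq2] at this

end polyops

section bridges
variable {X Y : Type*} [DecidableEq X] [DecidableEq Y]

lemma cpx_of_isComplex {K : Finset (Finset X)} (hK : IsComplex K) : Cpx (K : Set (Finset X)) :=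
  ⟨hK.2.1, fun s hs t ht hn => hK.2.2 s hs t ht hn⟩

lemma sub_verts {K : Finset (Finset X)} {s : Finset X} (hs : s ∈ K) : s ⊆ verts K := by
  unfold verts; exact Finset.le_sup (f := id) hs

lemma mem_verts {K : Finset (Finset X)} {v : X} : v ∈ verts K ↔ ∃ s ∈ K, v ∈ s := by
  unfold verts; simp [Finset.mem_sup]

lemma GComplex.cpx (G : GComplex) : Cpx (G.faces : Set (Finset (ℕ → ℝ))) :=
  ⟨G.empty_not_mem, fun s hs t ht hn => G.down_closed s hs t ht hn⟩

lemma ai_dep {s : Finset (ℕ → ℝ)} (hai : AffineIndependent ℝ (fun x : {y : ℕ → ℝ // y ∈ s} => (x : ℕ → ℝ)))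
    (d : (ℕ → ℝ) →₀ ℝ) (hd : d.support ⊆ s) (h0 : tot d = 0) (h1 : lam (fun v => v) d = 0) : d = 0 := by
  rw [affineIndependent_iff] at hai
  have := hai Finset.univ (fun v => d v) ?_ ?_
  · ext v
    by_cases hv : v ∈ s
    · exact this ⟨v, hv⟩ (Finset.mem_univ _)
    · exact Finsupp.notMem_support_iff.1 fun h => hv (hd h)
  · rw [← h0, tot_eq_sum d s hd, ← Finset.sum_coe_sort s]
  · rw [← h1, lam_eq_sum _ d s hd, ← Finset.sum_coe_sort s]

lemma mapDomain_Sx {Z Z' : Type*} [DecidableEq Z'] (f : Z → Z') {s : Finset Z} {w : Z →₀ ℝ} (hw : w ∈ Sx s) :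
    w.mapDomain f ∈ Sx (s.image f) := by
  refine ⟨fun v => ?_, ?_, ?_⟩
  · rw [Finsupp.mapDomain, Finsupp.sum, Finsupp.finsetSum_apply]
    refine Finset.sum_nonneg fun u _ => ?_
    rw [Finsupp.single_apply]
    split_ifs
    · exact hw.1 u
    · exact le_rfl
  · intro v hv
    have h2 := Finsupp.mapDomain_support hv
    obtain ⟨u, hu, rfl⟩ := Finset.mem_image.1 h2
    exact Finset.mem_image_of_mem _ (hw.2.1 hu)
  · rw [tot, Finsupp.linearCombination_mapDomain]; exact hw.2.2

lemma coe_image' {s : Finset X} {f : X → ℕ → ℝ} : ((s.image f : Finset (ℕ → ℝ)) : Set (ℕ → ℝ)) = f '' s := by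
  simp

lemma realizes_GR {G : GComplex} {K : Finset (Finset X)} {f : X → ℕ → ℝ} (h : RealizesMap G K f) :
    GR f (K : Set (Finset X)) := by
  intro w hw u hu he
  obtain ⟨hinj, hfac⟩ := h
  have hs : w.support.image f ∈ G.faces := by rw [hfac]; exact Finset.mem_image_of_mem _ hw.2.1
  have ht : u.support.image f ∈ G.faces := by rw [hfac]; exact Finset.mem_image_of_mem _ hu.2.1
  have hw' := mapDomain_Sx f (Wt_Sx hw)
  have hu' := mapDomain_Sx f (Wt_Sx hu)
  have e1 : lam (fun v => v) (w.mapDomain f) = lam f w := by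
    rw [lam, Finsupp.linearCombination_mapDomain]; rfl
  have e2 : lam (fun v => v) (u.mapDomain f) = lam f u := by
    rw [lam, Finsupp.linearCombination_mapDomain]; rfl
  have hx : lam f w ∈ convexHull ℝ ((w.support.image f ∩ u.support.image f : Finset (ℕ → ℝ)) : Set (ℕ → ℝ)) := by
    have := G.glue _ hs _ ht
    convert (this.subset ⟨mem_conv_iff.2 ⟨_, hw', e1⟩, mem_conv_iff.2 ⟨_, hu', e2.trans he.symm⟩⟩) using 3
  obtain ⟨v, hv, hv2⟩ := mem_conv_iff.1 hx
  have h1 : w.mapDomain f = v := by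
    rw [← sub_eq_zero]
    refine ai_dep (G.indep _ hs) _ ?_ ?_ ?_
    · refine Finsupp.support_sub.trans (Finset.union_subset hw'.2.1 (hv.2.1.trans Finset.inter_subset_left))
    · rw [map_sub, hw'.2.2, hv.2.2, sub_self]
    · rw [map_sub, e1, hv2, sub_self]
  have h2 : u.mapDomain f = v := by
    rw [← sub_eq_zero]
    refine ai_dep (G.indep _ ht) _ ?_ ?_ ?_
    · refine Finsupp.support_sub.trans (Finset.union_subset hu'.2.1 (hv.2.1.trans Finset.inter_subset_right))
    · rw [map_sub, hu'.2.2, hv.2.2, sub_self]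
    · rw [map_sub, e2, hv2, he, sub_self]
  refine Finsupp.mapDomain_injOn (S := (verts K : Set X)) hinj ?_ ?_ (h1.trans h2.symm)
  · exact_mod_cast sub_verts (K := K) hw.2.1
  · exact_mod_cast sub_verts (K := K) hu.2.1

lemma subCarrier_eq {K : Finset (Finset X)} (hK : Cpx (K : Set (Finset X))) {f : X → ℕ → ℝ} :
    subCarrier f K = car f (K : Set (Finset X)) := by
  rw [car_eq hK, subCarrier]
  simp

lemma realizes_car {G : GComplex} {K : Finset (Finset X)} (hK : Cpx (K : Set (Finset X))) {f : X → ℕ → ℝ}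
    (h : RealizesMap G K f) : G.carrier = car f (K : Set (Finset X)) := by
  rw [car_eq hK, GComplex.carrier, h.2]
  ext x
  simp

lemma single_Wt {K : Set (Finset X)} (hK : Cpx K) {s : Finset X} (hs : s ∈ K) {v : X} (hv : v ∈ s) :
    Finsupp.single v (1 : ℝ) ∈ Wt K := Sx_Wt hK hs (single_mem_Sx hv)

lemma GR.injOn {E : Type*} [AddCommGroup E] [Module ℝ E] {f : X → E} {K : Finset (Finset X)}
    (hK : Cpx (K : Set (Finset X))) (hf : GR f (K : Set (Finset X))) :
    Set.InjOn f (verts K : Set X) := by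
  intro u hu v hv h
  obtain ⟨s, hs, hus⟩ := mem_verts.1 hu
  obtain ⟨t, ht, hvt⟩ := mem_verts.1 hv
  have := hf (single_Wt hK hs hus) (single_Wt hK ht hvt) (by simpa [lam] using h)
  exact Finsupp.single_left_injective one_ne_zero this

lemma exists_G {K : Finset (Finset X)} (hn : K.Nonempty) (hK : Cpx (K : Set (Finset X))) {f : X → ℕ → ℝ}
    (hf : GR f (K : Set (Finset X))) : ∃ G : GComplex, RealizesMap G K f := by
  have hinj := hf.injOn hK
  have hne : ∀ s ∈ K, s.Nonempty := fun s hs => by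
    rw [Finset.nonempty_iff_ne_empty]; rintro rfl; exact hK.1 hs
  refine ⟨⟨K.image (Finset.image f), hn.image _, ?_, ?_, ?_, ?_⟩, hinj, rfl⟩
  · intro h
    obtain ⟨s, hs, h⟩ := Finset.mem_image.1 h
    rw [Finset.image_eq_empty] at h
    exact hK.1 (h ▸ hs)
  · intro s' hs' t' ht hn
    obtain ⟨s, hs, rfl⟩ := Finset.mem_image.1 hs'
    obtain ⟨t, hts, rfl⟩ := Finset.subset_image_iff.1 ht
    refine Finset.mem_image_of_mem _ (hK.2 s hs t (by exact_mod_cast hts) ?_)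
    exact Finset.image_nonempty.1 hn
  · intro s' hs'
    obtain ⟨s, hs, rfl⟩ := Finset.mem_image.1 hs'
    rw [affineIndependent_iff]
    intro S W h0 h1
    -- pull back the dependency
    have hinjs : Set.InjOn f (s : Set X) := hinj.mono (by exact_mod_cast sub_verts hs)
    set d : X →₀ ℝ := ∑ v ∈ s, Finsupp.single v (if h : f v ∈ s.image f then (if ⟨f v, h⟩ ∈ S then W ⟨f v, h⟩ else 0) else 0) with hd
    have hdv : ∀ v ∈ s, ∀ h : f v ∈ s.image f, d v = if ⟨f v, h⟩ ∈ S then W ⟨f v, h⟩ else 0 := by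
      intro v hv h
      rw [hd, Finsupp.finsetSum_apply]
      simp only [Finsupp.single_apply]
      rw [Finset.sum_ite_eq' s v, if_pos hv, dif_pos h]
    have hds : d.support ⊆ s := by
      refine Finsupp.support_finsetSum.trans ?_
      intro u hu
      obtain ⟨v, hv, h⟩ := Finset.mem_biUnion.1 hu
      have := Finsupp.support_single_subset h
      simp at this; rwa [this]
    have key : ∀ {M : Type} [AddCommGroup M] [Module ℝ M] (g : (ℕ → ℝ) → M),
        ∑ v ∈ s, d v • g (f v) = ∑ x ∈ S, W x • g x.1 := by
      intro M _ _ g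
      have : ∑ x ∈ S, W x • g x.1 = ∑ x : {y // y ∈ s.image f}, (if x ∈ S then W x else 0) • g x.1 := by
        simp only [ite_smul, zero_smul]
        rw [Finset.sum_ite_mem, Finset.univ_inter]
      rw [this]
      symm
      refine Finset.sum_bij' (fun x _ => (Finset.mem_image.1 x.2).choose)
        (fun v hv => ⟨f v, Finset.mem_image_of_mem f hv⟩) ?_ ?_ ?_ ?_ ?_
      · intro x _; exact (Finset.mem_image.1 x.2).choose_spec.1
      · intro x _; exact Finset.mem_univ _
      · intro x _
        exact Subtype.ext (Finset.mem_image.1 x.2).choose_spec.2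
      · intro v hv
        have h := (Finset.mem_image.1 (Finset.mem_image_of_mem f hv)).choose_spec
        exact hinjs h.1 hv h.2
      · intro x _
        have h := (Finset.mem_image.1 x.2).choose_spec
        have hm : f (Finset.mem_image.1 x.2).choose ∈ s.image f := Finset.mem_image_of_mem f h.1
        rw [hdv _ h.1 hm]
        have hx : (⟨f (Finset.mem_image.1 x.2).choose, hm⟩ : {y // y ∈ s.image f}) = x := Subtype.ext h.2
        rw [hx, h.2]
    have hz : d = 0 := by
      refine dep_zero (hne s hs) (Set.InjOn.mono (Sx_Wt hK hs) hf) d hds ?_ ?_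
      · have := key (fun _ => (1 : ℝ))
        rw [tot_eq_sum d s hds]
        simpa [h0] using this
      · have := key (fun x => x)
        rw [lam_eq_sum f d s hds, this, h1]
    intro x hx
    obtain ⟨v, hv, hvx⟩ := Finset.mem_image.1 x.2
    have h := hdv v hv (Finset.mem_image_of_mem f hv)
    have hx' : (⟨f v, Finset.mem_image_of_mem f hv⟩ : {y // y ∈ s.image f}) = x := Subtype.ext hvx
    rw [hx', hz, if_pos hx] at h
    simpa using h.symm
  · intro s' hs' t' ht'
    obtain ⟨s, hs, rfl⟩ := Finset.mem_image.1 hs'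
    obtain ⟨t, ht, rfl⟩ := Finset.mem_image.1 ht'
    apply Set.Subset.antisymm
    · rintro x ⟨h1, h2⟩
      rw [Finset.coe_image, ← lam_Sx] at h1 h2
      obtain ⟨w, hw, rfl⟩ := h1
      obtain ⟨u, hu, he⟩ := h2
      have := hf (Sx_Wt hK ht hu) (Sx_Wt hK hs hw) he
      subst this
      have hmem : lam f u ∈ convexHull ℝ (f '' ((s ∩ t : Finset X) : Set X)) := by
        rw [← lam_Sx]
        exact ⟨u, ⟨hu.1, Finset.subset_inter hw.2.1 hu.2.1, hu.2.2⟩, rfl⟩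
      refine convexHull_mono ?_ hmem
      rintro _ ⟨v, hv, rfl⟩
      have hv := Finset.mem_inter.1 (Finset.mem_coe.1 hv)
      simp only [Finset.coe_inter, Finset.coe_image]
      exact ⟨⟨v, hv.1, rfl⟩, ⟨v, hv.2, rfl⟩⟩
    · exact Set.subset_inter (convexHull_mono (by simp)) (convexHull_mono (by simp))

lemma realizes_id (G : GComplex) : RealizesMap G G.faces (fun x => x) := by
  refine ⟨fun _ _ _ _ h => h, ?_⟩
  have : (Finset.image fun x : ℕ → ℝ => x) = fun s => s := by
    funext s; exact Finset.image_id'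
  rw [this]
  simp

lemma combEquiv_PLH {K : Finset (Finset X)} {L : Finset (Finset Y)} (hK : Cpx (K : Set (Finset X)))
    (hL : Cpx (L : Set (Finset Y)))
    (h : CombEquiv K L) {E F : Type*} [AddCommGroup E] [Module ℝ E] [AddCommGroup F] [Module ℝ F]
    {f : X → E} {g : Y → F} (hf : GR f (K : Set (Finset X)))
    (hg : GR g (L : Set (Finset Y))) : PLH (car f (K : Set (Finset X))) (car g (L : Set (Finset Y))) := by
  obtain ⟨G1, G1', G2, G2', ⟨f1, h1⟩, ⟨f2, h2⟩, h3, h4, φ, hφ⟩ := h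
  have p1 := PLH.simp K.finite_toSet hK hf (realizes_GR h1)
  rw [← realizes_car hK h1, ← h3.1] at p1
  have p2 := PLH.simp L.finite_toSet hL hg (realizes_GR h2)
  rw [← realizes_car hL h2, ← h4.1] at p2
  have r1 := realizes_id G1'
  have r2 : RealizesMap G2' G1'.faces φ := hφ
  have p3 := PLH.simp G1'.faces.finite_toSet G1'.cpx (realizes_GR r1) (realizes_GR r2)
  rw [← realizes_car G1'.cpx r1, ← realizes_car G1'.cpx r2] at p3
  exact (p1.trans p3).trans p2.symm

end bridges

/-- Standard basis vectors. -/
def ee (i : ℕ) : ℕ → ℝ := Pi.single i 1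

lemma lam_ee (w : ℕ →₀ ℝ) : lam ee w = fun i => w i := by
  rw [lam_eq_sum ee w _ subset_rfl]
  funext i
  rw [Finset.sum_apply]
  simp only [ee, Pi.smul_apply, Pi.single_apply, smul_eq_mul, mul_ite, mul_one, mul_zero]
  rw [Finset.sum_ite_eq]
  split_ifs with h
  · rfl
  · exact (Finsupp.notMem_support_iff.1 h).symm

lemma lam_ee_inj : Function.Injective (lam ee) := by
  intro w u h
  rw [lam_ee, lam_ee] at h
  ext i; exact congrFun h i

lemma GR_ee (K : Set (Finset ℕ)) : GR ee K := lam_ee_inj.injOn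

/-- Standard simplex. -/
def DD (A : Finset ℕ) : Set (ℕ → ℝ) :=
  {x | (∀ i, 0 ≤ x i) ∧ (∀ i, i ∉ A → x i = 0) ∧ ∑ i ∈ A, x i = 1}

/-- Boundary of the standard simplex. -/
def SS (A : Finset ℕ) : Set (ℕ → ℝ) := {x | x ∈ DD A ∧ ∃ i ∈ A, x i = 0}

lemma DD_eq (A : Finset ℕ) : DD A = lam ee '' Sx A := by
  ext x; constructor
  · intro hx
    set w : ℕ →₀ ℝ := Finsupp.onFinset A x (fun i hi => by by_contra h; exact hi (hx.2.1 i h)) with hw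
    have hws : w.support ⊆ A := Finsupp.support_onFinset_subset
    refine ⟨w, ⟨hx.1, hws, ?_⟩, ?_⟩
    · rw [tot_eq_sum w A hws]; exact hx.2.2
    · rw [lam_ee]; rfl
  · rintro ⟨w, hw, rfl⟩
    rw [lam_ee]
    refine ⟨hw.1, fun i hi => Finsupp.notMem_support_iff.1 fun h => hi (hw.2.1 h), ?_⟩
    rw [← tot_eq_sum w A hw.2.1]; exact hw.2.2

lemma DD_conv (A : Finset ℕ) : DD A = convexHull ℝ (ee '' (A : Set ℕ)) := by rw [DD_eq, lam_Sx]

lemma DD_poly (A : Finset ℕ) : Poly (DD A) := by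
  rw [DD_conv]; exact Poly.conv (A.finite_toSet.image _)

lemma DD_erase {A : Finset ℕ} {i : ℕ} {x : ℕ → ℝ} : x ∈ DD (A.erase i) ↔ x ∈ DD A ∧ x i = 0 := by
  constructor
  · intro hx
    have h0 : x i = 0 := hx.2.1 i (by simp)
    refine ⟨⟨hx.1, fun j hj => hx.2.1 j fun h => hj (Finset.mem_of_mem_erase h), ?_⟩, h0⟩
    rw [← Finset.sum_erase A h0]; exact hx.2.2
  · rintro ⟨hx, h0⟩
    refine ⟨hx.1, fun j hj => ?_, ?_⟩
    · by_cases h : j = i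
      · rw [h, h0]
      · exact hx.2.1 j fun h' => hj (Finset.mem_erase.2 ⟨h, h'⟩)
    · rw [Finset.sum_erase A h0]; exact hx.2.2

lemma DD_mono {A B : Finset ℕ} (h : A ⊆ B) : DD A ⊆ DD B := by
  rw [DD_eq, DD_eq]; exact Set.image_mono (Sx_mono h)

lemma SS_eq (A : Finset ℕ) : SS A = ⋃ i ∈ (A : Set ℕ), DD (A.erase i) := by
  ext x
  simp only [SS, Set.mem_setOf_eq, Set.mem_iUnion, DD_erase, Finset.mem_coe, exists_prop]
  constructor
  · rintro ⟨h, i, hi, h0⟩; exact ⟨i, hi, h, h0⟩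
  · rintro ⟨i, hi, h, h0⟩; exact ⟨h, i, hi, h0⟩

lemma SS_poly (A : Finset ℕ) : Poly (SS A) := by
  rw [SS_eq]; exact Poly.biUnion A.finite_toSet fun i _ => DD_poly _

lemma stdBall_cpx {X : Type*} [DecidableEq X] (A : Finset X) : Cpx (stdBall A : Set (Finset X)) := by
  refine ⟨by simp [stdBall], fun s hs t ht hn => ?_⟩
  simp only [stdBall, Finset.mem_coe, Finset.mem_erase, Finset.mem_powerset] at hs ⊢
  exact ⟨hn.ne_empty, ht.trans hs.2⟩

lemma stdSphere_cpx {X : Type*} [DecidableEq X] (A : Finset X) : Cpx (stdSphere A : Set (Finset X)) := by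
  refine ⟨by simp [stdSphere], fun s hs t ht hn => ?_⟩
  simp only [stdSphere, Finset.mem_coe, Finset.mem_erase, Finset.mem_powerset] at hs ⊢
  refine ⟨?_, hn.ne_empty, ht.trans hs.2.2⟩
  rintro rfl
  exact hs.1 (Finset.Subset.antisymm hs.2.2 ht)

lemma car_stdBall (A : Finset ℕ) : car ee (stdBall A : Set (Finset ℕ)) = DD A := by
  rw [DD_eq, car]
  congr 1
  ext w
  simp only [Wt, Sx, stdBall, Set.mem_setOf_eq, Finset.mem_coe, Finset.mem_erase, Finset.mem_powerset]
  constructor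
  · rintro ⟨h1, ⟨_, h2⟩, h3⟩; exact ⟨h1, h2, h3⟩
  · rintro ⟨h1, h2, h3⟩; exact ⟨h1, ⟨(support_nonempty h3).ne_empty, h2⟩, h3⟩

lemma car_stdSphere (A : Finset ℕ) : car ee (stdSphere A : Set (Finset ℕ)) = SS A := by
  ext x
  simp only [SS, Set.mem_setOf_eq, car, DD_eq]
  constructor
  · rintro ⟨w, ⟨h1, h2, h3⟩, rfl⟩
    simp only [stdSphere, Finset.mem_coe, Finset.mem_erase, Finset.mem_powerset] at h2
    refine ⟨⟨w, ⟨h1, h2.2.2, h3⟩, rfl⟩, ?_⟩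
    by_contra hn
    push Not at hn
    refine h2.1 (Finset.Subset.antisymm h2.2.2 fun i hi => ?_)
    have := hn i hi
    rw [lam_ee] at this
    exact Finsupp.mem_support_iff.2 this
  · rintro ⟨⟨w, ⟨h1, h2, h3⟩, rfl⟩, i, hi, h0⟩
    rw [lam_ee] at h0
    refine ⟨w, ⟨h1, ?_, h3⟩, rfl⟩
    simp only [stdSphere, Finset.mem_coe, Finset.mem_erase, Finset.mem_powerset]
    refine ⟨fun h => ?_, (support_nonempty h3).ne_empty, h2⟩
    rw [← h] at hi
    exact Finsupp.mem_support_iff.1 hi h0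

lemma DD_nonempty {A : Finset ℕ} (h : A.Nonempty) : (DD A).Nonempty := by
  obtain ⟨i, hi⟩ := h
  rw [DD_conv]
  exact ⟨ee i, subset_convexHull ℝ _ ⟨i, hi, rfl⟩⟩

section balls
variable {E : Type*} [AddCommGroup E] [Module ℝ E]

/-- pl ball -/
def Ball (k : ℕ) (P : Set E) : Prop := ∃ A : Finset ℕ, A.card = k + 1 ∧ PLH P (DD A)

/-- pl sphere -/
def Sph (k : ℕ) (P : Set E) : Prop := ∃ A : Finset ℕ, A.card = k + 2 ∧ PLH P (SS A)

lemma Ball.of_PLH {F : Type*} [AddCommGroup F] [Module ℝ F] {k : ℕ} {P : Set E} {Q : Set F} (h : PLH P Q)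
    (hQ : Ball k Q) : Ball k P := by
  obtain ⟨A, hA, h'⟩ := hQ; exact ⟨A, hA, h.trans h'⟩

lemma Sph.of_PLH {F : Type*} [AddCommGroup F] [Module ℝ F] {k : ℕ} {P : Set E} {Q : Set F} (h : PLH P Q)
    (hQ : Sph k Q) : Sph k P := by
  obtain ⟨A, hA, h'⟩ := hQ; exact ⟨A, hA, h.trans h'⟩

lemma ball_of_comb {X : Type*} [DecidableEq X] {k : ℕ} {K : Finset (Finset X)} (hK : Cpx (K : Set (Finset X)))
    (h : IsCombBall k K) {f : X → E} (hf : GR f (K : Set (Finset X))) : Ball k (car f (K : Set (Finset X))) := by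
  obtain ⟨A, hA, h⟩ := h
  have := combEquiv_PLH hK (stdBall_cpx A) h hf (GR_ee _)
  rw [car_stdBall] at this
  exact ⟨A, hA, this⟩

lemma sph_of_comb {X : Type*} [DecidableEq X] {k : ℕ} {K : Finset (Finset X)} (hK : Cpx (K : Set (Finset X)))
    (h : IsCombSphere k K) {f : X → E} (hf : GR f (K : Set (Finset X))) : Sph k (car f (K : Set (Finset X))) := by
  obtain ⟨A, hA, h⟩ := h
  have := combEquiv_PLH hK (stdSphere_cpx A) h hf (GR_ee _)
  rw [car_stdSphere] at this
  exact ⟨A, hA, this⟩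

end balls

lemma iso_of_realizes {X : Type*} [DecidableEq X] {G G' : GComplex} {K : Finset (Finset X)} {f g : X → ℕ → ℝ}
    (hf : RealizesMap G K f) (hg : RealizesMap G' K g) : Iso G.faces G'.faces := by
  by_cases hX : Nonempty X
  swap
  · exfalso
    obtain ⟨s, hs⟩ := G.nonempty
    rw [hf.2] at hs
    obtain ⟨t, ht, rfl⟩ := Finset.mem_image.1 hs
    apply G.empty_not_mem
    rw [hf.2]
    refine Finset.mem_image.2 ⟨t, ht, ?_⟩
    rw [Finset.image_eq_empty]
    exact Finset.eq_empty_of_forall_notMem fun x _ => hX ⟨x⟩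
  set φ : (ℕ → ℝ) → (ℕ → ℝ) := fun y => g (Function.invFunOn f (verts K : Set X) y) with hφ
  have key : ∀ v ∈ verts K, φ (f v) = g v := by
    intro v hv
    have h := Function.invFunOn_apply_mem (f := f) (s := (verts K : Set X)) (a := v) hv
    have h2 := Function.invFunOn_apply_eq (f := f) (s := (verts K : Set X)) (a := v) hv
    rw [hφ]
    simp only
    rw [hf.1 h hv h2]
  refine ⟨φ, ?_, ?_⟩
  · intro y hy z hz h
    obtain ⟨s', hs', hys⟩ := mem_verts.1 hy
    obtain ⟨t', ht', hzt⟩ := mem_verts.1 hz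
    rw [hf.2] at hs' ht'
    obtain ⟨s, hs, rfl⟩ := Finset.mem_image.1 hs'
    obtain ⟨t, ht, rfl⟩ := Finset.mem_image.1 ht'
    obtain ⟨u, hu, rfl⟩ := Finset.mem_image.1 hys
    obtain ⟨v, hv, rfl⟩ := Finset.mem_image.1 hzt
    rw [key u (sub_verts hs hu), key v (sub_verts ht hv)] at h
    rw [hg.1 (sub_verts hs hu) (sub_verts ht hv) h]
  · rw [hf.2, hg.2, Finset.image_image]
    refine Finset.image_congr fun s hs => ?_
    simp only [Function.comp]
    rw [Finset.image_image]
    exact Finset.image_congr fun v hv => (key v (sub_verts hs hv)).symm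

lemma Ball.isPLBall {k : ℕ} {P : Set (ℕ → ℝ)} (h : Ball k P) : IsPLBall k P := by
  obtain ⟨A, hA, Γ, hΓ, h1, h2, h3, h4⟩ := h
  have hAne : A.Nonempty := Finset.card_pos.1 (by omega)
  obtain ⟨κ, T, g, hfin, hT, hg, hcar, -⟩ := tri {Γ} (by simp) (by simpa using hΓ)
  rw [Set.sUnion_singleton] at hcar
  have l1 : ∀ w, lam (fun v => (g v).1) w = (lam g w).1 := fun w => lam_comp g (LinearMap.fst ℝ _ _) w
  have l2 : ∀ w, lam (fun v => (g v).2) w = (lam g w).2 := fun w => lam_comp g (LinearMap.snd ℝ _ _) w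
  have hm : ∀ w ∈ Wt T, lam g w ∈ Γ := fun w hw => hcar ▸ ⟨w, hw, rfl⟩
  have g1 : GR (fun v => (g v).1) T := by
    intro w hw u hu h
    rw [l1, l1] at h
    exact hg hw hu (h1 _ (hm w hw) _ (hm u hu) h)
  have g2 : GR (fun v => (g v).2) T := by
    intro w hw u hu h
    rw [l2, l2] at h
    exact hg hw hu (h2 _ (hm w hw) _ (hm u hu) h)
  have c1 : car (fun v => (g v).1) T = P := by
    rw [← h3, ← hcar, car, car, ← Set.image_comp]
    exact Set.image_congr fun w _ => l1 w
  have c2 : car (fun v => (g v).2) T = DD A := by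
    rw [← h4, ← hcar, car, car, ← Set.image_comp]
    exact Set.image_congr fun w _ => l2 w
  lift T to Finset (Finset κ) using hfin
  have hTne : T.Nonempty := by
    obtain ⟨x, hx⟩ := DD_nonempty hAne
    rw [← c2] at hx
    obtain ⟨w, hw, _⟩ := hx
    exact ⟨_, hw.2.1⟩
  obtain ⟨G, hG⟩ := exists_G hTne hT g1
  obtain ⟨G', hG'⟩ := exists_G hTne hT g2
  have hAm : A ∈ stdBall A := by simp [stdBall, hAne.ne_empty]
  obtain ⟨G2, hG2⟩ := exists_G ⟨A, hAm⟩ (stdBall_cpx A) (GR_ee _)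
  refine ⟨G, by rw [realizes_car hT hG, c1], A, hA, G, G, G2, G', ⟨_, realizes_id G⟩, ⟨_, hG2⟩,
    ⟨rfl, fun s hs => ⟨s, hs, subset_rfl⟩⟩, ⟨?_, fun s hs => ?_⟩, iso_of_realizes hG hG'⟩
  · rw [realizes_car hT hG', c2, realizes_car (stdBall_cpx A) hG2, car_stdBall]
  · refine ⟨A.image ee, ?_, ?_⟩
    · rw [hG2.2]; exact Finset.mem_image_of_mem _ hAm
    · rw [Finset.coe_image, ← DD_conv, ← c2, ← realizes_car hT hG']
      exact Set.subset_biUnion_of_mem (u := fun s : Finset (ℕ → ℝ) => convexHull ℝ (s : Set (ℕ → ℝ))) hs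

section linksec
variable {E : Type*} [AddCommGroup E] [Module ℝ E]

lemma PLH.radial_at (o : E) {X Y : Set E} (hX : Poly X) (hY : Poly Y)
    (rX : ∀ x ∈ X, ∀ a > (0 : ℝ), o + a • (x - o) ∈ X → a = 1)
    (rY : ∀ x ∈ Y, ∀ a > (0 : ℝ), o + a • (x - o) ∈ Y → a = 1)
    (hXY : ∀ x ∈ X, ∃ a > (0 : ℝ), o + a • (x - o) ∈ Y)
    (hYX : ∀ y ∈ Y, ∃ a > (0 : ℝ), o + a • (y - o) ∈ X) : PLH X Y := by
  set φ : E →ᵃ[ℝ] E := AffineMap.id ℝ E - AffineMap.const ℝ E o with hφ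
  have hφa : ∀ x, φ x = x - o := fun x => by simp [hφ]
  have hinj : ∀ S : Set E, Set.InjOn φ S := fun S x _ y _ h => by
    rw [hφa, hφa] at h; exact sub_left_injective h
  have hm : ∀ (S : Set E) (y : E), y ∈ φ '' S ↔ o + y ∈ S := by
    intro S y; constructor
    · rintro ⟨x, hx, rfl⟩; rw [hφa]; simpa using hx
    · intro h; exact ⟨_, h, by rw [hφa]; simp⟩
  have h1 := PLH.affine hX φ (hinj X)
  have h2 := PLH.affine hY φ (hinj Y)
  refine h1.trans (PLH.trans (PLH.radial (hX.image φ) (hY.image φ) ?_ ?_ ?_ ?_) h2.symm)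
  · intro x hx a ha h
    rw [hm] at hx h
    exact rX _ hx a ha (by simpa using h)
  · intro x hx a ha h
    rw [hm] at hx h
    exact rY _ hx a ha (by simpa using h)
  · intro x hx
    rw [hm] at hx
    obtain ⟨a, ha, h⟩ := hXY _ hx
    exact ⟨a, ha, by rw [hm]; simpa using h⟩
  · intro x hx
    rw [hm] at hx
    obtain ⟨a, ha, h⟩ := hYX _ hx
    exact ⟨a, ha, by rw [hm]; simpa using h⟩

variable {X : Type*}

/-- Frontier of the open star of `τ`. -/
def lk (L : Set (Finset X)) (τ : Finset X) : Set (Finset X) :=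
  {s | s.Nonempty ∧ ¬ τ ⊆ s ∧ s ∪ τ ∈ L}

lemma lk_sub {L : Set (Finset X)} (hL : Cpx L) (τ : Finset X) : lk L τ ⊆ L :=
  fun s hs => hL.2 _ hs.2.2 s Finset.subset_union_left hs.1

lemma lk_cpx {L : Set (Finset X)} (hL : Cpx L) (τ : Finset X) : Cpx (lk L τ) := by
  refine ⟨fun h => by simpa using h.1, fun s hs t ht hn => ⟨hn, fun h => hs.2.1 (h.trans ht), ?_⟩⟩
  exact hL.2 _ hs.2.2 _ (Finset.union_subset_union ht subset_rfl) (hn.mono Finset.subset_union_left)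

lemma comb_Wt {L : Set (Finset X)} (hL : Cpx L) {w0 w : X →₀ ℝ} {τ : Finset X} (hw0 : w0 ∈ Sx τ)
    (hw : w ∈ Wt (lk L τ)) {a : ℝ} (ha : 0 < a) (ha1 : a ≤ 1) : (1 - a) • w0 + a • w ∈ Wt L := by
  refine Sx_Wt hL hw.2.1.2.2 (Sx_convex _ ?_ ?_ (by linarith) ha.le (by ring))
  · exact Sx_mono Finset.subset_union_right hw0
  · exact Sx_mono Finset.subset_union_left (Wt_Sx hw)

lemma lam_comb (e : X → E) (w0 w : X →₀ ℝ) (a : ℝ) :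
    lam e ((1 - a) • w0 + a • w) = lam e w0 + a • (lam e w - lam e w0) := by
  rw [map_add, map_smul, map_smul, smul_sub, sub_smul, one_smul]; abel

lemma lk_ray_aux {L : Set (Finset X)} (hL : Cpx L) {e : X → E} (he : GR e L) {w0 : X →₀ ℝ} (hw0 : w0 ∈ Wt L)
    {w u : X →₀ ℝ} (hw : w ∈ Wt (lk L w0.support)) (hu : u ∈ Wt (lk L w0.support)) {a : ℝ} (ha : 0 < a)
    (ha1 : a ≤ 1) (h : lam e u = lam e w0 + a • (lam e w - lam e w0)) : a = 1 := by
  by_contra hne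
  have hlt : a < 1 := lt_of_le_of_ne ha1 hne
  rw [← lam_comb] at h
  have := he (Wt_mono (lk_sub hL _) hu) (comb_Wt hL (Wt_Sx hw0) hw ha ha1) h
  apply hu.2.1.2.1
  intro i hi
  rw [this, Finsupp.mem_support_iff]
  have h1 : 0 < w0 i := lt_of_le_of_ne (hw0.1 i) (Ne.symm (Finsupp.mem_support_iff.1 hi))
  have h2 := hw.1 i
  have h3 : 0 < 1 - a := by linarith
  simp only [Finsupp.add_apply, Finsupp.smul_apply, smul_eq_mul]
  positivity

lemma lk_ray {L : Set (Finset X)} (hL : Cpx L) {e : X → E} (he : GR e L) {w0 : X →₀ ℝ} (hw0 : w0 ∈ Wt L) :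
    ∀ x ∈ car e (lk L w0.support), ∀ a > (0 : ℝ),
      lam e w0 + a • (x - lam e w0) ∈ car e (lk L w0.support) → a = 1 := by
  rintro _ ⟨w, hw, rfl⟩ a ha ⟨u, hu, h⟩
  rcases le_total a 1 with h1 | h1
  · exact lk_ray_aux hL he hw0 hw hu ha h1 h
  · have := lk_ray_aux hL he hw0 hu hw (inv_pos.2 ha) (inv_le_one_of_one_le₀ h1) (by
      rw [h, add_sub_cancel_left, smul_smul, inv_mul_cancel₀ ha.ne', one_smul]; abel)
    rwa [inv_eq_one] at this

lemma lk_push {L : Set (Finset X)} {e : X → E} {w0 : X →₀ ℝ} (hw0 : w0 ∈ Wt L)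
    {σ : Finset X} (hσ : σ ∈ L) (hτ : w0.support ⊆ σ) (hL : Cpx L) {y : E}
    (hy : y ∈ convexHull ℝ (e '' (σ : Set X))) (hne : y ≠ lam e w0) :
    ∃ a > (0 : ℝ), lam e w0 + a • (y - lam e w0) ∈ car e (lk L w0.support) := by
  rw [← lam_Sx] at hy
  obtain ⟨w, hw, rfl⟩ := hy
  obtain ⟨i, hi, hmin⟩ := w0.support.exists_min_image (fun i => w i / w0 i) (support_nonempty hw0.2.2)
  have hp : ∀ j ∈ w0.support, 0 < w0 j := fun j hj =>
    lt_of_le_of_ne (hw0.1 j) (Ne.symm (Finsupp.mem_support_iff.1 hj))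
  set t := w i / w0 i with ht
  have hle : ∀ j, t * w0 j ≤ w j := by
    intro j
    by_cases hj : j ∈ w0.support
    · exact (le_div_iff₀ (hp j hj)).1 (hmin j hj)
    · rw [Finsupp.notMem_support_iff.1 hj, mul_zero]; exact hw.1 j
  have ht1 : t < 1 := by
    by_contra hn
    push Not at hn
    apply hne
    have hge : ∀ j, w0 j ≤ w j := fun j => by
      have := hle j; have := hw0.1 j; nlinarith
    congr 1
    have hs : ∑ j ∈ σ, (w j - w0 j) = 0 := by
      rw [Finset.sum_sub_distrib, ← tot_eq_sum w σ hw.2.1, ← tot_eq_sum w0 σ hτ, hw.2.2, hw0.2.2, sub_self]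
    rw [Finset.sum_eq_zero_iff_of_nonneg (fun j _ => sub_nonneg.2 (hge j))] at hs
    ext j
    by_cases hj : j ∈ σ
    · exact sub_eq_zero.1 (hs j hj)
    · rw [Finsupp.notMem_support_iff.1 fun h => hj (hw.2.1 h), Finsupp.notMem_support_iff.1 fun h => hj (hτ h)]
  have h1t : 0 < 1 - t := by linarith
  refine ⟨(1 - t)⁻¹, inv_pos.2 h1t, (1 - t)⁻¹ • (w - t • w0), ⟨fun j => ?_, ⟨?_, ?_, ?_⟩, ?_⟩, ?_⟩
  · have := hle j
    simp only [Finsupp.smul_apply, Finsupp.sub_apply, smul_eq_mul]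
    exact mul_nonneg (inv_pos.2 h1t).le (by linarith)
  · apply support_nonempty
    rw [map_smul, map_sub, map_smul, hw.2.2, hw0.2.2, smul_eq_mul, smul_eq_mul, mul_one, inv_mul_cancel₀ h1t.ne']
  · intro h
    have := Finsupp.mem_support_iff.1 (h hi)
    apply this
    simp only [Finsupp.smul_apply, Finsupp.sub_apply, smul_eq_mul]
    rw [ht, div_mul_cancel₀ _ (hp i hi).ne', sub_self, mul_zero]
  · refine hL.2 σ hσ _ (Finset.union_subset ?_ hτ) ⟨i, Finset.mem_union_right _ hi⟩
    refine Finsupp.support_smul.trans (Finsupp.support_sub.trans (Finset.union_subset hw.2.1 ?_))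
    exact Finsupp.support_smul.trans hτ
  · rw [map_smul, map_sub, map_smul, hw.2.2, hw0.2.2, smul_eq_mul, smul_eq_mul, mul_one, inv_mul_cancel₀ h1t.ne']
  · rw [map_smul, map_sub, map_smul]
    have : lam e w - t • lam e w0 = (lam e w - lam e w0) + (1 - t) • lam e w0 := by
      rw [sub_smul, one_smul]; abel
    rw [this, smul_add, smul_smul, inv_mul_cancel₀ h1t.ne', one_smul, add_comm]

lemma lk_ne {L : Set (Finset X)} (hL : Cpx L) {e : X → E} (he : GR e L) {w0 : X →₀ ℝ} (hw0 : w0 ∈ Wt L)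
    {x : E} (hx : x ∈ car e (lk L w0.support)) : x ≠ lam e w0 := by
  rintro rfl
  obtain ⟨w, hw, h⟩ := hx
  have := he (Wt_mono (lk_sub hL _) hw) hw0 h
  subst this
  exact hw.2.1.2.1 subset_rfl

lemma link_radial {Y : Type*} {T : Set (Finset Y)} (hT : Cpx T) (hTf : T.Finite) {g : Y → ℕ → ℝ} (hg : GR g T)
    {L : Set (Finset X)} (hL : Cpx L) (hLf : L.Finite) {e : X → ℕ → ℝ} (he : GR e L)
    {w0 : X →₀ ℝ} (hw0 : w0 ∈ Wt L) {c0 : Y} (hc0 : {c0} ∈ T) (h0 : g c0 = lam e w0)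
    (hcar : car g T = car e L)
    (href : ∀ s ∈ T, ∃ σ ∈ L, convexHull ℝ (g '' (s : Set Y)) ⊆ convexHull ℝ (e '' (σ : Set X))) :
    PLH (car g (lk T {c0})) (car e (lk L w0.support)) := by
  set u0 : Y →₀ ℝ := Finsupp.single c0 1 with hu0
  have hu0W : u0 ∈ Wt T := Sx_Wt hT hc0 (single_mem_Sx (by simp))
  have hu0s : u0.support = {c0} := Finsupp.support_single_ne_zero _ one_ne_zero
  have hu0l : lam g u0 = lam e w0 := by rw [← h0]; simp [hu0, lam]
  have lkT : lk T {c0} = lk T u0.support := by rw [hu0s]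
  rw [lkT]
  refine PLH.radial_at (lam e w0) (Poly.car (hTf.subset (lk_sub hT _)) (lk_cpx hT _))
    (Poly.car (hLf.subset (lk_sub hL _)) (lk_cpx hL _)) ?_ (lk_ray hL he hw0) ?_ ?_
  · have := lk_ray hT hg hu0W
    rwa [hu0l] at this
  · intro x hx
    have hne := lk_ne hT hg hu0W hx
    obtain ⟨w, hw, rfl⟩ := hx
    obtain ⟨σ, hσ, hsub⟩ := href _ hw.2.1.2.2
    refine lk_push hw0 hσ ?_ hL (hsub ?_) (hu0l ▸ hne)
    · have : lam e w0 ∈ convexHull ℝ (e '' (σ : Set X)) := by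
        apply hsub
        rw [← h0]
        refine subset_convexHull ℝ _ ⟨c0, ?_, rfl⟩
        rw [hu0s]; simp
      rw [← lam_Sx] at this
      obtain ⟨v, hv, h⟩ := this
      have := he (Sx_Wt hL hσ hv) hw0 h
      rw [← this]; exact hv.2.1
    · rw [← lam_Sx]
      exact ⟨w, Sx_mono Finset.subset_union_left (Wt_Sx hw), rfl⟩
  · intro z hz
    have hne := lk_ne hL he hw0 hz
    -- points close to the centre
    have hin : ∀ a : ℝ, 0 < a → a ≤ 1 → lam e w0 + a • (z - lam e w0) ∈ car g T := by
      intro a ha ha1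
      obtain ⟨w, hw, rfl⟩ := hz
      rw [hcar]
      exact ⟨_, comb_Wt hL (Wt_Sx hw0) hw ha ha1, lam_comb e w0 w a⟩
    have hex : ∃ a : ℝ, 0 < a ∧ a ≤ 1 ∧ ∃ w ∈ Wt T, c0 ∈ w.support ∧ lam g w = lam e w0 + a • (z - lam e w0) := by
      by_contra hno
      push Not at hno
      set N : Set (ℕ → ℝ) := ⋃ s ∈ {s ∈ T | c0 ∉ s}, convexHull ℝ (g '' (s : Set Y)) with hN
      have hNc : IsClosed N :=
        (hTf.subset fun s hs => hs.1).isClosed_biUnion fun s _ => (s.finite_toSet.image g).isClosed_convexHull ℝ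
      have hlim : Filter.Tendsto (fun a : ℝ => lam e w0 + a • (z - lam e w0)) (nhdsWithin 0 (Set.Ioi 0))
          (nhds (lam e w0)) := by
        have hc : Continuous (fun a : ℝ => lam e w0 + a • (z - lam e w0)) := by fun_prop
        have := hc.tendsto 0
        simp only [zero_smul, add_zero] at this
        exact this.mono_left nhdsWithin_le_nhds
      have hmem : lam e w0 ∈ N := by
        refine hNc.mem_of_tendsto hlim ?_
        have : Set.Ioc (0 : ℝ) 1 ∈ nhdsWithin (0 : ℝ) (Set.Ioi 0) := Ioc_mem_nhdsGT one_pos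
        filter_upwards [this] with a ha
        obtain ⟨w, hw, h⟩ := hin a ha.1 ha.2
        refine Set.mem_biUnion (x := w.support) ⟨hw.2.1, fun hc => hno a ha.1 ha.2 w hw hc h⟩ ?_
        rw [← lam_Sx, ← h]; exact ⟨w, Wt_Sx hw, rfl⟩
      simp only [hN, Set.mem_iUnion] at hmem
      obtain ⟨s, hs, hmem⟩ := hmem
      rw [← lam_Sx] at hmem
      obtain ⟨w, hw, h⟩ := hmem
      have := hg (Sx_Wt hT hs.1 hw) hu0W (h.trans hu0l.symm)
      rw [this] at hw
      exact hs.2 (hw.2.1 (by rw [hu0s]; simp))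
    obtain ⟨a, ha, ha1, w, hw, hcw, h⟩ := hex
    obtain ⟨b, hb, hb2⟩ := lk_push (e := g) hu0W hw.2.1 (by rw [hu0s]; simpa using hcw) hT (y := lam g w)
      (by rw [← lam_Sx]; exact ⟨w, Wt_Sx hw, rfl⟩) (by
        rw [h, hu0l]
        intro h2
        rw [add_eq_left, smul_eq_zero, sub_eq_zero] at h2
        rcases h2 with h2 | h2
        · exact ha.ne' h2
        · exact hne h2)
    refine ⟨b * a, mul_pos hb ha, ?_⟩
    rw [h, hu0l, add_sub_cancel_left, smul_smul] at hb2
    exact hb2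

lemma link_PLH {Y : Type*} {K : Set (Finset Y)} (hK : Cpx K) (hKf : K.Finite) {f : Y → ℕ → ℝ} (hf : GR f K)
    {L : Set (Finset X)} (hL : Cpx L) (hLf : L.Finite) {e : X → ℕ → ℝ} (he : GR e L)
    (h : PLH (car f K) (car e L)) {u : Y} (hu : {u} ∈ K) :
    ∃ τ ∈ L, PLH (car f (lk K {u})) (car e (lk L τ)) := by
  obtain ⟨Γ, hΓ, h1, h2, h3, h4⟩ := h
  set u0 : Y →₀ ℝ := Finsupp.single u 1 with hu0
  have hu0W : u0 ∈ Wt K := Sx_Wt hK hu (single_mem_Sx (by simp))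
  have hu0s : u0.support = {u} := Finsupp.support_single_ne_zero _ one_ne_zero
  have hu0l : lam f u0 = f u := by simp [hu0, lam]
  have hfu : f u ∈ Prod.fst '' Γ := by rw [h3, ← hu0l]; exact ⟨_, hu0W, rfl⟩
  obtain ⟨⟨_, y0⟩, hp, rfl⟩ := hfu
  have hy0 : y0 ∈ car e L := by rw [← h4]; exact ⟨_, hp, rfl⟩
  obtain ⟨w0, hw0, hwy⟩ := hy0
  set pt := (f u, y0) with hpt
  set fam : Finset Y × Finset X → Set ((ℕ → ℝ) × (ℕ → ℝ)) := fun q =>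
    Γ ∩ (convexHull ℝ (f '' (q.1 : Set Y)) ×ˢ convexHull ℝ (e '' (q.2 : Set X))) with hfam
  set PP : Set (Set ((ℕ → ℝ) × (ℕ → ℝ))) := insert {(f u, y0)} (fam '' (K ×ˢ L)) with hPP
  have hPPf : PP.Finite := ((hKf.prod hLf).image fam).insert _
  have hPPp : ∀ P ∈ PP, Poly P := by
    rintro P (rfl | ⟨q, hq, rfl⟩)
    · have := Poly.conv (E := (ℕ → ℝ) × (ℕ → ℝ)) (Set.finite_singleton (f u, y0))
      rwa [convexHull_singleton] at this
    · exact hΓ.inter ((Poly.conv (q.1.finite_toSet.image f)).prod (Poly.conv (q.2.finite_toSet.image e)))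
  have hPPu : ⋃₀ PP = Γ := by
    apply Set.Subset.antisymm
    · rintro x ⟨P, (rfl | ⟨q, hq, rfl⟩), hx⟩
      · rw [Set.mem_singleton_iff] at hx; rw [hx]; exact hp
      · exact hx.1
    · rintro ⟨x, y⟩ hxy
      have hx : x ∈ car f K := by rw [← h3]; exact ⟨_, hxy, rfl⟩
      have hy : y ∈ car e L := by rw [← h4]; exact ⟨_, hxy, rfl⟩
      obtain ⟨w, hw, rfl⟩ := hx
      obtain ⟨v, hv, rfl⟩ := hy
      refine ⟨fam (w.support, v.support), Or.inr ⟨_, ⟨hw.2.1, hv.2.1⟩, rfl⟩, hxy, ?_, ?_⟩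
      · simp only; rw [← lam_Sx]; exact ⟨w, Wt_Sx hw, rfl⟩
      · simp only; rw [← lam_Sx]; exact ⟨v, Wt_Sx hv, rfl⟩
  obtain ⟨κ, T, g, hTf, hT, hg, hcar, href⟩ := tri PP hPPf hPPp
  rw [hPPu] at hcar
  have l1 : ∀ w, lam (fun v => (g v).1) w = (lam g w).1 := fun w => lam_comp g (LinearMap.fst ℝ _ _) w
  have l2 : ∀ w, lam (fun v => (g v).2) w = (lam g w).2 := fun w => lam_comp g (LinearMap.snd ℝ _ _) w
  have hm : ∀ w ∈ Wt T, lam g w ∈ Γ := fun w hw => hcar ▸ ⟨w, hw, rfl⟩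
  have g1 : GR (fun v => (g v).1) T := by
    intro w hw u hu h
    rw [l1, l1] at h
    exact hg hw hu (h1 _ (hm w hw) _ (hm u hu) h)
  have g2 : GR (fun v => (g v).2) T := by
    intro w hw u hu h
    rw [l2, l2] at h
    exact hg hw hu (h2 _ (hm w hw) _ (hm u hu) h)
  have c1 : car (fun v => (g v).1) T = car f K := by
    rw [← h3, ← hcar, car, car, ← Set.image_comp]
    exact Set.image_congr fun w _ => l1 w
  have c2 : car (fun v => (g v).2) T = car e L := by
    rw [← h4, ← hcar, car, car, ← Set.image_comp]
    exact Set.image_congr fun w _ => l2 w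
  -- the vertex over the point
  obtain ⟨c0, hc0T, hc0⟩ : ∃ c0, {c0} ∈ T ∧ g c0 = (f u, y0) := by
    have : (f u, y0) ∈ car g T := by rw [hcar]; exact hp
    obtain ⟨w, hw, h⟩ := this
    obtain ⟨c, hc⟩ := support_nonempty hw.2.2
    refine ⟨c, hT.2 _ hw.2.1 _ (by simpa using hc) (by simp), ?_⟩
    have := href {(f u, y0)} (Or.inl rfl) w hw (by rw [h]; rfl)
    exact this (subset_convexHull ℝ _ ⟨c, hc, rfl⟩)
  -- refinement
  have hr : ∀ s ∈ T, ∃ σ ∈ K, ∃ ρ ∈ L, convexHull ℝ (g '' (s : Set κ)) ⊆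
      convexHull ℝ (f '' (σ : Set Y)) ×ˢ convexHull ℝ (e '' (ρ : Set X)) := by
    intro s hs
    have hwu := unif_mem_Wt hT hs
    have hx : lam g (unif s) ∈ Γ := hm _ hwu
    have hx1 : (lam g (unif s)).1 ∈ car f K := by rw [← h3]; exact ⟨_, hx, rfl⟩
    have hx2 : (lam g (unif s)).2 ∈ car e L := by rw [← h4]; exact ⟨_, hx, rfl⟩
    obtain ⟨w, hw, e1⟩ := hx1
    obtain ⟨v, hv, e2⟩ := hx2
    refine ⟨w.support, hw.2.1, v.support, hv.2.1, ?_⟩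
    have := href (fam (w.support, v.support)) (Or.inr ⟨_, ⟨hw.2.1, hv.2.1⟩, rfl⟩) _ hwu
      ⟨hx, by simp only; rw [← lam_Sx, ← e1]; exact ⟨w, Wt_Sx hw, rfl⟩,
        by simp only; rw [← lam_Sx, ← e2]; exact ⟨v, Wt_Sx hv, rfl⟩⟩
    rw [unif_support] at this
    exact this.trans Set.inter_subset_right
  have i1 : ∀ s : Finset κ, convexHull ℝ ((fun v => (g v).1) '' (s : Set κ)) = Prod.fst '' convexHull ℝ (g '' (s : Set κ)) := by
    intro s
    have := (LinearMap.fst ℝ (ℕ → ℝ) (ℕ → ℝ)).image_convexHull (g '' (s : Set κ))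
    rw [← Set.image_comp] at this
    exact this.symm
  have i2 : ∀ s : Finset κ, convexHull ℝ ((fun v => (g v).2) '' (s : Set κ)) = Prod.snd '' convexHull ℝ (g '' (s : Set κ)) := by
    intro s
    have := (LinearMap.snd ℝ (ℕ → ℝ) (ℕ → ℝ)).image_convexHull (g '' (s : Set κ))
    rw [← Set.image_comp] at this
    exact this.symm
  have p1 := link_radial hT hTf g1 hK hKf hf hu0W hc0T (by rw [hc0, hu0l]) c1 (by
    intro s hs
    obtain ⟨σ, hσ, ρ, hρ, hsub⟩ := hr s hs
    refine ⟨σ, hσ, ?_⟩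
    rw [i1]; rintro _ ⟨q, hq, rfl⟩; exact (hsub hq).1)
  have p2 := link_radial hT hTf g2 hL hLf he hw0 hc0T (by rw [hc0, hwy]) c2 (by
    intro s hs
    obtain ⟨σ, hσ, ρ, hρ, hsub⟩ := hr s hs
    refine ⟨ρ, hρ, ?_⟩
    rw [i2]; rintro _ ⟨q, hq, rfl⟩; exact (hsub hq).2)
  rw [hu0s] at p1
  have p3 := PLH.simp (hTf.subset (lk_sub hT {c0})) (lk_cpx hT {c0}) (g1.mono (lk_sub hT {c0})) (g2.mono (lk_sub hT {c0}))
  exact ⟨_, hw0.2.1, p1.symm.trans (p3.trans p2)⟩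

end linksec

/-- the projection from `a` along the barycentre of `τ` -/
def horn (τ : Finset ℕ) (a : ℕ) : (ℕ → ℝ) →ₗ[ℝ] (ℕ → ℝ) :=
  LinearMap.pi fun i => if i = a then 0 else
    if i ∈ τ then LinearMap.proj i + (τ.card : ℝ)⁻¹ • LinearMap.proj a else LinearMap.proj i

lemma horn_apply (τ : Finset ℕ) (a : ℕ) (x : ℕ → ℝ) (i : ℕ) : horn τ a x i =
    if i = a then 0 else if i ∈ τ then x i + (τ.card : ℝ)⁻¹ * x a else x i := by
  simp only [horn, LinearMap.pi_apply]
  split_ifs <;> simp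

/-- the part of the simplex where some coordinate in `τ` vanishes -/
def ZB (A τ : Finset ℕ) : Set (ℕ → ℝ) := {x | x ∈ DD A ∧ ∃ i ∈ τ, x i = 0}

lemma horn_inj {A τ : Finset ℕ} {a : ℕ} (haτ : a ∉ τ) (hτ : τ.Nonempty) :
    Set.InjOn (horn τ a) (ZB A τ) := by
  have hc : (0 : ℝ) < (τ.card : ℝ)⁻¹ := by
    have := Finset.card_pos.2 hτ
    positivity
  have key : ∀ x ∈ ZB A τ, ∀ y ∈ ZB A τ, horn τ a x = horn τ a y → y a ≤ x a := by
    rintro x ⟨hx, i, hi, h0⟩ y ⟨hy, -⟩ h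
    have h1 := congrFun h i
    have hia : i ≠ a := fun h => haτ (h ▸ hi)
    rw [horn_apply, horn_apply, if_neg hia, if_neg hia, if_pos hi, if_pos hi, h0, zero_add] at h1
    have := hy.1 i
    nlinarith
  intro x hx y hy h
  have ha : x a = y a := le_antisymm (key y hy x hx h.symm) (key x hx y hy h)
  funext i
  have h1 := congrFun h i
  rw [horn_apply, horn_apply] at h1
  split_ifs at h1 with h2 h3
  · rw [h2, ha]
  · rw [ha] at h1; linarith
  · exact h1

lemma horn_maps {A τ : Finset ℕ} {a : ℕ} (haτ : a ∉ τ) (ha : a ∈ A) (hτ : τ.Nonempty) (hA : τ ⊆ A)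
    {x : ℕ → ℝ} (hx : x ∈ DD A) : horn τ a x ∈ DD (A.erase a) := by
  have hc : (0 : ℝ) < (τ.card : ℝ) := by exact_mod_cast Finset.card_pos.2 hτ
  refine ⟨fun i => ?_, fun i hi => ?_, ?_⟩
  · have := hx.1 i; have := hx.1 a
    rw [horn_apply]; split_ifs <;> positivity
  · rw [horn_apply]
    by_cases h : i = a
    · rw [if_pos h]
    · have hiA : i ∉ A := fun h' => hi (Finset.mem_erase.2 ⟨h, h'⟩)
      rw [if_neg h, if_neg fun h' => hiA (hA h'), hx.2.1 i hiA]
  · have h1 : ∀ i ∈ A.erase a, horn τ a x i = x i + if i ∈ τ then (τ.card : ℝ)⁻¹ * x a else 0 := by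
      intro i hi
      rw [horn_apply, if_neg (Finset.ne_of_mem_erase hi)]
      split_ifs <;> simp
    have h2 : (A.erase a).filter (· ∈ τ) = τ := by
      ext i; simp only [Finset.mem_filter, Finset.mem_erase]
      exact ⟨fun h => h.2, fun h => ⟨⟨fun h' => haτ (h' ▸ h), hA h⟩, h⟩⟩
    rw [Finset.sum_congr rfl h1, Finset.sum_add_distrib, ← Finset.sum_filter, h2, Finset.sum_const,
      nsmul_eq_mul, ← mul_assoc, mul_inv_cancel₀ hc.ne', one_mul, Finset.sum_erase_add _ _ ha]
    exact hx.2.2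

lemma horn_surj {A τ : Finset ℕ} {a : ℕ} (haτ : a ∉ τ) (ha : a ∈ A) (hτ : τ.Nonempty) (hA : τ ⊆ A)
    {y : ℕ → ℝ} (hy : y ∈ DD (A.erase a)) : ∃ x ∈ ZB A τ, horn τ a x = y ∧
      (∀ j ∈ τ, y j = 0 → x a = 0) ∧ ∀ j, j ∉ τ → j ≠ a → x j = y j := by
  have hc : (0 : ℝ) < (τ.card : ℝ) := by exact_mod_cast Finset.card_pos.2 hτ
  obtain ⟨m, hm, hmin⟩ := τ.exists_min_image y hτ
  set x : ℕ → ℝ := fun i => if i = a then y m * τ.card else if i ∈ τ then y i - y m else y i with hx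
  have hxa : x a = y m * τ.card := by simp [hx]
  have hma : m ≠ a := fun h => haτ (h ▸ hm)
  have hxt : ∀ i ∈ τ, x i = y i - y m := fun i hi => by
    have : i ≠ a := fun h => haτ (h ▸ hi)
    simp only [hx]; rw [if_neg this, if_pos hi]
  have hxn : ∀ j, j ∉ τ → j ≠ a → x j = y j := fun j hj hja => by
    simp only [hx]; rw [if_neg hja, if_neg hj]
  have hhorn : horn τ a x = y := by
    funext i
    rw [horn_apply]
    split_ifs with h1 h2
    · rw [h1, hy.2.1 a (by simp)]
    · rw [hxt i h2, hxa]; field_simp; ring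
    · exact hxn i h2 h1
  have hym := hy.1 m
  refine ⟨x, ⟨⟨fun i => ?_, fun i hi => ?_, ?_⟩, m, hm, by rw [hxt m hm, sub_self]⟩, hhorn, ?_, hxn⟩
  · by_cases h1 : i = a
    · rw [h1, hxa]; positivity
    · by_cases h2 : i ∈ τ
      · rw [hxt i h2]; linarith [hmin i h2]
      · rw [hxn i h2 h1]; exact hy.1 i
  · rw [hxn i (fun h => hi (hA h)) (fun h => hi (h ▸ ha))]
    exact hy.2.1 i fun h => hi (Finset.mem_of_mem_erase h)
  · have h1 : ∀ i ∈ A.erase a, x i = y i - if i ∈ τ then y m else 0 := by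
      intro i hi
      by_cases h2 : i ∈ τ
      · rw [hxt i h2, if_pos h2]
      · rw [hxn i h2 (Finset.ne_of_mem_erase hi), if_neg h2, sub_zero]
    have h2 : (A.erase a).filter (· ∈ τ) = τ := by
      ext i; simp only [Finset.mem_filter, Finset.mem_erase]
      exact ⟨fun h => h.2, fun h => ⟨⟨fun h' => haτ (h' ▸ h), hA h⟩, h⟩⟩
    rw [← Finset.sum_erase_add _ _ ha, Finset.sum_congr rfl h1, Finset.sum_sub_distrib, ← Finset.sum_filter, h2,
      Finset.sum_const, nsmul_eq_mul, hy.2.2, hxa]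
    ring
  · intro j hj h0
    have : y m = 0 := le_antisymm (h0 ▸ hmin j hj) hym
    rw [hxa, this, zero_mul]

lemma ZB_poly {A τ : Finset ℕ} : Poly (ZB A τ) := by
  have : ZB A τ = ⋃ i ∈ (τ : Set ℕ), DD (A.erase i) := by
    ext x
    simp only [ZB, Set.mem_setOf_eq, Set.mem_iUnion, DD_erase, Finset.mem_coe, exists_prop]
    constructor
    · rintro ⟨h, i, hi, h0⟩; exact ⟨i, hi, h, h0⟩
    · rintro ⟨i, hi, h, h0⟩; exact ⟨h, i, hi, h0⟩
  rw [this]; exact Poly.biUnion τ.finite_toSet fun i _ => DD_poly _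

lemma ZB_PLH {A τ : Finset ℕ} {a : ℕ} (haτ : a ∉ τ) (ha : a ∈ A) (hτ : τ.Nonempty) (hA : τ ⊆ A) :
    PLH (ZB A τ) (DD (A.erase a)) := by
  have h := PLH.affine (ZB_poly (A := A) (τ := τ)) (horn τ a).toAffineMap (horn_inj haτ hτ)
  convert h using 1
  apply Set.Subset.antisymm
  · intro y hy
    obtain ⟨x, hx, h, -⟩ := horn_surj haτ ha hτ hA hy
    exact ⟨x, hx, h⟩
  · rintro _ ⟨x, hx, rfl⟩
    exact horn_maps haτ ha hτ hA hx.1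

lemma ZS_PLH {A τ : Finset ℕ} {a : ℕ} (haτ : a ∉ τ) (ha : a ∈ A) (hτ : τ.Nonempty) (hA : τ ⊆ A) :
    PLH (ZB A τ ∩ ZB A (A \ τ)) (SS (A.erase a)) := by
  have h := PLH.affine ((ZB_poly (A := A) (τ := τ)).inter (ZB_poly (A := A) (τ := A \ τ)))
    (horn τ a).toAffineMap ((horn_inj haτ hτ).mono Set.inter_subset_left)
  convert h using 1
  apply Set.Subset.antisymm
  · rintro y ⟨hy, j, hj, hj0⟩
    obtain ⟨x, hx, h, h1, h2⟩ := horn_surj haτ ha hτ hA hy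
    refine ⟨x, ⟨hx, hx.1, ?_⟩, h⟩
    by_cases hjt : j ∈ τ
    · exact ⟨a, Finset.mem_sdiff.2 ⟨ha, haτ⟩, h1 j hjt hj0⟩
    · exact ⟨j, Finset.mem_sdiff.2 ⟨Finset.mem_of_mem_erase hj, hjt⟩,
        by rw [h2 j hjt (Finset.ne_of_mem_erase hj), hj0]⟩
  · rintro _ ⟨x, ⟨⟨hx, i, hi, hi0⟩, -, j, hj, hj0⟩, rfl⟩
    refine ⟨horn_maps haτ ha hτ hA hx, ?_⟩
    show ∃ i ∈ A.erase a, horn τ a x i = 0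
    rw [Finset.mem_sdiff] at hj
    by_cases hja : j = a
    · subst hja
      have hij : i ≠ j := fun h => haτ (h ▸ hi)
      exact ⟨i, Finset.mem_erase.2 ⟨hij, hA hi⟩, by rw [horn_apply, if_neg hij, if_pos hi, hi0, hj0]; simp⟩
    · exact ⟨j, Finset.mem_erase.2 ⟨hja, hj.1⟩, by rw [horn_apply, if_neg hja, if_neg hj.2, hj0]⟩

lemma mem_lk {X : Type*} [DecidableEq X] {L : Set (Finset X)} {s τ : Finset X} :
    s ∈ lk L τ ↔ s.Nonempty ∧ ¬ τ ⊆ s ∧ s ∪ τ ∈ L := by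
  unfold lk
  rw [Set.mem_setOf_eq]
  have : ∀ i1 i2 : DecidableEq X, @Union.union (Finset X) (@Finset.instUnion X i1) s τ =
    @Union.union (Finset X) (@Finset.instUnion X i2) s τ := fun i1 i2 => by rw [Subsingleton.elim i1 i2]
  rw [this]

lemma lk_stdBall {A τ : Finset ℕ} (hA : τ ⊆ A) :
    car ee (lk (stdBall A : Set (Finset ℕ)) τ) = ZB A τ := by
  ext x
  simp only [ZB, DD_eq, Set.mem_setOf_eq]
  constructor
  · rintro ⟨w, ⟨h1, h234, h5⟩, rfl⟩
    obtain ⟨h2, h3, h4⟩ := mem_lk.1 h234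
    simp only [stdBall, Finset.mem_coe, Finset.mem_erase, Finset.mem_powerset] at h4
    refine ⟨⟨w, ⟨h1, Finset.subset_union_left.trans h4.2, h5⟩, rfl⟩, ?_⟩
    obtain ⟨i, hi, h⟩ := Finset.not_subset.1 h3
    exact ⟨i, hi, by rw [lam_ee]; exact Finsupp.notMem_support_iff.1 h⟩
  · rintro ⟨⟨w, ⟨h1, h2, h3⟩, rfl⟩, i, hi, h0⟩
    rw [lam_ee] at h0
    have hn := support_nonempty h3
    refine ⟨w, ⟨h1, mem_lk.2 ⟨hn, fun h => ?_, ?_⟩, h3⟩, rfl⟩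
    · exact Finsupp.mem_support_iff.1 (h hi) h0
    · simp only [stdBall, Finset.mem_coe, Finset.mem_erase, Finset.mem_powerset]
      exact ⟨(hn.mono Finset.subset_union_left).ne_empty, Finset.union_subset h2 hA⟩

lemma lk_stdSphere {A τ : Finset ℕ} (hA : τ ⊆ A) :
    car ee (lk (stdSphere A : Set (Finset ℕ)) τ) = ZB A τ ∩ ZB A (A \ τ) := by
  ext x
  simp only [ZB, DD_eq, Set.mem_setOf_eq, Set.mem_inter_iff]
  constructor
  · rintro ⟨w, ⟨h1, h234, h5⟩, rfl⟩
    obtain ⟨h2, h3, h4⟩ := mem_lk.1 h234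
    simp only [stdSphere, Finset.mem_coe, Finset.mem_erase, Finset.mem_powerset] at h4
    have h6 : lam ee w ∈ lam ee '' Sx A := ⟨w, ⟨h1, Finset.subset_union_left.trans h4.2.2, h5⟩, rfl⟩
    refine ⟨⟨h6, ?_⟩, h6, ?_⟩
    · obtain ⟨i, hi, h⟩ := Finset.not_subset.1 h3
      exact ⟨i, hi, by rw [lam_ee]; exact Finsupp.notMem_support_iff.1 h⟩
    · have : ¬ A ⊆ w.support ∪ τ := fun h => h4.1 (Finset.Subset.antisymm h4.2.2 h)
      obtain ⟨i, hi, h⟩ := Finset.not_subset.1 this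
      rw [Finset.mem_union, not_or] at h
      exact ⟨i, Finset.mem_sdiff.2 ⟨hi, h.2⟩, by rw [lam_ee]; exact Finsupp.notMem_support_iff.1 h.1⟩
  · rintro ⟨⟨⟨w, ⟨h1, h2, h3⟩, rfl⟩, i, hi, h0⟩, -, j, hj, hj0⟩
    rw [lam_ee] at h0 hj0
    have hn := support_nonempty h3
    refine ⟨w, ⟨h1, mem_lk.2 ⟨hn, fun h => ?_, ?_⟩, h3⟩, rfl⟩
    · exact Finsupp.mem_support_iff.1 (h hi) h0
    · simp only [stdSphere, Finset.mem_coe, Finset.mem_erase, Finset.mem_powerset]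
      refine ⟨fun h => ?_, (hn.mono Finset.subset_union_left).ne_empty, Finset.union_subset h2 hA⟩
      rw [Finset.mem_sdiff] at hj
      rw [← h, Finset.mem_union] at hj
      rcases hj.1 with h | h
      · exact Finsupp.mem_support_iff.1 h hj0
      · exact hj.2 h

lemma ball_link {Y : Type*} {K : Set (Finset Y)} (hK : Cpx K) (hKf : K.Finite) {f : Y → ℕ → ℝ} (hf : GR f K)
    {k : ℕ} (h : Ball (k + 1) (car f K)) {u : Y} (hu : {u} ∈ K) :
    Ball k (car f (lk K {u})) ∨ Sph k (car f (lk K {u})) := by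
  obtain ⟨A, hA, h⟩ := h
  rw [← car_stdBall] at h
  obtain ⟨τ, hτ, h⟩ := link_PLH hK hKf hf (stdBall_cpx A) (Finset.finite_toSet _) (GR_ee _) h hu
  simp only [stdBall, Finset.mem_coe, Finset.mem_erase, Finset.mem_powerset] at hτ
  rw [lk_stdBall hτ.2] at h
  by_cases hc : τ = A
  · right
    subst hc
    exact ⟨τ, hA, h⟩
  · left
    obtain ⟨a, ha, hat⟩ := Finset.exists_of_ssubset (Finset.ssubset_iff_subset_ne.2 ⟨hτ.2, hc⟩)
    exact ⟨A.erase a, by rw [Finset.card_erase_of_mem ha, hA]; rfl,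
      h.trans (ZB_PLH hat ha (Finset.nonempty_iff_ne_empty.2 hτ.1) hτ.2)⟩

lemma sph_link {Y : Type*} {K : Set (Finset Y)} (hK : Cpx K) (hKf : K.Finite) {f : Y → ℕ → ℝ} (hf : GR f K)
    {k : ℕ} (h : Sph (k + 1) (car f K)) {u : Y} (hu : {u} ∈ K) : Sph k (car f (lk K {u})) := by
  obtain ⟨A, hA, h⟩ := h
  rw [← car_stdSphere] at h
  obtain ⟨τ, hτ, h⟩ := link_PLH hK hKf hf (stdSphere_cpx A) (Finset.finite_toSet _) (GR_ee _) h hu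
  simp only [stdSphere, Finset.mem_coe, Finset.mem_erase, Finset.mem_powerset] at hτ
  rw [lk_stdSphere hτ.2.2] at h
  obtain ⟨a, ha, hat⟩ := Finset.exists_of_ssubset (Finset.ssubset_iff_subset_ne.2 ⟨hτ.2.2, hτ.1⟩)
  exact ⟨A.erase a, by rw [Finset.card_erase_of_mem ha, hA]; rfl,
    h.trans (ZS_PLH hat ha (Finset.nonempty_iff_ne_empty.2 hτ.2.1) hτ.2.2)⟩

section mfd
variable {X : Type*}

/-- Link of a face. -/
def Lk (K : Set (Finset X)) (τ : Finset X) : Set (Finset X) :=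
  {s | s.Nonempty ∧ Disjoint s τ ∧ s ∪ τ ∈ K}

lemma Lk_sub {K : Set (Finset X)} (hK : Cpx K) (τ : Finset X) : Lk K τ ⊆ K :=
  fun s hs => hK.2 _ hs.2.2 s Finset.subset_union_left hs.1

lemma Lk_cpx {K : Set (Finset X)} (hK : Cpx K) (τ : Finset X) : Cpx (Lk K τ) := by
  refine ⟨fun h => by simpa using h.1, fun s hs t ht hn =>
    ⟨hn, Finset.disjoint_of_subset_left ht hs.2.1, ?_⟩⟩
  exact hK.2 _ hs.2.2 _ (Finset.union_subset_union ht subset_rfl) (hn.mono Finset.subset_union_left)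

lemma lk_Lk {K : Set (Finset X)} {τ : Finset X} {v : X} (hv : v ∉ τ) :
    lk (Lk K τ) {v} = Lk K (insert v τ) := by
  ext s
  have e : s ∪ {v} ∪ τ = s ∪ insert v τ := by
    ext i; simp only [Finset.mem_union, Finset.mem_singleton, Finset.mem_insert]; tauto
  constructor
  · rintro ⟨h1, h2, h3, h4, h5⟩
    refine ⟨h1, ?_, by rwa [← e]⟩
    rw [Finset.disjoint_insert_right]
    exact ⟨fun h => h2 (by simpa using h), Finset.disjoint_of_subset_left Finset.subset_union_left h4⟩
  · rintro ⟨h1, h2, h3⟩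
    rw [Finset.disjoint_insert_right] at h2
    refine ⟨h1, fun h => h2.1 (by simpa using h), h1.mono Finset.subset_union_left, ?_, by rwa [e]⟩
    rw [Finset.disjoint_union_left]
    exact ⟨h2.2, by simpa using hv⟩

lemma single_Lk {K : Set (Finset X)} {τ : Finset X} {v : X} (hv : v ∉ τ) (h : insert v τ ∈ K) :
    {v} ∈ Lk K τ := by
  refine ⟨by simp, by simpa using hv, ?_⟩
  rwa [← Finset.insert_eq]

lemma link_face {K : Set (Finset X)} (hK : Cpx K) (hKf : K.Finite) {f : X → ℕ → ℝ} (hf : GR f K) (d : ℕ)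
    (hv : ∀ v, {v} ∈ K → Ball (d - 1) (car f (Lk K {v})) ∨ Sph (d - 1) (car f (Lk K {v})))
    (τ : Finset X) : τ.Nonempty → τ ∈ K → τ.card ≤ d →
      Ball (d - τ.card) (car f (Lk K τ)) ∨ Sph (d - τ.card) (car f (Lk K τ)) := by
  induction τ using Finset.induction_on with
  | empty => intro h; simp at h
  | insert v τ hvτ ih =>
    intro _ hτ hc
    rcases τ.eq_empty_or_nonempty with rfl | hn
    · simpa using hv v (by simpa using hτ)
    · rw [Finset.card_insert_of_notMem hvτ] at hc ⊢
      have ih := ih hn (hK.2 _ hτ _ (Finset.subset_insert _ _) hn) (by omega)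
      have e : d - τ.card = (d - (τ.card + 1)) + 1 := by omega
      rw [e] at ih
      have hfin := hKf.subset (Lk_sub hK τ)
      have hg := hf.mono (Lk_sub hK τ)
      rw [← lk_Lk hvτ]
      rcases ih with ih | ih
      · exact ball_link (Lk_cpx hK τ) hfin hg ih (single_Lk hvτ hτ)
      · exact Or.inr (sph_link (Lk_cpx hK τ) hfin hg ih (single_Lk hvτ hτ))

lemma sph_up {K : Set (Finset X)} (hK : Cpx K) (hKf : K.Finite) {f : X → ℕ → ℝ} (hf : GR f K) (d : ℕ)
    {τ : Finset X} (hτ : τ.Nonempty) (h : Sph (d - τ.card) (car f (Lk K τ))) (n : ℕ) : ∀ σ ∈ K, τ ⊆ σ →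
      (σ \ τ).card = n → σ.card ≤ d → Sph (d - σ.card) (car f (Lk K σ)) := by
  induction n with
  | zero =>
    intro σ hσ hs hn _
    have : σ = τ := Finset.Subset.antisymm (by rwa [Finset.card_eq_zero, Finset.sdiff_eq_empty_iff_subset] at hn) hs
    rwa [this]
  | succ n ih =>
    intro σ hσ hs hn hc
    obtain ⟨v, hv⟩ : (σ \ τ).Nonempty := Finset.card_pos.1 (by omega)
    rw [Finset.mem_sdiff] at hv
    have hsub : τ ⊆ σ.erase v := fun i hi => Finset.mem_erase.2 ⟨fun h => hv.2 (h ▸ hi), hs hi⟩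
    have hcard := Finset.card_erase_add_one hv.1
    have ih := ih (σ.erase v) (hK.2 _ hσ _ (Finset.erase_subset _ _) (hτ.mono hsub)) hsub (by
      rw [Finset.erase_sdiff_comm, Finset.card_erase_of_mem (Finset.mem_sdiff.2 hv), hn]; rfl) (by omega)
    have e : d - (σ.erase v).card = (d - σ.card) + 1 := by omega
    rw [e] at ih
    have hfin := hKf.subset (Lk_sub hK (σ.erase v))
    have hg := hf.mono (Lk_sub hK (σ.erase v))
    have := sph_link (Lk_cpx hK _) hfin hg ih (u := v) (single_Lk (by simp) (by rwa [Finset.insert_erase hv.1]))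
    rwa [lk_Lk (by simp), Finset.insert_erase hv.1] at this

lemma not_sph0 {P : Set (ℕ → ℝ)} (hP : P.Subsingleton) : ¬ Sph 0 P := by
  rintro ⟨A, hA, Γ, hΓ, h1, h2, h3, h4⟩
  obtain ⟨a, b, hab, rfl⟩ := Finset.card_eq_two.1 hA
  have hS : (SS {a, b}).Subsingleton := by
    rw [← h4]
    rintro _ ⟨p, hp, rfl⟩ _ ⟨q, hq, rfl⟩
    have : p = q := h1 p hp q hq (hP (h3 ▸ ⟨p, hp, rfl⟩) (h3 ▸ ⟨q, hq, rfl⟩))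
    rw [this]
  have key : ∀ c c' : ℕ, c ≠ c' → c ∈ ({a, b} : Finset ℕ) → c' ∈ ({a, b} : Finset ℕ) → ee c ∈ SS {a, b} := by
    intro c c' hc h h'
    refine ⟨?_, c', h', ?_⟩
    · rw [DD_conv]; exact subset_convexHull ℝ _ ⟨c, h, rfl⟩
    · simp [ee, hc.symm]
  have := hS (key a b hab (by simp) (by simp)) (key b a hab.symm (by simp) (by simp))
  have := congrFun this a
  simp [ee, hab] at this

lemma bdry_ball {K : Set (Finset X)} (hK : Cpx K) (hKf : K.Finite) {f : X → ℕ → ℝ} (hf : GR f K) (d : ℕ)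
    (hv : ∀ v, {v} ∈ K → Ball (d - 1) (car f (Lk K {v})) ∨ Sph (d - 1) (car f (Lk K {v})))
    {τ s : Finset X} (hτ : τ.Nonempty) (hs : s ∈ K) (hts : τ ⊆ s) (hsd : s.card = d)
    (hdeg : ∀ v w, insert v s ∈ K → insert w s ∈ K → v ∉ s → w ∉ s → v = w) :
    Ball (d - τ.card) (car f (Lk K τ)) := by
  have hc : τ.card ≤ d := hsd ▸ Finset.card_le_card hts
  rcases link_face hK hKf hf d hv τ hτ (hK.2 _ hs _ hts hτ) hc with h | h
  · exact h
  exfalso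
  have h := sph_up hK hKf hf d hτ h _ s hs hts rfl hsd.le
  rw [hsd, Nat.sub_self] at h
  refine not_sph0 ?_ h
  have hvert : ∀ t ∈ Lk K s, ∀ v ∈ t, insert v s ∈ K ∧ v ∉ s := by
    intro t ht v hv
    refine ⟨hK.2 _ ht.2.2 _ ?_ (by simp), Finset.disjoint_left.1 ht.2.1 hv⟩
    exact Finset.insert_subset (Finset.mem_union_left _ hv) Finset.subset_union_right
  rintro _ ⟨w, hw, rfl⟩ _ ⟨u, hu, rfl⟩
  congr 1
  obtain ⟨z, hz⟩ := hw.2.1.1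
  have e : ∀ t ∈ Lk K s, t ⊆ {z} := by
    intro t ht v hv
    have h1 := hvert t ht v hv
    have h2 := hvert _ hw.2.1 z hz
    rw [Finset.mem_singleton]
    exact hdeg v z h1.1 h2.1 h1.2 h2.2
  have h1 := e _ hw.2.1
  have h2 := e _ hu.2.1
  have h3 := hw.2.2
  have h4 := hu.2.2
  rw [tot_eq_sum w _ h1, Finset.sum_singleton] at h3
  rw [tot_eq_sum u _ h2, Finset.sum_singleton] at h4
  ext i
  by_cases hi : i = z
  · rw [hi, h3, h4]
  · rw [Finsupp.notMem_support_iff.1 fun h => hi (by simpa using h1 h),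
      Finsupp.notMem_support_iff.1 fun h => hi (by simpa using h2 h)]

end mfd

section cone
variable {E F : Type*} [AddCommGroup E] [Module ℝ E] [AddCommGroup F] [Module ℝ F]

/-- Geometric cone. -/
def Cone (o : E) (P : Set E) : Set E := {x | ∃ y ∈ P, ∃ t : ℝ, 0 ≤ t ∧ t ≤ 1 ∧ x = (1 - t) • o + t • y}

/-- The cone is nondegenerate. -/
def Cn (o : E) (P : Set E) : Prop := ∀ x ∈ P, ∀ y ∈ P, ∀ t u : ℝ, 0 ≤ t → t ≤ 1 → 0 ≤ u → u ≤ 1 →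
  (1 - t) • o + t • x = (1 - u) • o + u • y → t = u ∧ (t ≠ 0 → x = y)

lemma Cone_poly (o : E) {P : Set E} (h : Poly P) : Poly (Cone o P) := by
  obtain ⟨S, rfl, hS⟩ := poly_simp h
  have : Cone o (⋃ s ∈ S, convexHull ℝ (s : Set E)) =
      ⋃ s ∈ (S : Set (Finset E)), convexHull ℝ (insert o (s : Set E)) := by
    ext x
    simp only [Cone, Set.mem_setOf_eq, Set.mem_iUnion, exists_prop]
    constructor
    · rintro ⟨y, ⟨s, hs, hy⟩, t, h0, h1, rfl⟩
      refine ⟨s, hs, ?_⟩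
      rw [convexHull_insert (by exact_mod_cast (hS s hs).1), mem_convexJoin]
      exact ⟨o, rfl, y, hy, 1 - t, t, by linarith, h0, by ring, rfl⟩
    · rintro ⟨s, hs, hx⟩
      rw [convexHull_insert (by exact_mod_cast (hS s hs).1), mem_convexJoin] at hx
      obtain ⟨_, rfl, y, hy, a, b, ha, hb, hab, rfl⟩ := hx
      exact ⟨y, ⟨s, hs, hy⟩, b, hb, by linarith, by rw [← hab]; simp⟩
  rw [this]
  exact Poly.biUnion S.finite_toSet fun s _ => Poly.conv (s.finite_toSet.insert o)

lemma Cone_PLH {o : E} {o' : F} {P : Set E} {Q : Set F} (h : PLH P Q) (hP : Cn o P) (hQ : Cn o' Q) :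
    PLH (Cone o P) (Cone o' Q) := by
  obtain ⟨Γ, hΓ, h1, h2, rfl, rfl⟩ := h
  refine ⟨Cone (o, o') Γ, Cone_poly _ hΓ, ?_, ?_, ?_, ?_⟩
  · rintro _ ⟨p, hp, t, ht, ht1, rfl⟩ _ ⟨q, hq, u, hu, hu1, rfl⟩ h
    obtain ⟨rfl, h'⟩ := hP p.1 ⟨p, hp, rfl⟩ q.1 ⟨q, hq, rfl⟩ t u ht ht1 hu hu1 h
    by_cases h0 : t = 0
    · simp [h0]
    · rw [h1 p hp q hq (h' h0)]
  · rintro _ ⟨p, hp, t, ht, ht1, rfl⟩ _ ⟨q, hq, u, hu, hu1, rfl⟩ h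
    obtain ⟨rfl, h'⟩ := hQ p.2 ⟨p, hp, rfl⟩ q.2 ⟨q, hq, rfl⟩ t u ht ht1 hu hu1 h
    by_cases h0 : t = 0
    · simp [h0]
    · rw [h2 p hp q hq (h' h0)]
  · ext x; constructor
    · rintro ⟨_, ⟨p, hp, t, ht, ht1, rfl⟩, rfl⟩
      exact ⟨p.1, ⟨p, hp, rfl⟩, t, ht, ht1, rfl⟩
    · rintro ⟨_, ⟨p, hp, rfl⟩, t, ht, ht1, rfl⟩
      exact ⟨_, ⟨p, hp, t, ht, ht1, rfl⟩, rfl⟩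
  · ext x; constructor
    · rintro ⟨_, ⟨p, hp, t, ht, ht1, rfl⟩, rfl⟩
      exact ⟨p.2, ⟨p, hp, rfl⟩, t, ht, ht1, rfl⟩
    · rintro ⟨_, ⟨p, hp, rfl⟩, t, ht, ht1, rfl⟩
      exact ⟨_, ⟨p, hp, t, ht, ht1, rfl⟩, rfl⟩

variable {X : Type*}

/-- Simplicial cone. -/
def coneC (a : X) (M : Set (Finset X)) : Set (Finset X) :=
  {s | s.Nonempty ∧ (s.erase a = ∅ ∨ s.erase a ∈ M)}

lemma mem_coneC [DecidableEq X] {a : X} {M : Set (Finset X)} {s : Finset X} :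
    s ∈ coneC a M ↔ s.Nonempty ∧ (s.erase a = ∅ ∨ s.erase a ∈ M) := by
  unfold coneC
  rw [Set.mem_setOf_eq]
  have e : ∀ i1 i2 : DecidableEq X, @Finset.erase X i1 s a = @Finset.erase X i2 s a :=
    fun i1 i2 => by rw [Subsingleton.elim i1 i2]
  rw [e]

lemma coneC_cpx {a : X} {M : Set (Finset X)} (hM : Cpx M) : Cpx (coneC a M) := by
  refine ⟨fun h => by simpa using h.1, fun s hs t ht hn => ⟨hn, ?_⟩⟩
  rcases (t.erase a).eq_empty_or_nonempty with h | h
  · exact Or.inl h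
  · right
    have hsub := Finset.erase_subset_erase a ht
    rcases hs.2 with h' | h'
    · rw [h'] at hsub; exact absurd (Finset.subset_empty.1 hsub) h.ne_empty
    · exact hM.2 _ h' _ hsub h

lemma insert_coneC {a : X} {M : Set (Finset X)} (ha : ∀ s ∈ M, a ∉ s) {s : Finset X} (hs : s ∈ M) :
    insert a s ∈ coneC a M :=
  ⟨by simp, Or.inr (by rwa [Finset.erase_insert (ha s hs)])⟩

lemma cone_Wt {a : X} {M : Set (Finset X)} (hM : Cpx M) (ha : ∀ s ∈ M, a ∉ s) {w : X →₀ ℝ} (hw : w ∈ Wt M)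
    {t : ℝ} (h0 : 0 ≤ t) (h1 : t ≤ 1) : (1 - t) • Finsupp.single a (1 : ℝ) + t • w ∈ Wt (coneC a M) := by
  refine Sx_Wt (coneC_cpx hM) (insert_coneC ha hw.2.1) (Sx_convex _ ?_ ?_ (by linarith) h0 (by ring))
  · exact single_mem_Sx (by simp)
  · exact Sx_mono (Finset.subset_insert _ _) (Wt_Sx hw)

lemma car_coneC {a : X} {M : Set (Finset X)} (hM : Cpx M) (hMn : M.Nonempty) (ha : ∀ s ∈ M, a ∉ s) (g : X → E) :
    car g (coneC a M) = Cone (g a) (car g M) := by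
  apply Set.Subset.antisymm
  · rw [car_eq (coneC_cpx hM)]
    intro x hx
    simp only [Set.mem_iUnion, exists_prop] at hx
    obtain ⟨s, hs, hx⟩ := hx
    have hsub : (g '' (s : Set X)) ⊆ insert (g a) (g '' (s.erase a : Finset X)) := by
      rintro _ ⟨i, hi, rfl⟩
      by_cases h : i = a
      · left; rw [h]
      · right; exact ⟨i, by simpa [h] using hi, rfl⟩
    have hx := convexHull_mono (𝕜 := ℝ) hsub hx
    rcases hs.2 with h | h
    · rw [h] at hx
      simp only [Finset.coe_empty, Set.image_empty, insert_empty_eq, convexHull_singleton,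
        Set.mem_singleton_iff] at hx
      obtain ⟨s', hs'⟩ := hMn
      refine ⟨_, ⟨_, unif_mem_Wt hM hs', rfl⟩, 0, le_rfl, zero_le_one, by simp [hx]⟩
    · have hne : (s.erase a).Nonempty := by
        rw [Finset.nonempty_iff_ne_empty]; rintro h'; exact hM.1 (h' ▸ h)
      rw [convexHull_insert ((Finset.coe_nonempty.2 hne).image g), mem_convexJoin] at hx
      obtain ⟨_, rfl, y, hy, a, b, ha, hb, hab, rfl⟩ := hx
      exact ⟨y, conv_subset_car hM h hy, b, hb, by linarith, by rw [← hab]; simp⟩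
  · rintro _ ⟨_, ⟨w, hw, rfl⟩, t, h0, h1, rfl⟩
    exact ⟨_, cone_Wt hM ha hw h0 h1, by
    rw [map_add, map_smul, map_smul, lam, Finsupp.linearCombination_single, one_smul]⟩

lemma Cn_of_GR {a : X} {M : Set (Finset X)} (hM : Cpx M) (ha : ∀ s ∈ M, a ∉ s) {g : X → E}
    (hg : GR g (coneC a M)) : Cn (g a) (car g M) := by
  rintro _ ⟨w, hw, rfl⟩ _ ⟨w', hw', rfl⟩ t u h0 h1 k0 k1 h
  have hl : ∀ (t : ℝ) (w : X →₀ ℝ), lam g ((1 - t) • Finsupp.single a (1 : ℝ) + t • w) =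
    (1 - t) • g a + t • lam g w := fun t w => by
    rw [map_add, map_smul, map_smul, lam, Finsupp.linearCombination_single, one_smul]
  rw [← hl, ← hl] at h
  have h := hg (cone_Wt hM ha hw h0 h1) (cone_Wt hM ha hw' k0 k1) h
  have e1 : w a = 0 := Finsupp.notMem_support_iff.1 (ha _ hw.2.1)
  have e2 : w' a = 0 := Finsupp.notMem_support_iff.1 (ha _ hw'.2.1)
  have h2 := DFunLike.congr_fun h a
  simp [e1, e2] at h2
  subst h2
  refine ⟨rfl, fun hne => ?_⟩
  have h3 := smul_right_injective _ hne (add_left_cancel h)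
  rw [h3]

lemma ball_cone {a : X} {M : Set (Finset X)} (hM : Cpx M) (ha : ∀ s ∈ M, a ∉ s) {g : X → E}
    (hg : GR g (coneC a M)) {k : ℕ} (h : Ball k (car g M)) : Ball (k + 1) (car g (coneC a M)) := by
  obtain ⟨A, hA, h⟩ := h
  have hAn : A.Nonempty := Finset.card_pos.1 (by omega)
  obtain ⟨b, hb⟩ := Infinite.exists_notMem_finset A
  have hS : (stdBall (insert b A) : Set (Finset ℕ)) = coneC b (stdBall A : Set (Finset ℕ)) := by
    ext s
    rw [mem_coneC]
    simp only [stdBall, Finset.mem_coe, Finset.mem_erase, Finset.mem_powerset,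
      Finset.subset_insert_iff, Finset.nonempty_iff_ne_empty]
    constructor
    · rintro ⟨h1, h2⟩
      refine ⟨h1, ?_⟩
      by_cases h : s.erase b = ∅
      · exact Or.inl h
      · exact Or.inr ⟨h, h2⟩
    · rintro ⟨h1, h | h⟩
      · exact ⟨h1, by rw [h]; simp⟩
      · exact ⟨h1, h.2⟩
  have hbA : ∀ s ∈ (stdBall A : Set (Finset ℕ)), b ∉ s := by
    intro s hs h
    simp only [stdBall, Finset.mem_coe, Finset.mem_erase, Finset.mem_powerset] at hs
    exact hb (hs.2 h)
  have hAS : (stdBall A : Set (Finset ℕ)).Nonempty := ⟨A, by simp [stdBall, hAn.ne_empty]⟩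
  have hMn : M.Nonempty := by
    obtain ⟨Γ, -, -, -, h3, h4⟩ := h
    obtain ⟨x, hx⟩ := DD_nonempty hAn
    rw [← h4] at hx
    obtain ⟨p, hp, -⟩ := hx
    have : p.1 ∈ car g M := h3 ▸ ⟨p, hp, rfl⟩
    obtain ⟨w, hw, -⟩ := this
    exact ⟨_, hw.2.1⟩
  refine ⟨insert b A, by rw [Finset.card_insert_of_notMem hb, hA], ?_⟩
  rw [← car_stdBall] at h ⊢
  rw [hS, car_coneC hM hMn ha, car_coneC (stdBall_cpx A) hAS hbA]
  exact Cone_PLH h (Cn_of_GR hM ha hg) (Cn_of_GR (stdBall_cpx A) hbA (GR_ee _))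

end cone

section collapse
variable {X Y E : Type*} [AddCommGroup E] [Module ℝ E]

lemma car_reindex [DecidableEq Y] {K : Set (Finset X)} {K' : Set (Finset Y)} (hK : Cpx K) (hK' : Cpx K') (φ : X → Y)
    (h : ∀ t, t ∈ K' ↔ ∃ s ∈ K, s.image φ = t) (g : Y → E) : car (fun x => g (φ x)) K = car g K' := by
  rw [car_eq hK, car_eq hK']
  ext x
  simp only [Set.mem_iUnion, exists_prop]
  have e : ∀ s : Finset X, (fun x => g (φ x)) '' (s : Set X) = g '' ((s.image φ : Finset Y) : Set Y) := by
    intro s; rw [Finset.coe_image, Set.image_image]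
  constructor
  · rintro ⟨s, hs, hx⟩
    rw [e] at hx
    exact ⟨_, (h _).2 ⟨s, hs, rfl⟩, hx⟩
  · rintro ⟨t, ht, hx⟩
    obtain ⟨s, hs, rfl⟩ := (h _).1 ht
    exact ⟨s, hs, by rw [e]; exact hx⟩

lemma GR_reindex [DecidableEq Y] {K : Set (Finset X)} {K' : Set (Finset Y)} (hK' : Cpx K') (φ : X → Y)
    (S : Set X) (hS : ∀ s ∈ K, (s : Set X) ⊆ S) (hφ : Set.InjOn φ S)
    (h : ∀ t, t ∈ K' ↔ ∃ s ∈ K, s.image φ = t) {g : Y → E} (hg : GR g K') : GR (fun x => g (φ x)) K := by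
  have e : ∀ w : X →₀ ℝ, lam (fun x => g (φ x)) w = lam g (w.mapDomain φ) := by
    intro w; rw [lam, lam, Finsupp.linearCombination_mapDomain]; rfl
  have hm : ∀ w ∈ Wt K, w.mapDomain φ ∈ Wt K' := fun w hw =>
    Sx_Wt hK' ((h _).2 ⟨_, hw.2.1, rfl⟩) (mapDomain_Sx φ (Wt_Sx hw))
  intro w hw u hu he
  rw [e, e] at he
  exact Finsupp.mapDomain_injOn S hφ (hS _ hw.2.1) (hS _ hu.2.1) (hg (hm w hw) (hm u hu) he)

/-- Collapsing a cone from its apex onto its base. -/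
lemma collapse_cone {M M' N : Set (Finset Y)} {g : Y → ℕ → ℝ} (hg : GR g M) (hN : Cpx N) {a : Y}
    (ha : ∀ s ∈ N, a ∉ s) (h1 : M = M' ∪ coneC a N) (h2 : M' ∩ coneC a N = N) {k : ℕ}
    (hk : Ball k (car g N)) : PolyElemCollapse (car g M) (car g M') := by
  have hs1 : M' ⊆ M := h1 ▸ Set.subset_union_left
  have hs2 : coneC a N ⊆ M := h1 ▸ Set.subset_union_right
  refine ⟨k + 1, by omega, car g (coneC a N), (ball_cone hN ha (hg.mono hs2) hk).isPLBall, ?_, ?_⟩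
  · rw [← car_union, ← h1]
  · rw [car_inter hg hs1 hs2, h2]; exact hk.isPLBall

/-- Proper cofaces. -/
def Up (K : Set (Finset X)) (τ : Finset X) : Set (Finset X) := {σ | σ ∈ K ∧ τ ⊂ σ}

lemma Up_PLH {K : Set (Finset X)} (hK : Cpx K) (hKf : K.Finite) {f : X → ℕ → ℝ} (hf : GR f K) {τ : Finset X}
    (hfin : (Ch (Up K τ)).Finite) : PLH (car (bary f) (Ch (Up K τ))) (car f (Lk K τ)) := by
  have hC := Ch_cpx (Up K τ)
  have hC' := Ch_cpx (Lk K τ)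
  have hsub : Ch (Up K τ) ⊆ Ch K := fun s hs => ⟨hs.1, fun a ha => (hs.2.1 a ha).1, hs.2.2⟩
  have hb := (GR_bary hK hf).mono hsub
  have hinj : Set.InjOn (fun σ : Finset X => σ \ τ) (Up K τ) := by
    intro σ hσ ρ hρ h
    simp only at h
    rw [← Finset.sdiff_union_of_subset hσ.2.subset, h, Finset.sdiff_union_of_subset hρ.2.subset]
  have himg : ∀ t, t ∈ Ch (Lk K τ) ↔ ∃ s ∈ Ch (Up K τ), s.image (fun σ : Finset X => σ \ τ) = t := by
    intro t
    constructor
    · intro ht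
      refine ⟨t.image (fun σ => σ ∪ τ), ⟨ht.1.image _, ?_, ?_⟩, ?_⟩
      · intro a ha
        obtain ⟨σ, hσ, rfl⟩ := Finset.mem_image.1 ha
        have h := ht.2.1 σ hσ
        refine ⟨h.2.2, Finset.ssubset_iff_subset_ne.2 ⟨Finset.subset_union_right, fun he => ?_⟩⟩
        obtain ⟨i, hi⟩ := h.1
        have h3 : i ∈ τ := by rw [he]; exact Finset.mem_union_left _ hi
        exact Finset.disjoint_left.1 h.2.1 hi h3
      · intro a ha b hb
        obtain ⟨σ, hσ, rfl⟩ := Finset.mem_image.1 ha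
        obtain ⟨ρ, hρ, rfl⟩ := Finset.mem_image.1 hb
        rcases ht.2.2 σ hσ ρ hρ with h | h
        · exact Or.inl (Finset.union_subset_union h subset_rfl)
        · exact Or.inr (Finset.union_subset_union h subset_rfl)
      · rw [Finset.image_image]
        conv_rhs => rw [← Finset.image_id (s := t)]
        refine Finset.image_congr fun σ hσ => ?_
        simp only [Function.comp, id]
        rw [Finset.union_sdiff_right, Finset.sdiff_eq_self_of_disjoint (ht.2.1 σ hσ).2.1]
    · rintro ⟨s, hs, rfl⟩
      refine ⟨hs.1.image _, ?_, ?_⟩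
      · intro a ha
        obtain ⟨σ, hσ, rfl⟩ := Finset.mem_image.1 ha
        have h := hs.2.1 σ hσ
        refine ⟨Finset.sdiff_nonempty.2 fun h' => h.2.2 h', Finset.sdiff_disjoint, ?_⟩
        rw [Finset.sdiff_union_of_subset h.2.subset]; exact h.1
      · intro a ha b hb
        obtain ⟨σ, hσ, rfl⟩ := Finset.mem_image.1 ha
        obtain ⟨ρ, hρ, rfl⟩ := Finset.mem_image.1 hb
        rcases hs.2.2 σ hσ ρ hρ with h | h
        · exact Or.inl (Finset.sdiff_subset_sdiff h subset_rfl)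
        · exact Or.inr (Finset.sdiff_subset_sdiff h subset_rfl)
  have hgl : GR (bary f) (Ch (Lk K τ)) := GR_bary (Lk_cpx hK τ) (hf.mono (Lk_sub hK τ))
  have hr := GR_reindex hC' (fun σ : Finset X => σ \ τ) (Up K τ)
    (fun (s : Finset (Finset X)) (hs : s ∈ Ch (Up K τ)) a ha => hs.2.1 a ha) hinj himg hgl
  have h := PLH.simp hfin hC hb hr
  rwa [car_reindex hC hC' (fun σ : Finset X => σ \ τ) himg (bary f), car_bary (Lk_cpx hK τ)] at h

lemma Ch_finite {K : Set (Finset X)} (hKf : K.Finite) : (Ch K).Finite := by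
  refine (hKf.toFinset.powerset.finite_toSet).subset fun s hs => ?_
  rw [Finset.mem_coe, Finset.mem_powerset]
  intro a ha
  exact hKf.mem_toFinset.2 (hs.2.1 a ha)

lemma stage1_step {K Q : Set (Finset X)} (hK : Cpx K) (hKf : K.Finite) {f : X → ℕ → ℝ} (hf : GR f K)
    (hQ : Q ⊆ K) {τ : Finset X} (hτ : τ ∈ Q) (hup : Up K τ ⊆ Q) (hlow : ∀ σ ∈ Q, ¬ σ ⊂ τ) {k : ℕ}
    (hk : Ball k (car f (Lk K τ))) :
    PolyElemCollapse (car (bary f) (Ch Q)) (car (bary f) (Ch (Q \ {τ}))) := by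
  have hQM : Ch Q ⊆ Ch K := fun s hs => ⟨hs.1, fun a ha => hQ (hs.2.1 a ha), hs.2.2⟩
  have hUf : (Ch (Up K τ)).Finite := Ch_finite (hKf.subset fun σ hσ => hσ.1)
  have haU : ∀ s ∈ Ch (Up K τ), τ ∉ s := fun s hs h => (hs.2.1 τ h).2.2 subset_rfl
  have hkU := Ball.of_PLH (Up_PLH hK hKf hf hUf) hk
  refine collapse_cone ((GR_bary hK hf).mono hQM) (Ch_cpx _) haU ?_ ?_ hkU
  · ext s
    constructor
    · intro hs
      by_cases h : τ ∈ s
      · right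
        refine mem_coneC.2 ⟨hs.1, ?_⟩
        rcases (s.erase τ).eq_empty_or_nonempty with h' | h'
        · exact Or.inl h'
        · right
          refine ⟨h', fun σ hσ => ?_, fun a ha b hb =>
            hs.2.2 a (Finset.mem_of_mem_erase ha) b (Finset.mem_of_mem_erase hb)⟩
          obtain ⟨hne, hσ⟩ := Finset.mem_erase.1 hσ
          refine ⟨hQ (hs.2.1 σ hσ), ?_⟩
          rcases hs.2.2 σ hσ τ h with h1 | h1
          · exact absurd (Finset.ssubset_iff_subset_ne.2 ⟨h1, hne⟩) (hlow σ (hs.2.1 σ hσ))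
          · exact Finset.ssubset_iff_subset_ne.2 ⟨h1, hne.symm⟩
      · left
        exact ⟨hs.1, fun a ha => ⟨hs.2.1 a ha, fun h' => h (Set.mem_singleton_iff.1 h' ▸ ha)⟩, hs.2.2⟩
    · rintro (hs | hs)
      · exact ⟨hs.1, fun a ha => (hs.2.1 a ha).1, hs.2.2⟩
      · rw [mem_coneC] at hs
        have hel : ∀ a ∈ s, a = τ ∨ a ∈ s.erase τ := fun a ha => by
          by_cases h : a = τ
          · exact Or.inl h
          · exact Or.inr (Finset.mem_erase.2 ⟨h, ha⟩)
        rcases hs.2 with h | h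
        · have hel' : ∀ a ∈ s, a = τ := fun a ha => (hel a ha).resolve_right (by rw [h]; simp)
          refine ⟨hs.1, fun a ha => hel' a ha ▸ hτ, fun a ha b hb => ?_⟩
          rw [hel' a ha, hel' b hb]; exact Or.inl subset_rfl
        · refine ⟨hs.1, fun a ha => ?_, fun a ha b hb => ?_⟩
          · rcases hel a ha with rfl | h'
            · exact hτ
            · exact hup (h.2.1 a h')
          · rcases hel a ha with rfl | ha'
            · rcases hel b hb with rfl | hb'
              · exact Or.inl subset_rfl
              · exact Or.inl (h.2.1 b hb').2.subset
            · rcases hel b hb with rfl | hb'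
              · exact Or.inr (h.2.1 a ha').2.subset
              · exact h.2.2 a ha' b hb'
  · ext s
    constructor
    · rintro ⟨h1, h2⟩
      have hn : τ ∉ s := fun h => (h1.2.1 τ h).2 rfl
      have h3 := (mem_coneC.1 h2).2
      rw [Finset.erase_eq_of_notMem hn] at h3
      exact h3.resolve_left h1.1.ne_empty
    · intro hs
      refine ⟨⟨hs.1, fun a ha => ⟨hup (hs.2.1 a ha), fun h => haU s hs (Set.mem_singleton_iff.1 h ▸ ha)⟩, hs.2.2⟩,
        mem_coneC.2 ⟨hs.1, Or.inr ?_⟩⟩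
      rwa [Finset.erase_eq_of_notMem (haU s hs)]

lemma stage1 {K D : Set (Finset X)} (hK : Cpx K) (hKf : K.Finite) {f : X → ℕ → ℝ} (hf : GR f K)
    (hD : ∀ s ∈ D, ∀ t ⊆ s, t ∈ K → t ∈ D)
    (hball : ∀ τ ∈ D, ∃ k, Ball k (car f (Lk K τ))) (n : ℕ) : ∀ Q : Set (Finset X), Q ⊆ K → K \ D ⊆ Q →
      (∀ σ ∈ Q, ∀ ρ ∈ K, σ ⊆ ρ → ρ ∈ Q) → (Q ∩ D).ncard = n →
      PolyCollapsesTo (car (bary f) (Ch Q)) (car (bary f) (Ch (K \ D))) := by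
  induction n with
  | zero =>
    intro Q hQ hDQ _ hn
    have hfin : (Q ∩ D).Finite := hKf.subset (Set.inter_subset_left.trans hQ)
    rw [Set.ncard_eq_zero hfin] at hn
    have : Q = K \ D := Set.Subset.antisymm (fun s hs => ⟨hQ hs, fun h => by
      have : s ∈ Q ∩ D := ⟨hs, h⟩
      rw [hn] at this; exact this⟩) hDQ
    rw [this]
    exact Relation.ReflTransGen.refl
  | succ n ih =>
    intro Q hQ hDQ hup hn
    have hfin : (Q ∩ D).Finite := hKf.subset (Set.inter_subset_left.trans hQ)
    have hne : (Q ∩ D).Nonempty := Set.nonempty_of_ncard_ne_zero (by omega)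
    obtain ⟨τ, hτ, hmin⟩ := Set.exists_min_image _ Finset.card hfin hne
    have hlow : ∀ σ ∈ Q, ¬ σ ⊂ τ := fun σ hσ h =>
      absurd (Finset.card_lt_card h) (not_lt.2 (hmin σ ⟨hσ, hD τ hτ.2 σ h.subset (hQ hσ)⟩))
    obtain ⟨k, hk⟩ := hball τ hτ.2
    refine Relation.ReflTransGen.head (stage1_step hK hKf hf hQ hτ.1 (fun σ hσ => hup τ hτ.1 σ hσ.1 hσ.2.subset) hlow hk)
      (ih _ (Set.diff_subset.trans hQ) ?_ ?_ ?_)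
    · intro s hs
      exact ⟨hDQ hs, fun h => hs.2 (Set.mem_singleton_iff.1 h ▸ hτ.2)⟩
    · intro σ hσ ρ hρ hs
      refine ⟨hup σ hσ.1 ρ hρ hs, fun h => ?_⟩
      rw [Set.mem_singleton_iff] at h
      subst h
      exact hlow σ hσ.1 (Finset.ssubset_iff_subset_ne.2 ⟨hs, fun h => hσ.2 h⟩)
    · have : (Q \ {τ}) ∩ D = (Q ∩ D) \ {τ} := by ext s; simp only [Set.mem_inter_iff, Set.mem_diff]; tauto
      rw [this, Set.ncard_sdiff_singleton_of_mem hτ, hn]; rfl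

end collapse

section stage2
variable {X Y : Type*}

/-- All nonempty faces of a simplex. -/
def Fa (s : Finset Y) : Set (Finset Y) := {t | t.Nonempty ∧ t ⊆ s}

/-- Faces of a simplex not containing a given facet. -/
def Hn (s u : Finset Y) : Set (Finset Y) := {t | t.Nonempty ∧ t ⊆ s ∧ ¬ u ⊆ t}

lemma Fa_cpx (s : Finset Y) : Cpx (Fa s) :=
  ⟨fun h => by simpa using h.1, fun _ hs _ ht hn => ⟨hn, ht.trans hs.2⟩⟩

lemma Hn_cpx (s u : Finset Y) : Cpx (Hn s u) :=
  ⟨fun h => by simpa using h.1, fun _ hs _ ht hn => ⟨hn, ht.trans hs.2.1, fun h => hs.2.2 (h.trans ht)⟩⟩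

lemma Fa_finite (s : Finset Y) : (Fa s).Finite :=
  (s.powerset.finite_toSet).subset fun t ht => by
    rw [Finset.mem_coe, Finset.mem_powerset]; exact ht.2

lemma Fa_ball [DecidableEq Y] {s : Finset Y} (hs : s.Nonempty) {g : Y → ℕ → ℝ} (hg : GR g (Fa s)) :
    Ball (s.card - 1) (car g (Fa s)) := by
  obtain ⟨φ, hφ⟩ := Set.countable_iff_exists_injOn.1 s.countable_toSet
  have himg : ∀ t, t ∈ (stdBall (s.image φ) : Set (Finset ℕ)) ↔ ∃ r ∈ Fa s, r.image φ = t := by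
    intro t
    simp only [stdBall, Finset.mem_coe, Finset.mem_erase, Finset.mem_powerset]
    constructor
    · rintro ⟨h1, h2⟩
      obtain ⟨r, hr, rfl⟩ := Finset.subset_image_iff.1 h2
      refine ⟨r, ⟨?_, hr⟩, rfl⟩
      exact Finset.image_nonempty.1 (Finset.nonempty_iff_ne_empty.2 h1)
    · rintro ⟨r, hr, rfl⟩
      exact ⟨(hr.1.image φ).ne_empty, Finset.image_subset_image hr.2⟩
  have hr := GR_reindex (stdBall_cpx _) φ (s : Set Y) (fun t ht => Finset.coe_subset.2 ht.2) hφ himg (GR_ee _)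
  have h := PLH.simp (Fa_finite s) (Fa_cpx s) hg hr
  rw [car_reindex (Fa_cpx s) (stdBall_cpx _) φ himg ee, car_stdBall] at h
  refine ⟨s.image φ, ?_, h⟩
  rw [Finset.card_image_of_injOn hφ]
  have := hs.card_pos
  omega

lemma Hn_ball [DecidableEq Y] {s : Finset Y} {a : Y} (ha : a ∈ s) (hs : (s.erase a).Nonempty) {g : Y → ℕ → ℝ}
    (hg : GR g (Fa s)) : Ball (s.card - 1 - 1) (car g (Hn s (s.erase a))) := by
  obtain ⟨φ, hφ⟩ := Set.countable_iff_exists_injOn.1 s.countable_toSet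
  have hsub : Hn s (s.erase a) ⊆ Fa s := fun t ht => ⟨ht.1, ht.2.1⟩
  have key : ∀ r ⊆ s, (s.erase a).image φ ⊆ r.image φ ↔ s.erase a ⊆ r := by
    intro r hr
    constructor
    · intro h x hx
      obtain ⟨y, hy, he⟩ := Finset.mem_image.1 (h (Finset.mem_image_of_mem φ hx))
      rwa [← hφ (hr hy) (Finset.mem_of_mem_erase hx) he]
    · exact fun h => Finset.image_subset_image h
  have hAs : (s.erase a).image φ ⊆ s.image φ := Finset.image_subset_image (Finset.erase_subset _ _)
  have himg : ∀ t, t ∈ lk (stdBall (s.image φ) : Set (Finset ℕ)) ((s.erase a).image φ) ↔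
      ∃ r ∈ Hn s (s.erase a), r.image φ = t := by
    intro t
    rw [mem_lk]
    simp only [stdBall, Finset.mem_coe, Finset.mem_erase, Finset.mem_powerset]
    constructor
    · rintro ⟨h1, h2, h3, h4⟩
      obtain ⟨r, hr, rfl⟩ := Finset.subset_image_iff.1 (Finset.subset_union_left.trans h4)
      exact ⟨r, ⟨Finset.image_nonempty.1 h1, hr, fun h => h2 ((key r hr).2 h)⟩, rfl⟩
    · rintro ⟨r, hr, rfl⟩
      exact ⟨hr.1.image φ, fun h => hr.2.2 ((key r hr.2.1).1 h),
        ((hr.1.image φ).mono Finset.subset_union_left).ne_empty,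
        Finset.union_subset (Finset.image_subset_image hr.2.1) hAs⟩
  have hr := GR_reindex (lk_cpx (stdBall_cpx _) _) φ (s : Set Y)
    (fun t ht => Finset.coe_subset.2 ht.2.1) hφ himg (GR_ee _)
  have h := PLH.simp ((Fa_finite s).subset hsub) (Hn_cpx s _) (hg.mono hsub) hr
  rw [car_reindex (Hn_cpx s _) (lk_cpx (stdBall_cpx _) _) φ himg ee, lk_stdBall hAs] at h
  have ha' : φ a ∉ (s.erase a).image φ := by
    intro h
    obtain ⟨y, hy, he⟩ := Finset.mem_image.1 h
    exact (Finset.mem_erase.1 hy).1 (hφ (Finset.mem_of_mem_erase hy) ha he)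
  have h2 := ZB_PLH ha' (Finset.mem_image_of_mem φ ha) (hs.image φ) hAs
  refine ⟨_, ?_, h.trans h2⟩
  rw [Finset.card_erase_of_mem (Finset.mem_image_of_mem φ ha), Finset.card_image_of_injOn hφ]
  have := hs.card_pos
  rw [Finset.card_erase_of_mem ha] at this
  omega

lemma horn_collapse [DecidableEq Y] {g : Y → ℕ → ℝ} {m a : Y} (hma : m ≠ a) (n : ℕ) :
    ∀ M : Set (Finset Y), M.Finite → Cpx M → GR g M → (∀ s ∈ M, m ∈ s → insert a s ∈ M) →
      {s | s ∈ M ∧ m ∈ s}.ncard = n →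
      PolyCollapsesTo (car g M) (car g {s | s ∈ M ∧ m ∉ s}) := by
  induction n using Nat.strong_induction_on with
  | _ n ih =>
  intro M hMf hM hg H hn
  have hfin : {s | s ∈ M ∧ m ∈ s}.Finite := hMf.subset fun s hs => hs.1
  rcases Set.eq_empty_or_nonempty {s | s ∈ M ∧ m ∈ s} with he | hne
  · have : {s | s ∈ M ∧ m ∉ s} = M := by
      ext s
      exact ⟨fun h => h.1, fun h => ⟨h, fun h' => by
        have : s ∈ {s | s ∈ M ∧ m ∈ s} := ⟨h, h'⟩
        rw [he] at this; exact this⟩⟩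
    rw [this]
    exact Relation.ReflTransGen.refl
  · obtain ⟨s, ⟨hsM, hms⟩, hmax⟩ := Set.exists_max_image _ Finset.card hfin hne
    have has : a ∈ s := by
      by_contra h
      have := hmax (insert a s) ⟨H s hsM hms, Finset.mem_insert_of_mem hms⟩
      rw [Finset.card_insert_of_notMem h] at this
      omega
    have hmu : m ∈ s.erase a := Finset.mem_erase.2 ⟨hma, hms⟩
    have hun : (s.erase a).Nonempty := ⟨m, hmu⟩
    have huM : s.erase a ∈ M := hM.2 s hsM _ (Finset.erase_subset _ _) hun
    have htop : ∀ t ∈ M, s.erase a ⊆ t → t = s ∨ t = s.erase a := by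
      intro t ht hut
      have h1 : s ⊆ insert a t := by
        intro x hx
        by_cases hxa : x = a
        · rw [hxa]; exact Finset.mem_insert_self _ _
        · exact Finset.mem_insert_of_mem (hut (Finset.mem_erase.2 ⟨hxa, hx⟩))
      have h2 := Finset.eq_of_subset_of_card_le h1
        (hmax (insert a t) ⟨H t ht (hut hmu), Finset.mem_insert_of_mem (hut hmu)⟩)
      by_cases hat : a ∈ t
      · left; rw [h2, Finset.insert_eq_of_mem hat]
      · right; rw [h2, Finset.erase_insert hat]
    set M' : Set (Finset Y) := {t | t ∈ M ∧ ¬ s.erase a ⊆ t} with hM'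
    have hM'c : Cpx M' := ⟨fun h => hM.1 h.1, fun r hr t ht hn =>
      ⟨hM.2 r hr.1 t ht hn, fun h => hr.2 (h.trans ht)⟩⟩
    have hM's : M' ⊆ M := fun t ht => ht.1
    have hFs : Fa s ⊆ M := fun t ht => hM.2 s hsM t ht.2 ht.1
    have hrem : {t | t ∈ M' ∧ m ∉ t} = {t | t ∈ M ∧ m ∉ t} := by
      ext t
      exact ⟨fun h => ⟨h.1.1, h.2⟩, fun h => ⟨⟨h.1, fun h' => h.2 (h' hmu)⟩, h.2⟩⟩
    have hlt : {t | t ∈ M' ∧ m ∈ t}.ncard < n := by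
      rw [← hn]
      refine Set.ncard_lt_ncard ((Set.ssubset_iff_of_subset ?_).2 ?_) hfin
      · exact fun t ht => ⟨ht.1.1, ht.2⟩
      exact ⟨s, ⟨hsM, hms⟩, fun h => h.1.2 (Finset.erase_subset _ _)⟩
    have hH' : ∀ t ∈ M', m ∈ t → insert a t ∈ M' := by
      intro t ht hmt
      refine ⟨H t ht.1 hmt, fun h => ht.2 ?_⟩
      intro x hx
      exact (Finset.mem_insert.1 (h hx)).resolve_left (Finset.mem_erase.1 hx).1
    have hrec := ih _ hlt M' (hMf.subset hM's) hM'c (hg.mono hM's) hH' rfl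
    rw [hrem] at hrec
    refine Relation.ReflTransGen.head ?_ hrec
    have hcard : 1 ≤ s.card - 1 := by
      have := hun.card_pos
      rw [Finset.card_erase_of_mem has] at this
      omega
    refine ⟨s.card - 1, hcard, car g (Fa s), (Fa_ball ⟨a, has⟩ (hg.mono hFs)).isPLBall, ?_, ?_⟩
    · rw [← car_union]
      congr 1
      ext t
      constructor
      · intro ht
        by_cases h : s.erase a ⊆ t
        · right
          rcases htop t ht h with rfl | rfl
          · exact ⟨⟨a, has⟩, subset_rfl⟩
          · exact ⟨hun, Finset.erase_subset _ _⟩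
        · exact Or.inl ⟨ht, h⟩
      · rintro (h | h)
        · exact h.1
        · exact hFs h
    · rw [car_inter hg hM's hFs]
      have : M' ∩ Fa s = Hn s (s.erase a) := by
        ext t
        exact ⟨fun h => ⟨h.2.1, h.2.2, h.1.2⟩, fun h => ⟨⟨hFs ⟨h.1, h.2.1⟩, h.2.2⟩, h.1, h.2.1⟩⟩
      rw [this]
      exact (Hn_ball has hun (hg.mono hFs)).isPLBall

lemma stage2_aux {L : Set (Finset X)} {g : Finset X → ℕ → ℝ} (ρ : Finset X → Finset X) (n : ℕ) :
    ∀ Q : Set (Finset X), Q.Finite → L ⊆ Q → GR g (Ch Q) →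
      (∀ m ∈ Q, m ∉ L → ρ m ∈ L ∧ ρ m ⊆ m ∧ ∀ σ ∈ L, σ ⊆ m → σ ⊆ ρ m) →
      (Q \ L).ncard = n → PolyCollapsesTo (car g (Ch Q)) (car g (Ch L)) := by
  induction n using Nat.strong_induction_on with
  | _ n ih =>
  intro Q hQf hLQ hg hρ hn
  have hfin : (Q \ L).Finite := hQf.subset Set.sdiff_subset
  rcases Set.eq_empty_or_nonempty (Q \ L) with he | hne
  · rw [Set.Subset.antisymm hLQ (Set.sdiff_eq_empty.1 he)]
    exact Relation.ReflTransGen.refl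
  · obtain ⟨m, ⟨hmQ, hmL⟩, hmin⟩ := Set.exists_min_image _ Finset.card hfin hne
    obtain ⟨h1, h2, h3⟩ := hρ m hmQ hmL
    have hma : m ≠ ρ m := fun h => hmL (h ▸ h1)
    have hH : ∀ s ∈ Ch Q, m ∈ s → insert (ρ m) s ∈ Ch Q := by
      intro s hs hms
      have hc : ∀ b ∈ s, ρ m ⊆ b ∨ b ⊆ ρ m := by
        intro b hb
        rcases hs.2.2 m hms b hb with h | h
        · exact Or.inl (h2.trans h)
        · by_cases hbL : b ∈ L
          · exact Or.inr (h3 b hbL h)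
          · have := Finset.eq_of_subset_of_card_le h (hmin b ⟨hs.2.1 b hb, hbL⟩)
            rw [this]; exact Or.inl h2
      refine ⟨Finset.insert_nonempty _ _, fun b hb => ?_, fun b hb c hc' => ?_⟩
      · rcases Finset.mem_insert.1 hb with rfl | hb
        · exact hLQ h1
        · exact hs.2.1 b hb
      · rcases Finset.mem_insert.1 hb with rfl | hb
        · rcases Finset.mem_insert.1 hc' with rfl | hc'
          · exact Or.inl subset_rfl
          · exact hc c hc'
        · rcases Finset.mem_insert.1 hc' with rfl | hc'
          · exact (hc b hb).symm
          · exact hs.2.2 b hb c hc'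
    have hc := horn_collapse hma _ (Ch Q) (Ch_finite hQf) (Ch_cpx Q) hg hH rfl
    have hrem : {s | s ∈ Ch Q ∧ m ∉ s} = Ch (Q \ {m}) := by
      ext s
      constructor
      · rintro ⟨hs, hm⟩
        exact ⟨hs.1, fun b hb => ⟨hs.2.1 b hb, fun h => hm (Set.mem_singleton_iff.1 h ▸ hb)⟩, hs.2.2⟩
      · intro hs
        exact ⟨⟨hs.1, fun b hb => (hs.2.1 b hb).1, hs.2.2⟩, fun hm => (hs.2.1 m hm).2 rfl⟩
    rw [hrem] at hc
    have hCh : Ch (Q \ {m}) ⊆ Ch Q := by rw [← hrem]; exact fun s hs => hs.1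
    refine hc.trans (ih _ ?_ (Q \ {m}) (hQf.subset Set.sdiff_subset) ?_ (hg.mono hCh)
      (fun b hb => hρ b hb.1) rfl)
    · rw [← hn]
      refine Set.ncard_lt_ncard ((Set.ssubset_iff_of_subset ?_).2 ?_) hfin
      · exact fun t ht => ⟨ht.1.1, ht.2⟩
      exact ⟨m, ⟨hmQ, hmL⟩, fun h => h.1.2 rfl⟩
    · exact fun s hs => ⟨hLQ hs, fun h => hmL (Set.mem_singleton_iff.1 h ▸ hs)⟩

end stage2

section final
variable {X : Type*}

lemma final_aux (d : ℕ) (K : Finset (Finset X)) (hK : IsCombManifoldWithBdry d K)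
    (hind : IsInduced K (bdryComplex d K)) (G : GComplex) (f : X → ℕ → ℝ) (hG : RealizesMap G K f) :
    PolyCollapsesTo G.carrier (subCarrier f (simpComplement (bdryComplex d K) K)) := by
  obtain ⟨hKc, hlink, -⟩ := hK
  have hC := cpx_of_isComplex hKc
  have hf := realizes_GR hG
  have hKf : (K : Set (Finset X)).Finite := K.finite_toSet
  have hne : ∀ s ∈ K, s.Nonempty := fun s hs => Finset.nonempty_iff_ne_empty.2 fun h => hKc.2.1 (h ▸ hs)
  have hlk : ∀ v, (link K {v} : Set (Finset X)) = Lk (K : Set (Finset X)) {v} := by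
    intro v
    ext s
    simp only [link, Finset.mem_coe, Finset.mem_filter]
    constructor
    · rintro ⟨h1, h2, h3⟩
      exact ⟨hne s h1, h2, h3⟩
    · rintro ⟨h1, h2, h3⟩
      exact ⟨hKc.2.2 _ h3 s Finset.subset_union_left h1, h2, h3⟩
  have hv : ∀ v, {v} ∈ (K : Set (Finset X)) → Ball (d - 1) (car f (Lk (K : Set (Finset X)) {v})) ∨
      Sph (d - 1) (car f (Lk (K : Set (Finset X)) {v})) := by
    intro v hv
    have hvv : v ∈ verts K := mem_verts.2 ⟨_, hv, Finset.mem_singleton_self v⟩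
    have hc : Cpx (link K {v} : Set (Finset X)) := by rw [hlk]; exact Lk_cpx hC _
    have hg : GR f (link K {v} : Set (Finset X)) := by rw [hlk]; exact hf.mono (Lk_sub hC _)
    rw [← hlk]
    rcases hlink v hvv with h | h
    · exact Or.inr (sph_of_comb hc h hg)
    · exact Or.inl (ball_of_comb hc h hg)
  set D := bdryComplex d K with hD
  have hmD : ∀ t, t ∈ D ↔ t ∈ K ∧ ∃ s ∈ K, t ⊆ s ∧ s.card = d ∧ degOf K d s = 1 := by
    intro t; rw [hD, bdryComplex, Finset.mem_filter]
  have hball : ∀ τ ∈ (D : Set (Finset X)), ∃ k, Ball k (car f (Lk (K : Set (Finset X)) τ)) := by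
    intro τ hτ
    obtain ⟨h1, s, hs, hts, hsd, hdeg⟩ := (hmD τ).1 hτ
    refine ⟨_, bdry_ball hC hKf hf d hv (hne τ h1) hs hts hsd ?_⟩
    intro v w hv hw hvs hws
    obtain ⟨t, ht⟩ := Finset.card_eq_one.1 hdeg
    have e : ∀ v, insert v s ∈ K → v ∉ s → insert v s = t := by
      intro v hv hvs
      refine Finset.mem_singleton.1 ?_
      rw [← ht, Finset.mem_filter]
      exact ⟨hv, Finset.subset_insert _ _, by rw [Finset.card_insert_of_notMem hvs, hsd]⟩
    have h2 : v ∈ insert w s := by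
      rw [e w hw hws, ← e v hv hvs]; exact Finset.mem_insert_self _ _
    exact (Finset.mem_insert.1 h2).resolve_right hvs
  have hDd : ∀ s ∈ (D : Set (Finset X)), ∀ t ⊆ s, t ∈ (K : Set (Finset X)) → t ∈ (D : Set (Finset X)) := by
    intro s hs t hts ht
    obtain ⟨-, r, hr, hsr, h⟩ := (hmD s).1 hs
    exact (hmD t).2 ⟨ht, r, hr, hts.trans hsr, h⟩
  have st1 := stage1 hC hKf hf hDd hball _ (K : Set (Finset X)) subset_rfl Set.sdiff_subset
    (fun _ _ ρ hρ _ => hρ) rfl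
  rw [car_bary hC, ← realizes_car hC hG] at st1
  set L := simpComplement D K with hL
  have hmL : ∀ t, t ∈ L ↔ t ∈ K ∧ t ⊆ verts K \ verts D := by
    intro t; rw [hL, simpComplement, Finset.mem_filter]
  have hLc : Cpx (L : Set (Finset X)) := ⟨fun h => hC.1 ((hmL _).1 h).1, fun s hs t hts hn =>
    (hmL t).2 ⟨hC.2 s ((hmL s).1 hs).1 t hts hn, hts.trans ((hmL s).1 hs).2⟩⟩
  have hLK : (L : Set (Finset X)) ⊆ K := fun s hs => ((hmL s).1 hs).1
  have hLD : (L : Set (Finset X)) ⊆ (K : Set (Finset X)) \ D := by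
    intro s hs
    refine ⟨hLK hs, fun hsD => ?_⟩
    obtain ⟨x, hx⟩ := hne s (hLK hs)
    exact (Finset.mem_sdiff.1 (((hmL s).1 hs).2 hx)).2 (sub_verts hsD hx)
  have hCh : Ch ((K : Set (Finset X)) \ D) ⊆ Ch (K : Set (Finset X)) :=
    fun s hs => ⟨hs.1, fun a ha => (hs.2.1 a ha).1, hs.2.2⟩
  have st2 := stage2_aux (L := (L : Set (Finset X))) (fun m => m \ verts D) _ ((K : Set (Finset X)) \ D)
    (hKf.subset Set.sdiff_subset) hLD ((GR_bary hC hf).mono hCh) (by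
      intro m hm _
      have hn : (m \ verts D).Nonempty := by
        rw [Finset.sdiff_nonempty]
        exact fun h => hm.2 (hind.2 m hm.1 h)
      refine ⟨(hmL _).2 ⟨hC.2 m hm.1 _ Finset.sdiff_subset hn,
        Finset.sdiff_subset_sdiff (sub_verts hm.1) subset_rfl⟩, Finset.sdiff_subset, ?_⟩
      intro σ hσ hσm x hx
      exact Finset.mem_sdiff.2 ⟨hσm hx, (Finset.mem_sdiff.1 (((hmL σ).1 hσ).2 hx)).2⟩) rfl
  rw [car_bary hLc, ← subCarrier_eq hLc] at st2
  exact st1.trans st2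

end final


/-- Proposition 3, Simplicial Neighbourhood Theorem consequence:
if `K` is a combinatorial `d`-manifold with boundary whose boundary `∂K` is an
induced subcomplex, and `L` is the simplicial complement of `∂K` in `K`, then
the polyhedron `|K|` collapses to `|L|`. -/
theorem carrier_collapses_to_complement_of_boundary {V : Type*} [DecidableEq V]
    (d : ℕ) (K : Finset (Finset V))
    (hK : IsCombManifoldWithBdry d K)
    (hind : IsInduced K (bdryComplex d K)) :
    ∀ (G : GComplex) (f : V → ℕ → ℝ), RealizesMap G K f →
      PolyCollapsesTo G.carrier
        (subCarrier f (simpComplement (bdryComplex d K) K)) := by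
  obtain rfl : ‹DecidableEq V› = fun a b => Classical.propDecidable (a = b) := Subsingleton.elim _ _
  intro G f hG
  exact final_aux d K hK hind G f hG

end HomologySpheres
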